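/- For every real k > 0, as τ → 0+, (1/(2π))·∫_ℝ τ^{7/8}·Φ_{τ,k}(u) / ((u*_τ(k) + iτ^{3/8}u)·(u*_τ(k) − √τ + iτ^{3/8}u)) du = (τ^{7/8}·β_t/(ζ(k)·√(2π)))·(1 + p₁(k)·τ^{1/4} + o(τ^{1/4})). -/

import Mathlib

open Filter Topology Asymptotics MeasureTheory

set_option linter.unusedVariables false

noncomputable section


/-- sign convention of the paper: 1 if `0 ≤ x`, -1 otherwise. -/
def sgn' (x : ℝ) : ℝ := if 0 ≤ x then 1 else -1

/-- principal-branch complex square root `d` of the Heston Riccati discriminant. -/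
def hestD (κ ρ ξ : ℝ) (w : ℂ) : ℂ :=
  (((κ : ℂ) - (ρ : ℂ) * (ξ : ℂ) * w) ^ 2 + w * (1 - w) * (ξ : ℂ) ^ 2) ^ ((1 : ℂ) / 2)

def hestGamma (κ ρ ξ : ℝ) (w : ℂ) : ℂ :=
  ((κ : ℂ) - (ρ : ℂ) * (ξ : ℂ) * w - hestD κ ρ ξ w) /
    ((κ : ℂ) - (ρ : ℂ) * (ξ : ℂ) * w + hestD κ ρ ξ w)

def hestB (κ ρ ξ : ℝ) (w : ℂ) (τ : ℝ) : ℂ :=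
  (((κ : ℂ) - (ρ : ℂ) * (ξ : ℂ) * w - hestD κ ρ ξ w) / (ξ : ℂ) ^ 2) *
    ((1 - Complex.exp (-(hestD κ ρ ξ w) * (τ : ℂ))) /
      (1 - hestGamma κ ρ ξ w * Complex.exp (-(hestD κ ρ ξ w) * (τ : ℂ))))

def hestA (κ θ ρ ξ : ℝ) (w : ℂ) (τ : ℝ) : ℂ :=
  ((κ * θ / ξ ^ 2 : ℝ) : ℂ) *
    (((κ : ℂ) - (ρ : ℂ) * (ξ : ℂ) * w - hestD κ ρ ξ w) * (τ : ℂ) -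
      2 * Complex.log ((1 - hestGamma κ ρ ξ w * Complex.exp (-(hestD κ ρ ξ w) * (τ : ℂ))) /
        (1 - hestGamma κ ρ ξ w)))

def betaT (κ ξ t : ℝ) : ℝ := ξ ^ 2 * (1 - Real.exp (-(κ * t))) / (4 * κ)

/-- explicit Heston forward log-mgf `G_τ(w)`. -/
def hestG (κ θ ξ v ρ t : ℝ) (w : ℂ) (τ : ℝ) : ℂ :=
  hestA κ θ ρ ξ w τ +
    hestB κ ρ ξ w τ * (v : ℂ) * ((Real.exp (-(κ * t)) : ℝ) : ℂ) /
      (1 - 2 * (betaT κ ξ t : ℂ) * hestB κ ρ ξ w τ) -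
    ((2 * κ * θ / ξ ^ 2 : ℝ) : ℂ) *
      Complex.log (1 - 2 * (betaT κ ξ t : ℂ) * hestB κ ρ ξ w τ)

/-- rescaled forward log-mgf, for complex argument. -/
def hestLambdaC (κ θ ξ v ρ t τ : ℝ) (z : ℂ) : ℂ :=
  ((Real.sqrt τ : ℝ) : ℂ) * hestG κ θ ξ v ρ t (z / ((Real.sqrt τ : ℝ) : ℂ)) τ

/-- rescaled forward log-mgf `Λ_τ(u) = √τ · G_τ(u/√τ)`. -/
def hestLambda (κ θ ξ v ρ t τ : ℝ) (u : ℝ) : ℂ :=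
  hestLambdaC κ θ ξ v ρ t τ (u : ℂ)

/-- `D_{t,τ}`: the maximal open interval containing `0` on which `Λ_τ` is real-valued. -/
def hestDom (κ θ ξ v ρ t τ : ℝ) : Set ℝ :=
  connectedComponentIn (interior {u : ℝ | (hestLambda κ θ ξ v ρ t τ u).im = 0}) 0



def B1hat (ρ ξ u : ℝ) : ℝ := u / 4 * (u ^ 2 * ρ * ξ - 2)
/-- the derivative of `B1hat` in `u`. -/
def B1hat' (ρ ξ u : ℝ) : ℝ := (3 * u ^ 2 * ρ * ξ - 2) / 4

def coefA0 (κ θ ξ v ρ t k : ℝ) : ℝ := sgn' k / Real.sqrt (betaT κ ξ t)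

def coefA1 (κ θ ξ v ρ t k : ℝ) : ℝ :=
  -(coefA0 κ θ ξ v ρ t k) * Real.sqrt v * Real.exp (-(κ * t) / 2) /
    (2 * Real.sqrt |k| * betaT κ ξ t ^ ((1 : ℝ) / 4))

def coefA2 (κ θ ξ v ρ t k : ℝ) : ℝ :=
  -(κ * θ) / (k * ξ ^ 2) - B1hat ρ ξ (coefA0 κ θ ξ v ρ t k) / coefA0 κ θ ξ v ρ t k

def coefA3 (κ θ ξ v ρ t k : ℝ) : ℝ :=
  (2 * betaT κ ξ t * coefA1 κ θ ξ v ρ t k ^ 3 / (ξ ^ 4 * v ^ 2)) *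
    (ξ ^ 2 * v * betaT κ ξ t * Real.exp (κ * t) *
        (|k| * ξ ^ 2 * Real.sqrt (betaT κ ξ t) * B1hat ρ ξ (coefA0 κ θ ξ v ρ t k) -
          k * ξ ^ 2 * B1hat' ρ ξ (coefA0 κ θ ξ v ρ t k) - κ * θ) +
      (2 * κ * θ * betaT κ ξ t * Real.exp (κ * t)) ^ 2 - ξ ^ 4 * v ^ 2 / 16)

def coefE0 (κ θ ξ v ρ t k : ℝ) : ℝ := -2 * coefA1 κ θ ξ v ρ t k / coefA0 κ θ ξ v ρ t k

def coefR (κ θ ξ v ρ t k : ℝ) : ℝ :=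
  coefA1 κ θ ξ v ρ t k ^ 2 / 2 - κ * θ / (|k| * ξ ^ 2 * Real.sqrt (betaT κ ξ t))

def coefE1 (κ θ ξ v ρ t k : ℝ) : ℝ := -2 * betaT κ ξ t * coefR κ θ ξ v ρ t k

def coefE2 (κ θ ξ v ρ t k : ℝ) : ℝ :=
  -2 * betaT κ ξ t *
    (coefA1 κ θ ξ v ρ t k * coefA2 κ θ ξ v ρ t k + coefA0 κ θ ξ v ρ t k * coefA3 κ θ ξ v ρ t k +
      coefA1 κ θ ξ v ρ t k * B1hat' ρ ξ (coefA0 κ θ ξ v ρ t k))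

def coefZeta (κ θ ξ v ρ t k : ℝ) : ℝ :=
  2 * Real.sqrt v * Real.exp (-(κ * t) / 2) / coefE0 κ θ ξ v ρ t k ^ ((3 : ℝ) / 2)

def coefPsi0 (κ θ ξ v ρ t k : ℝ) : ℝ :=
  (coefA0 κ θ ξ v ρ t k * v * Real.exp (-(κ * t)) / coefE0 κ θ ξ v ρ t k ^ 3) *
    (coefE0 κ θ ξ v ρ t k ^ 2 +
      coefA0 κ θ ξ v ρ t k * betaT κ ξ t *
        (3 * coefA1 κ θ ξ v ρ t k * coefE0 κ θ ξ v ρ t k -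
          2 * coefA0 κ θ ξ v ρ t k * coefE1 κ θ ξ v ρ t k))

def coefPsi1 (κ θ ξ v ρ t k : ℝ) : ℝ :=
  -4 * coefA0 κ θ ξ v ρ t k * v * betaT κ ξ t * Real.exp (-(κ * t)) / coefE0 κ θ ξ v ρ t k ^ 4

def coefPsi2 (κ θ ξ v ρ t k : ℝ) : ℝ :=
  (v * Real.exp (-(κ * t)) / (2 * coefE0 κ θ ξ v ρ t k ^ 4)) *
    (4 * coefA0 κ θ ξ v ρ t k * betaT κ ξ t *
        (3 * coefA0 κ θ ξ v ρ t k * coefE1 κ θ ξ v ρ t k -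
          4 * coefA1 κ θ ξ v ρ t k * coefE0 κ θ ξ v ρ t k) -
      5 * coefE0 κ θ ξ v ρ t k ^ 2)

def coefPsi3 (κ θ ξ v ρ t k : ℝ) : ℝ :=
  8 * v * betaT κ ξ t * Real.exp (-(κ * t)) / coefE0 κ θ ξ v ρ t k ^ 5

def coefPsi4 (κ θ ξ v ρ t k : ℝ) : ℝ :=
  (v * Real.exp (-(κ * t)) / (2 * coefE0 κ θ ξ v ρ t k ^ 3)) *
    ((coefE1 κ θ ξ v ρ t k ^ 2 - coefE0 κ θ ξ v ρ t k * coefE2 κ θ ξ v ρ t k) / betaT κ ξ t -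
      2 * coefA0 κ θ ξ v ρ t k * coefA1 κ θ ξ v ρ t k * coefE0 κ θ ξ v ρ t k *
        coefE1 κ θ ξ v ρ t k +
      2 * coefE0 κ θ ξ v ρ t k ^ 2 * coefR κ θ ξ v ρ t k)

def coefPhi2a (κ θ ξ v ρ t k : ℝ) : ℝ :=
  coefPsi2 κ θ ξ v ρ t k - coefPsi0 κ θ ξ v ρ t k ^ 2 / 2 -
    (4 * κ * θ * betaT κ ξ t / ξ ^ 2) * (2 * κ * θ + ξ ^ 2) / (coefE0 κ θ ξ v ρ t k ^ 2 * ξ ^ 2) -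
    (4 * κ * θ * betaT κ ξ t / ξ ^ 2) *
      (coefA0 κ θ ξ v ρ t k * coefPsi0 κ θ ξ v ρ t k / coefE0 κ θ ξ v ρ t k)

def coefPhi2b (κ θ ξ v ρ t k : ℝ) : ℝ :=
  coefPsi3 κ θ ξ v ρ t k - coefPsi0 κ θ ξ v ρ t k * coefPsi1 κ θ ξ v ρ t k -
    (4 * κ * θ * betaT κ ξ t / ξ ^ 2) *
      (coefA0 κ θ ξ v ρ t k * coefPsi1 κ θ ξ v ρ t k / coefE0 κ θ ξ v ρ t k)

def coefPhi2c (κ θ ξ v ρ t k : ℝ) : ℝ := -(coefPsi1 κ θ ξ v ρ t k ^ 2) / 2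

def coefC0 (κ θ ξ v ρ t k : ℝ) : ℝ := 2 * |coefA1 κ θ ξ v ρ t k * k|

def coefC1 (κ θ ξ v ρ t k : ℝ) : ℝ :=
  (v * Real.exp (-(κ * t)) / coefE0 κ θ ξ v ρ t k) *
      (coefA0 κ θ ξ v ρ t k * coefA1 κ θ ξ v ρ t k -
        coefE1 κ θ ξ v ρ t k / (2 * betaT κ ξ t * coefE0 κ θ ξ v ρ t k)) -
    coefA2 κ θ ξ v ρ t k * k

def coefC2 (κ θ ξ v ρ t k : ℝ) : ℝ := coefE0 κ θ ξ v ρ t k ^ (-(2 * κ * θ / ξ ^ 2))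

def coefZ1 (κ θ ξ v ρ t k : ℝ) : ℝ :=
  coefPsi4 κ θ ξ v ρ t k - coefA3 κ θ ξ v ρ t k * k -
    (2 * κ * θ / ξ ^ 2) * (coefE1 κ θ ξ v ρ t k / coefE0 κ θ ξ v ρ t k)

def coefP1 (κ θ ξ v ρ t k : ℝ) : ℝ :=
  coefE0 κ θ ξ v ρ t k + coefPhi2a κ θ ξ v ρ t k / coefZeta κ θ ξ v ρ t k ^ 2 +
    3 * coefPhi2b κ θ ξ v ρ t k / coefZeta κ θ ξ v ρ t k ^ 4 +
    15 * coefPhi2c κ θ ξ v ρ t k / coefZeta κ θ ξ v ρ t k ^ 6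

def phi1C (κ θ ξ v ρ t k u : ℝ) : ℂ :=
  Complex.I * (u : ℂ) *
      ((coefPsi0 κ θ ξ v ρ t k +
          4 * coefA0 κ θ ξ v ρ t k * κ * θ * betaT κ ξ t / (coefE0 κ θ ξ v ρ t k * ξ ^ 2) : ℝ) : ℂ) +
    Complex.I * (u : ℂ) ^ 3 * ((coefPsi1 κ θ ξ v ρ t k : ℝ) : ℂ)

def phi2R (κ θ ξ v ρ t k u : ℝ) : ℝ :=
  u ^ 2 * coefPhi2a κ θ ξ v ρ t k + u ^ 4 * coefPhi2b κ θ ξ v ρ t k +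
    u ^ 6 * coefPhi2c κ θ ξ v ρ t k


/-- the characteristic function `Φ_{τ,k}(u)` under the asymptotic measure change. -/
def hestPhi (κ θ ξ v ρ t k : ℝ) (ustar : ℝ → ℝ) (τ u : ℝ) : ℂ :=
  Complex.exp (-(Complex.I) * (u : ℂ) * (k : ℂ) * ((τ ^ (-(1 : ℝ) / 8) : ℝ) : ℂ) +
    ((τ ^ (-(1 : ℝ) / 2) : ℝ) : ℂ) *
      (hestLambdaC κ θ ξ v ρ t τ
          ((ustar τ : ℝ) + Complex.I * (u : ℂ) * ((τ ^ ((3 : ℝ) / 8) : ℝ) : ℂ)) -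
        hestLambdaC κ θ ξ v ρ t τ ((ustar τ : ℝ) : ℂ)))

/-! ### Entire functions `cosh √x` and `sinh √x / √x` -/

def chs (x : ℂ) : ℂ := ∑' n : ℕ, x ^ n / ((2 * n).factorial : ℂ)
def shs (x : ℂ) : ℂ := ∑' n : ℕ, x ^ n / ((2 * n + 1).factorial : ℂ)

lemma chs_sq (d : ℂ) : chs (d ^ 2) = Complex.cosh d := by
  rw [← (Complex.hasSum_cosh d).tsum_eq]
  unfold chs
  congr 1; ext n; rw [pow_mul]

lemma mul_shs_sq (d : ℂ) : d * shs (d ^ 2) = Complex.sinh d := by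
  rw [← (Complex.hasSum_sinh d).tsum_eq]
  unfold shs
  rw [← tsum_mul_left]
  congr 1; ext n; rw [← pow_mul]; ring

lemma fact_term_bound (x : ℂ) (R : ℝ) (hR : 0 ≤ R) (hx : ‖x‖ ≤ R) (n k : ℕ) (hk : n ≤ k) :
    ‖x ^ n / (k.factorial : ℂ)‖ ≤ R ^ n / (n.factorial : ℝ) := by
  rw [norm_div, norm_pow, Complex.norm_natCast]
  have h1 : (n.factorial : ℝ) ≤ k.factorial := by exact_mod_cast Nat.factorial_le hk
  have h2 : (0:ℝ) < n.factorial := by exact_mod_cast Nat.factorial_pos n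
  gcongr

lemma chs_differentiable : Differentiable ℂ chs := by
  intro x
  have h : DifferentiableOn ℂ chs (Metric.ball 0 (‖x‖ + 1)) := by
    apply Complex.differentiableOn_tsum_of_summable_norm (u := fun n => (‖x‖ + 1) ^ n / (n.factorial : ℝ))
    · exact Real.summable_pow_div_factorial _
    · intro i; fun_prop
    · exact Metric.isOpen_ball
    · intro i w hw
      exact fact_term_bound w _ (by positivity) (by simpa using (Metric.mem_ball.1 hw).le) _ _ (by omega)
  exact h.differentiableAt (Metric.isOpen_ball.mem_nhds (by simp))

lemma shs_differentiable : Differentiable ℂ shs := by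
  intro x
  have h : DifferentiableOn ℂ shs (Metric.ball 0 (‖x‖ + 1)) := by
    apply Complex.differentiableOn_tsum_of_summable_norm (u := fun n => (‖x‖ + 1) ^ n / (n.factorial : ℝ))
    · exact Real.summable_pow_div_factorial _
    · intro i; fun_prop
    · exact Metric.isOpen_ball
    · intro i w hw
      exact fact_term_bound w _ (by positivity) (by simpa using (Metric.mem_ball.1 hw).le) _ _ (by omega)
  exact h.differentiableAt (Metric.isOpen_ball.mem_nhds (by simp))

lemma exists_sq (x : ℂ) : ∃ d : ℂ, d ^ 2 = x := ⟨x ^ ((1:ℂ)/2), by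
  rw [← Complex.cpow_nat_mul]; simp⟩

lemma chs_bound (x : ℂ) (hx : ‖x‖ ≤ 1) : ‖chs x - 1‖ ≤ ‖x‖ := by
  obtain ⟨d, rfl⟩ := exists_sq x
  rw [norm_pow] at hx ⊢
  have hd : ‖d‖ ≤ 1 := by nlinarith [norm_nonneg d]
  rw [chs_sq, Complex.cosh]
  have h1 := Complex.norm_exp_sub_one_sub_id_le hd
  have h2 := Complex.norm_exp_sub_one_sub_id_le (x := -d) (by simpa using hd)
  rw [norm_neg] at h2
  have : (Complex.exp d + Complex.exp (-d)) / 2 - 1 =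
    ((Complex.exp d - 1 - d) + (Complex.exp (-d) - 1 - -d)) / 2 := by ring
  rw [this, norm_div]
  have := norm_add_le (Complex.exp d - 1 - d) (Complex.exp (-d) - 1 - -d)
  simp only [Complex.norm_ofNat]
  linarith

lemma exp_three (d : ℂ) (hd : ‖d‖ ≤ 1) : ‖Complex.exp d - (1 + d + d ^ 2 / 2)‖ ≤ ‖d‖ ^ 3 := by
  have h := Complex.exp_bound hd (n := 3) (by norm_num)
  simp [Finset.sum_range_succ, Nat.factorial] at h
  refine le_trans h ?_
  have : 0 ≤ ‖d‖ ^ 3 := by positivity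
  nlinarith

lemma shs_bound (x : ℂ) (hx : ‖x‖ ≤ 1) : ‖shs x - 1‖ ≤ ‖x‖ := by
  obtain ⟨d, rfl⟩ := exists_sq x
  rw [norm_pow] at hx ⊢
  have hd : ‖d‖ ≤ 1 := by nlinarith [norm_nonneg d]
  by_cases h0 : d = 0
  · subst h0
    have : shs 0 = 1 := by
      unfold shs
      rw [tsum_eq_single 0]
      · simp
      · intro b hb; simp [hb]
    simp [this]
  have h1 := exp_three d hd
  have h2 := exp_three (-d) (by simpa using hd)
  rw [norm_neg] at h2
  have h3 : d * (shs (d ^ 2) - 1) =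
    ((Complex.exp d - (1 + d + d ^ 2 / 2)) - (Complex.exp (-d) - (1 + -d + (-d) ^ 2 / 2))) / 2 := by
    rw [mul_sub, mul_shs_sq, Complex.sinh]; ring
  have h4 : ‖d * (shs (d ^ 2) - 1)‖ ≤ ‖d‖ ^ 3 := by
    rw [h3, norm_div]
    have := norm_sub_le (Complex.exp d - (1 + d + d ^ 2 / 2)) (Complex.exp (-d) - (1 + -d + (-d) ^ 2 / 2))
    simp only [Complex.norm_ofNat]
    linarith
  rw [norm_mul] at h4
  have hp : 0 < ‖d‖ := norm_pos_iff.2 h0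
  have : ‖d‖ * ‖shs (d ^ 2) - 1‖ ≤ ‖d‖ * ‖d‖ ^ 2 := by linarith [h4, pow_succ' ‖d‖ 2]
  exact le_of_mul_le_mul_left this hp

lemma chs_ofReal_im (x : ℝ) : (chs x).im = 0 := by
  rw [← Complex.conj_eq_iff_im]
  unfold chs
  rw [Complex.conj_tsum]
  congr 1; ext n; simp

lemma shs_ofReal_im (x : ℝ) : (shs x).im = 0 := by
  rw [← Complex.conj_eq_iff_im]
  unfold shs
  rw [Complex.conj_tsum]
  congr 1; ext n; simp

/-- Second order Taylor bound from a sup bound. -/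
lemma taylor_two {f : ℂ → ℂ} {R M : ℝ} (hf : DifferentiableOn ℂ f (Metric.ball 0 (R + 2)))
    (hM : ∀ z ∈ Metric.ball (0:ℂ) (R + 2), ‖f z‖ ≤ M) :
    (∀ z ∈ Metric.ball (0:ℂ) R, ‖deriv f z‖ ≤ 2 * M) ∧
    ∀ z ∈ Metric.ball (0:ℂ) R, ∀ z0 ∈ Metric.ball (0:ℂ) R,
      ‖f z - f z0 - deriv f z0 * (z - z0)‖ ≤ 4 * M * ‖z - z0‖ ^ 2 := by
  have sub1 : ∀ z ∈ Metric.ball (0:ℂ) (R+1), ∀ w ∈ Metric.closedBall z (1/2), w ∈ Metric.ball (0:ℂ) (R+2) := by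
    intro z hz w hw
    simp only [Metric.mem_ball, Metric.mem_closedBall, dist_zero_right] at *
    have := dist_triangle w z 0
    simp only [dist_zero_right] at this; linarith
  have sub0 : ∀ z ∈ Metric.ball (0:ℂ) R, ∀ w ∈ Metric.closedBall z (1/2), w ∈ Metric.ball (0:ℂ) (R+1) := by
    intro z hz w hw
    simp only [Metric.mem_ball, Metric.mem_closedBall, dist_zero_right] at *
    have := dist_triangle w z 0
    simp only [dist_zero_right] at this; linarith
  have d1 : ∀ z ∈ Metric.ball (0:ℂ) (R+1), ‖deriv f z‖ ≤ 2 * M := by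
    intro z hz
    have := Complex.norm_deriv_le_of_forall_mem_sphere_norm_le (f := f) (c := z) (R := 1/2) (C := M) (by norm_num)
      ((hf.mono (fun w hw => sub1 z hz w hw)).diffContOnCl_ball subset_rfl)
      (fun w hw => hM w (sub1 z hz w (Metric.sphere_subset_closedBall hw)))
    linarith
  have hfd : DifferentiableOn ℂ (deriv f) (Metric.ball 0 (R + 2)) := hf.deriv Metric.isOpen_ball
  have d2 : ∀ z ∈ Metric.ball (0:ℂ) R, ‖deriv (deriv f) z‖ ≤ 4 * M := by
    intro z hz
    have hz' : z ∈ Metric.ball (0:ℂ) (R+1) := Metric.ball_subset_ball (by linarith) hz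
    have := Complex.norm_deriv_le_of_forall_mem_sphere_norm_le (f := deriv f) (c := z) (R := 1/2) (C := 2*M) (by norm_num)
      ((hfd.mono (fun w hw => sub1 z hz' w hw)).diffContOnCl_ball subset_rfl)
      (fun w hw => d1 w (sub0 z hz w (Metric.sphere_subset_closedBall hw)))
    linarith
  have mem2 : ∀ z ∈ Metric.ball (0:ℂ) R, z ∈ Metric.ball (0:ℂ) (R+2) := fun z hz =>
    Metric.ball_subset_ball (by linarith) hz
  refine ⟨fun z hz => d1 z (Metric.ball_subset_ball (by linarith) hz), ?_⟩
  intro z hz z0 hz0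
  have m1 : ∀ w ∈ Metric.ball (0:ℂ) R, ‖deriv f w - deriv f z0‖ ≤ 4 * M * ‖w - z0‖ := fun w hw =>
    Convex.norm_image_sub_le_of_norm_deriv_le (s := Metric.ball (0:ℂ) R)
      (fun x hx => hfd.differentiableAt (Metric.isOpen_ball.mem_nhds (mem2 x hx))) d2 (convex_ball _ _) hz0 hw
  have hM0 : 0 ≤ M := le_trans (norm_nonneg _) (hM z (mem2 z hz))
  have hseg : segment ℝ z0 z ⊆ Metric.ball (0:ℂ) R := (convex_ball (0:ℂ) R).segment_subset hz0 hz
  have key := Convex.norm_image_sub_le_of_norm_deriv_le (f := fun w => f w - deriv f z0 * w)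
    (s := segment ℝ z0 z) (C := 4 * M * ‖z - z0‖)
    (fun x hx => by
      have := hf.differentiableAt (Metric.isOpen_ball.mem_nhds (mem2 x (hseg hx)))
      fun_prop)
    (fun x hx => by
      have hd := hf.differentiableAt (Metric.isOpen_ball.mem_nhds (mem2 x (hseg hx)))
      have : deriv (fun w => f w - deriv f z0 * w) x = deriv f x - deriv f z0 := by
        rw [deriv_fun_sub hd (by fun_prop)]; simp
      rw [this]
      refine (m1 x (hseg hx)).trans ?_
      have : ‖x - z0‖ ≤ ‖z - z0‖ := by
        have := norm_sub_le_of_mem_segment hx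
        exact this
      gcongr)
    (convex_segment _ _) (left_mem_segment ℝ z0 z) (right_mem_segment ℝ z0 z)
  calc _ = ‖f z - deriv f z0 * z - (f z0 - deriv f z0 * z0)‖ := by congr 1; ring
    _ ≤ _ := key
    _ = _ := by ring

def hC (κ ρ ξ q : ℝ) (z : ℂ) : ℂ := κ * q ^ 2 / 2 - ρ * ξ * z * q / 2
def hX (κ ρ ξ q : ℝ) (z : ℂ) : ℂ := q ^ 2 / 4 * ((κ * q - ρ * ξ * z) ^ 2 + z * (q - z) * ξ ^ 2)
def hDen (κ ρ ξ q : ℝ) (z : ℂ) : ℂ := chs (hX κ ρ ξ q z) + hC κ ρ ξ q z * shs (hX κ ρ ξ q z)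
def hBt (κ ρ ξ q : ℝ) (z : ℂ) : ℂ := (z ^ 2 - q * z) / 2 * shs (hX κ ρ ξ q z) / hDen κ ρ ξ q z
def hN (κ ρ ξ q : ℝ) (z : ℂ) : ℂ := (hBt κ ρ ξ q z - z ^ 2 / 2) / q
def hL (κ ρ ξ q : ℝ) (z : ℂ) : ℂ := (Complex.log (hDen κ ρ ξ q z) - hC κ ρ ξ q z) / q ^ 2

lemma hestD_sq (κ ρ ξ : ℝ) (w : ℂ) :
    hestD κ ρ ξ w ^ 2 = ((κ : ℂ) - (ρ : ℂ) * (ξ : ℂ) * w) ^ 2 + w * (1 - w) * (ξ : ℂ) ^ 2 := by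
  unfold hestD
  rw [← Complex.cpow_nat_mul]; simp

lemma cd_ne (κ ρ ξ : ℝ) (hξ : 0 < ξ) (w : ℂ) (h0 : w ≠ 0) (h1 : w ≠ 1) :
    (κ : ℂ) - (ρ : ℂ) * (ξ : ℂ) * w + hestD κ ρ ξ w ≠ 0 := by
  intro h
  have h2 := hestD_sq κ ρ ξ w
  have h3 : hestD κ ρ ξ w = -((κ : ℂ) - (ρ : ℂ) * (ξ : ℂ) * w) := by linear_combination h
  rw [h3] at h2
  have h4 : w * (1 - w) * (ξ : ℂ) ^ 2 = 0 := by linear_combination -h2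
  have hx : (ξ : ℂ) ≠ 0 := by exact_mod_cast hξ.ne'
  have : 1 - w ≠ 0 := sub_ne_zero.2 (Ne.symm h1)
  simp_all

lemma hX_eq (κ ρ ξ q : ℝ) (hq : 0 < q) (z : ℂ) :
    hX κ ρ ξ q z = (hestD κ ρ ξ (z / q) * (q ^ 2 : ℝ) / 2) ^ 2 := by
  have hq' : (q : ℂ) ≠ 0 := by exact_mod_cast hq.ne'
  rw [div_pow, mul_pow, hestD_sq]; unfold hX; push_cast; field_simp; ring

lemma repr_den (κ ρ ξ q : ℝ) (hξ : 0 < ξ) (hq : 0 < q) (z : ℂ) (hd : hestD κ ρ ξ (z / q) ≠ 0) :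
    hestD κ ρ ξ (z / q) * hDen κ ρ ξ q z =
      hestD κ ρ ξ (z / q) * Complex.cosh (hestD κ ρ ξ (z / q) * (q ^ 2 : ℝ) / 2) +
      (κ - ρ * ξ * (z / q)) * Complex.sinh (hestD κ ρ ξ (z / q) * (q ^ 2 : ℝ) / 2) := by
  have hq' : (q : ℂ) ≠ 0 := by exact_mod_cast hq.ne'
  unfold hDen
  rw [hX_eq κ ρ ξ q hq, ← mul_shs_sq, chs_sq]
  unfold hC; push_cast; field_simp

lemma one_sub_exp (D : ℂ) : Complex.exp D * (1 - Complex.exp (-(2 * D))) = 2 * Complex.sinh D := by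
  rw [mul_sub, ← Complex.exp_add, Complex.sinh]; ring_nf

lemma repr_log (κ ρ ξ q : ℝ) (hξ : 0 < ξ) (hq : 0 < q) (z : ℂ) (hd : hestD κ ρ ξ (z / q) ≠ 0)
    (h0 : z ≠ 0) (h1 : z ≠ q) :
    1 - hestGamma κ ρ ξ (z / q) * Complex.exp (-(hestD κ ρ ξ (z / q)) * ((q ^ 2 : ℝ) : ℂ)) =
      (1 - hestGamma κ ρ ξ (z / q)) *
      (Complex.exp (-(hestD κ ρ ξ (z / q) * (q ^ 2 : ℝ) / 2)) * hDen κ ρ ξ q z) ∧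
    1 - hestGamma κ ρ ξ (z / q) =
      2 * hestD κ ρ ξ (z / q) / (κ - ρ * ξ * (z / q) + hestD κ ρ ξ (z / q)) := by
  have hq' : (q : ℂ) ≠ 0 := by exact_mod_cast hq.ne'
  have w0 : z / q ≠ 0 := div_ne_zero h0 hq'
  have w1 : z / q ≠ 1 := by rw [Ne, div_eq_one_iff_eq hq']; exact h1
  have hcd := cd_ne κ ρ ξ hξ _ w0 w1
  have hden := repr_den κ ρ ξ q hξ hq z hd
  set w := z / q
  set d := hestD κ ρ ξ w
  set D := d * ((q ^ 2 : ℝ) : ℂ) / 2 with hD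
  have e1 : -d * ((q ^ 2 : ℝ) : ℂ) = -D + -D := by rw [hD]; ring
  have e2 : Complex.exp (-D) * Complex.exp D = 1 := by rw [← Complex.exp_add]; simp
  have h2 : 1 - hestGamma κ ρ ξ w = 2 * d / (κ - ρ * ξ * w + d) := by
    rw [hestGamma, eq_div_iff hcd, sub_mul, div_mul_cancel₀ _ hcd]; ring
  refine ⟨?_, h2⟩
  have h3 : (1 - hestGamma κ ρ ξ w) * (Complex.exp (-D) * hDen κ ρ ξ q z) =
     2 * Complex.exp (-D) * (d * hDen κ ρ ξ q z) / (κ - ρ * ξ * w + d) := by rw [h2]; ring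
  have h4 : hestGamma κ ρ ξ w * (κ - ρ * ξ * w + d) = κ - ρ * ξ * w - d := by
    rw [hestGamma, div_mul_cancel₀ _ hcd]
  rw [h3, hden, e1, Complex.exp_add, Complex.cosh, Complex.sinh, eq_div_iff hcd]
  linear_combination (-(κ - ρ * ξ * w + d)) * e2 - Complex.exp (-D) * Complex.exp (-D) * h4

lemma repr_B (κ ρ ξ q : ℝ) (hξ : 0 < ξ) (hq : 0 < q) (z : ℂ) (hd : hestD κ ρ ξ (z / q) ≠ 0)
    (h0 : z ≠ 0) (h1 : z ≠ q) :
    hestB κ ρ ξ (z / q) (q ^ 2) = hBt κ ρ ξ q z := by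
  obtain ⟨hl, hg⟩ := repr_log κ ρ ξ q hξ hq z hd h0 h1
  have hq' : (q : ℂ) ≠ 0 := by exact_mod_cast hq.ne'
  have hx : (ξ : ℂ) ≠ 0 := by exact_mod_cast hξ.ne'
  have w0 : z / q ≠ 0 := div_ne_zero h0 hq'
  have w1 : z / q ≠ 1 := by rw [Ne, div_eq_one_iff_eq hq']; exact h1
  have hcd := cd_ne κ ρ ξ hξ _ w0 w1
  have hsq := hestD_sq κ ρ ξ (z / q)
  unfold hestB hBt
  rw [hl, hg]
  have hXe := hX_eq κ ρ ξ q hq z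
  have hz : z = (z / q) * q := by field_simp
  set w := z / q
  set d := hestD κ ρ ξ w
  set D := d * ((q ^ 2 : ℝ) : ℂ) / 2 with hD
  have e1 : -d * ((q ^ 2 : ℝ) : ℂ) = -(2 * D) := by rw [hD]; ring
  have e3 : 1 - Complex.exp (-(2 * D)) = Complex.exp (-D) * (2 * (D * shs (hX κ ρ ξ q z))) := by
    rw [hXe, mul_shs_sq, ← one_sub_exp, ← mul_assoc, ← Complex.exp_add]; simp
  rw [e1, e3]
  have hE := Complex.exp_ne_zero (-D)
  set E := Complex.exp (-D)
  set S := shs (hX κ ρ ξ q z)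
  set H := hDen κ ρ ξ q z
  have hDq : D = d * q ^ 2 / 2 := by rw [hD]; push_cast; ring
  rw [hDq, hz]
  by_cases hH : H = 0
  · rw [hH]; simp
  field_simp
  linear_combination (-S) * hsq

lemma repr_A_re (κ θ ρ ξ q : ℝ) (hξ : 0 < ξ) (hq : 0 < q) (z : ℂ) (hd : hestD κ ρ ξ (z / q) ≠ 0)
    (h0 : z ≠ 0) (h1 : z ≠ q) (hH : hDen κ ρ ξ q z ≠ 0) :
    (hestA κ θ ρ ξ (z / q) (q ^ 2)).re =
      (κ * θ / ξ ^ 2) * (2 * (hC κ ρ ξ q z).re - 2 * Real.log ‖hDen κ ρ ξ q z‖) := by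
  obtain ⟨hl, hg⟩ := repr_log κ ρ ξ q hξ hq z hd h0 h1
  have hq' : (q : ℂ) ≠ 0 := by exact_mod_cast hq.ne'
  have w0 : z / q ≠ 0 := div_ne_zero h0 hq'
  have w1 : z / q ≠ 1 := by rw [Ne, div_eq_one_iff_eq hq']; exact h1
  have hcd := cd_ne κ ρ ξ hξ _ w0 w1
  have hgne : 1 - hestGamma κ ρ ξ (z / q) ≠ 0 := by
    rw [hg]; exact div_ne_zero (mul_ne_zero two_ne_zero hd) hcd
  unfold hestA
  rw [hl, mul_div_cancel_left₀ _ hgne, Complex.re_ofReal_mul]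
  congr 1
  have : 2 * Complex.log (Complex.exp (-(hestD κ ρ ξ (z / q) * (q ^ 2 : ℝ) / 2)) * hDen κ ρ ξ q z) =
    ((2:ℝ):ℂ) * Complex.log (Complex.exp (-(hestD κ ρ ξ (z / q) * (q ^ 2 : ℝ) / 2)) * hDen κ ρ ξ q z) := by norm_num
  rw [this, Complex.sub_re, Complex.re_ofReal_mul, Complex.log_re, norm_mul, Complex.norm_exp,
    Real.log_mul (Real.exp_pos _).ne' (norm_ne_zero_iff.2 hH), Real.log_exp]
  have e : (κ - ρ * ξ * (z / q) - hestD κ ρ ξ (z / q)) * ((q ^ 2 : ℝ) : ℂ) =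
    ((2:ℝ):ℂ) * hC κ ρ ξ q z + ((2:ℝ):ℂ) * (-(hestD κ ρ ξ (z / q) * (q ^ 2 : ℝ) / 2)) := by
    unfold hC; push_cast; field_simp; ring
  rw [e, Complex.add_re, Complex.re_ofReal_mul, Complex.re_ofReal_mul]; ring

lemma repr_A (κ θ ρ ξ q : ℝ) (hξ : 0 < ξ) (hq : 0 < q) (z : ℂ) (hd : hestD κ ρ ξ (z / q) ≠ 0)
    (h0 : z ≠ 0) (h1 : z ≠ q) (hH : hDen κ ρ ξ q z ≠ 0)
    (hlog : ‖Complex.log (hDen κ ρ ξ q z)‖ ≤ 1) (hX1 : ‖hX κ ρ ξ q z‖ ≤ 1) :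
    hestA κ θ ρ ξ (z / q) (q ^ 2) =
      -((2 * κ * θ / ξ ^ 2 : ℝ) : ℂ) * (q ^ 2 * hL κ ρ ξ q z) := by
  obtain ⟨hl, hg⟩ := repr_log κ ρ ξ q hξ hq z hd h0 h1
  have hq' : (q : ℂ) ≠ 0 := by exact_mod_cast hq.ne'
  have w0 : z / q ≠ 0 := div_ne_zero h0 hq'
  have w1 : z / q ≠ 1 := by rw [Ne, div_eq_one_iff_eq hq']; exact h1
  have hcd := cd_ne κ ρ ξ hξ _ w0 w1
  have hgne : 1 - hestGamma κ ρ ξ (z / q) ≠ 0 := by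
    rw [hg]; exact div_ne_zero (mul_ne_zero two_ne_zero hd) hcd
  have hXe := hX_eq κ ρ ξ q hq z
  unfold hestA hL
  rw [hl, mul_div_cancel_left₀ _ hgne]
  set D := hestD κ ρ ξ (z / q) * (q ^ 2 : ℝ) / 2 with hD
  have hDn : ‖D‖ ≤ 1 := by
    rw [hXe, norm_pow] at hX1; nlinarith [norm_nonneg D]
  have e1 : Complex.log (Complex.exp (-D) * hDen κ ρ ξ q z) = -D + Complex.log (hDen κ ρ ξ q z) := by
    conv_lhs => rw [← Complex.exp_log hH]
    rw [← Complex.exp_add]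
    have hp := Real.pi_gt_three
    have a1 := Complex.abs_im_le_norm (-D + Complex.log (hDen κ ρ ξ q z))
    have a2 := norm_add_le (-D) (Complex.log (hDen κ ρ ξ q z))
    rw [norm_neg] at a2
    have a3 := abs_le.1 a1
    apply Complex.log_exp <;> linarith
  rw [e1, hD]
  have hx : (ξ : ℂ) ≠ 0 := by exact_mod_cast hξ.ne'
  unfold hC
  push_cast; field_simp; ring

set_option maxHeartbeats 1000000 in
lemma den_bounds (κ ρ ξ R : ℝ) (hR : 0 < R) :
    ∃ q0 > 0, ∃ M > 0, ∀ q : ℝ, 0 < q → q < q0 → ∀ z ∈ Metric.ball (0:ℂ) R,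
      ‖hX κ ρ ξ q z‖ ≤ 1 ∧ ‖hDen κ ρ ξ q z - 1‖ ≤ 1 / 4 ∧ ‖Complex.log (hDen κ ρ ξ q z)‖ ≤ 1 ∧
      ‖hN κ ρ ξ q z‖ ≤ M ∧ ‖hL κ ρ ξ q z‖ ≤ M := by
  set c1 := |κ| + |ρ| * |ξ| * R with hc1
  set c2 := (|κ| + |ρ| * |ξ| * R) ^ 2 + R * (1 + R) * |ξ| ^ 2 with hc2
  set c3 := c2 + c1 * c2 with hc3
  set c4 := c1 + c3 with hc4
  have p1 : 0 ≤ c1 := by positivity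
  have p2 : 0 ≤ c2 := by positivity
  have p3 : 0 ≤ c3 := by positivity
  have p4 : 0 ≤ c4 := by positivity
  clear_value c4 c3 c2 c1
  refine ⟨1 / (4 * (1 + c4 + c2)), by positivity, (R ^ 2 * c2 + R ^ 2 * c4 + 2 * R) + (c4 ^ 2 + c3) + 1, by positivity, ?_⟩
  intro q hq hq0 z hz
  have hz : ‖z‖ ≤ R := by simpa using (Metric.mem_ball.1 hz).le
  have hq1 : q * (4 * (1 + c4 + c2)) < 1 := by rwa [lt_div_iff₀ (by positivity)] at hq0
  have q4 : q * c4 ≤ 1 / 4 := by nlinarith [mul_nonneg hq.le p2]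
  have q2 : q * c2 ≤ 1 / 4 := by nlinarith [mul_nonneg hq.le p4]
  have q1 : q ≤ 1 := by nlinarith [mul_nonneg hq.le p2, mul_nonneg hq.le p4]
  have nq : ‖(q : ℂ)‖ = q := by simp [abs_of_pos hq]
  have hqne : (q : ℂ) ≠ 0 := by exact_mod_cast hq.ne'
  have bC : ‖hC κ ρ ξ q z‖ ≤ c1 * q := by
    unfold hC
    refine (norm_sub_le _ _).trans ?_
    simp only [norm_div, norm_mul, norm_pow, nq, Complex.norm_real, Real.norm_eq_abs, Complex.norm_ofNat]
    have : |κ| * q ^ 2 ≤ |κ| * q := by gcongr; nlinarith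
    have : |ρ| * |ξ| * ‖z‖ * q ≤ |ρ| * |ξ| * R * q := by gcongr
    have : 0 ≤ |κ| * q := by positivity
    have : 0 ≤ |ρ| * |ξ| * R * q := by positivity
    rw [hc1]; linarith
  have bX : ‖hX κ ρ ξ q z‖ ≤ c2 * q ^ 2 := by
    unfold hX
    rw [norm_mul, norm_div, norm_pow, nq]
    have h1 : ‖((κ:ℂ) * q - ρ * ξ * z)‖ ≤ |κ| + |ρ| * |ξ| * R := by
      refine (norm_sub_le _ _).trans ?_
      simp only [norm_mul, nq, Complex.norm_real, Real.norm_eq_abs]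
      have : |κ| * q ≤ |κ| * 1 := by gcongr
      have : |ρ| * |ξ| * ‖z‖ ≤ |ρ| * |ξ| * R := by gcongr
      linarith
    have h2 : ‖(q:ℂ) - z‖ ≤ 1 + R := by
      refine (norm_sub_le _ _).trans ?_
      rw [nq]; linarith
    have h3 : ‖((κ:ℂ) * q - ρ * ξ * z) ^ 2 + z * (q - z) * ξ ^ 2‖ ≤ c2 := by
      refine (norm_add_le _ _).trans ?_
      simp only [norm_mul, norm_pow, Complex.norm_real, Real.norm_eq_abs]
      rw [hc2]; gcongr
    simp only [Complex.norm_ofNat]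
    calc q ^ 2 / 4 * _ ≤ q ^ 2 / 4 * c2 := by gcongr
      _ ≤ _ := by nlinarith [mul_nonneg (sq_nonneg q) p2]
  have X1 : ‖hX κ ρ ξ q z‖ ≤ 1 := by
    refine bX.trans ?_
    nlinarith
  have bc := (chs_bound _ X1).trans bX
  have bs := (shs_bound _ X1).trans bX
  have e1 : ‖hDen κ ρ ξ q z - 1 - hC κ ρ ξ q z‖ ≤ c3 * q ^ 2 := by
    have : hDen κ ρ ξ q z - 1 - hC κ ρ ξ q z =
      (chs (hX κ ρ ξ q z) - 1) + hC κ ρ ξ q z * (shs (hX κ ρ ξ q z) - 1) := by unfold hDen; ring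
    rw [this]
    refine (norm_add_le _ _).trans ?_
    rw [norm_mul]
    have h5 : ‖hC κ ρ ξ q z‖ * ‖shs (hX κ ρ ξ q z) - 1‖ ≤ (c1 * q) * (c2 * q ^ 2) := by gcongr
    have h6 : (c1 * q) * (c2 * q ^ 2) ≤ (c1 * 1) * (c2 * q ^ 2) := by gcongr
    rw [hc3]; linarith
  have e2 : ‖hDen κ ρ ξ q z - 1‖ ≤ c4 * q := by
    have := norm_add_le (hDen κ ρ ξ q z - 1 - hC κ ρ ξ q z) (hC κ ρ ξ q z)
    rw [sub_add_cancel] at this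
    have : c3 * q ^ 2 ≤ c3 * q := by gcongr; nlinarith
    rw [hc4]; linarith
  have e3 : ‖hDen κ ρ ξ q z - 1‖ ≤ 1 / 4 := by linarith
  set e := hDen κ ρ ξ q z - 1 with he
  have hDe : hDen κ ρ ξ q z = 1 + e := by rw [he]; ring
  have l1 : ‖Complex.log (1 + e) - e‖ ≤ ‖e‖ ^ 2 := by
    refine (Complex.norm_log_one_add_sub_self_le (by linarith)).trans ?_
    have : (1 - ‖e‖)⁻¹ ≤ 2 := by
      rw [inv_le_comm₀ (by linarith) (by norm_num)]; linarith
    have h7 : ‖e‖ ^ 2 * (1 - ‖e‖)⁻¹ ≤ ‖e‖ ^ 2 * 2 := by gcongr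
    linarith
  have l2 : ‖Complex.log (1 + e)‖ ≤ 1 := by
    have := Complex.norm_log_one_add_half_le_self (z := e) (by linarith)
    linarith
  refine ⟨X1, e3, by rw [hDe]; exact l2, ?_, ?_⟩
  · unfold hN hBt
    have hDn : 3 / 4 ≤ ‖hDen κ ρ ξ q z‖ := by
      have := norm_sub_norm_le (1:ℂ) (-e)
      rw [hDe]
      simp only [norm_one, norm_neg, sub_neg_eq_add] at this
      linarith
    have hD0 : hDen κ ρ ξ q z ≠ 0 := by intro h; rw [h] at hDn; norm_num at hDn
    have s2 : ‖shs (hX κ ρ ξ q z)‖ ≤ 2 := by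
      have := norm_add_le (shs (hX κ ρ ξ q z) - 1) 1
      rw [sub_add_cancel, norm_one] at this
      have := shs_bound _ X1
      linarith
    have : ((z ^ 2 - q * z) / 2 * shs (hX κ ρ ξ q z) / hDen κ ρ ξ q z - z ^ 2 / 2) / q =
       (z ^ 2 * (shs (hX κ ρ ξ q z) - 1) - z ^ 2 * (hDen κ ρ ξ q z - 1) - q * z * shs (hX κ ρ ξ q z)) /
        (2 * hDen κ ρ ξ q z * q) := by
      field_simp; ring
    rw [this, norm_div, div_le_iff₀ (by rw [norm_pos_iff]; simp [hD0, hqne])]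
    simp only [norm_mul, nq, Complex.norm_ofNat]
    have t1 : ‖z ^ 2 * (shs (hX κ ρ ξ q z) - 1) - z ^ 2 * (hDen κ ρ ξ q z - 1) - q * z * shs (hX κ ρ ξ q z)‖
        ≤ R ^ 2 * (c2 * q ^ 2) + R ^ 2 * (c4 * q) + q * R * 2 := by
      refine (norm_sub_le _ _).trans ?_
      refine add_le_add ((norm_sub_le _ _).trans ?_) ?_
      · simp only [norm_mul, norm_pow]
        gcongr
      · simp only [norm_mul, nq]; gcongr
    refine t1.trans ?_
    have t2 : R ^ 2 * (c2 * q ^ 2) ≤ R ^ 2 * (c2 * q) := by gcongr; nlinarith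
    have t3 : 0 ≤ c4 ^ 2 + c3 + 1 := by positivity
    have t4 : ((R ^ 2 * c2 + R ^ 2 * c4 + 2 * R) + (c4 ^ 2 + c3) + 1) * (2 * (3/4) * q) ≤
       ((R ^ 2 * c2 + R ^ 2 * c4 + 2 * R) + (c4 ^ 2 + c3) + 1) * (2 * ‖hDen κ ρ ξ q z‖ * q) := by gcongr
    have t5 : 0 ≤ (R ^ 2 * c2 + R ^ 2 * c4 + 2 * R) * q := by positivity
    have t6 : 0 ≤ (c4 ^ 2 + c3 + 1) * q := by positivity
    nlinarith
  · unfold hL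
    rw [norm_div, norm_pow, nq, div_le_iff₀ (by positivity), hDe]
    have : Complex.log (1 + e) - hC κ ρ ξ q z = (Complex.log (1 + e) - e) + (e - hC κ ρ ξ q z) := by ring
    rw [this]
    refine (norm_add_le _ _).trans ?_
    have h8 : ‖e‖ ^ 2 ≤ (c4 * q) ^ 2 := by gcongr
    have : 0 ≤ (R ^ 2 * c2 + R ^ 2 * c4 + 2 * R + 1) * q ^ 2 := by positivity
    nlinarith

lemma slit_of_near_one {x : ℂ} (h : ‖x - 1‖ ≤ 1 / 4) : x ∈ Complex.slitPlane := by
  left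
  have := (abs_le.1 ((Complex.abs_re_le_norm (x - 1)).trans h)).1
  simp at this; linarith

lemma hX_diff (κ ρ ξ q : ℝ) : Differentiable ℂ (hX κ ρ ξ q) := by unfold hX; fun_prop
lemma hC_diff (κ ρ ξ q : ℝ) : Differentiable ℂ (hC κ ρ ξ q) := by unfold hC; fun_prop
lemma hDen_diff (κ ρ ξ q : ℝ) : Differentiable ℂ (hDen κ ρ ξ q) := by
  have := hX_diff κ ρ ξ q
  have := hC_diff κ ρ ξ q
  have := chs_differentiable.comp (hX_diff κ ρ ξ q)
  have := shs_differentiable.comp (hX_diff κ ρ ξ q)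
  unfold hDen
  simp only [Function.comp_def] at *
  fun_prop

lemma hN_diffAt (κ ρ ξ q : ℝ) (z : ℂ) (h : ‖hDen κ ρ ξ q z - 1‖ ≤ 1 / 4) :
    DifferentiableAt ℂ (hN κ ρ ξ q) z := by
  have h0 : hDen κ ρ ξ q z ≠ 0 := Complex.slitPlane_ne_zero (slit_of_near_one h)
  have h1 := (hDen_diff κ ρ ξ q) z
  have h2 := (shs_differentiable.comp (hX_diff κ ρ ξ q)) z
  unfold hN hBt
  simp only [Function.comp_def] at *
  exact (((((by fun_prop : DifferentiableAt ℂ (fun z : ℂ => (z ^ 2 - q * z) / 2) z)).mul h2).div h1 h0).sub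
    (by fun_prop)).div_const _

lemma hL_diffAt (κ ρ ξ q : ℝ) (z : ℂ) (h : ‖hDen κ ρ ξ q z - 1‖ ≤ 1 / 4) :
    DifferentiableAt ℂ (hL κ ρ ξ q) z := by
  have h1 := (hDen_diff κ ρ ξ q) z
  have h2 := hC_diff κ ρ ξ q z
  unfold hL
  exact ((h1.clog (slit_of_near_one h)).sub h2).div_const _

lemma im_zero_iff {z : ℂ} : z.im = 0 ↔ ∃ r : ℝ, (r : ℂ) = z :=
  ⟨fun h => ⟨z.re, Complex.ext (by simp) (by simp [h])⟩, by rintro ⟨r, rfl⟩; simp⟩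

lemma hDen_real (κ ρ ξ q u : ℝ) : ∃ r : ℝ, (r : ℂ) = hDen κ ρ ξ q u := by
  have hx : ∃ x : ℝ, (x : ℂ) = hX κ ρ ξ q u :=
    ⟨q ^ 2 / 4 * ((κ * q - ρ * ξ * u) ^ 2 + u * (q - u) * ξ ^ 2), by unfold hX; push_cast; ring⟩
  obtain ⟨x, hx⟩ := hx
  obtain ⟨a, ha⟩ := im_zero_iff.1 (chs_ofReal_im x)
  obtain ⟨b, hb⟩ := im_zero_iff.1 (shs_ofReal_im x)
  refine ⟨a + (κ * q ^ 2 / 2 - ρ * ξ * u * q / 2) * b, ?_⟩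
  unfold hDen hC; rw [← hx, ← ha, ← hb]; push_cast; ring

lemma hN_real (κ ρ ξ q u : ℝ) : ∃ r : ℝ, (r : ℂ) = hN κ ρ ξ q u := by
  have hx : ∃ x : ℝ, (x : ℂ) = hX κ ρ ξ q u :=
    ⟨q ^ 2 / 4 * ((κ * q - ρ * ξ * u) ^ 2 + u * (q - u) * ξ ^ 2), by unfold hX; push_cast; ring⟩
  obtain ⟨x, hx⟩ := hx
  obtain ⟨b, hb⟩ := im_zero_iff.1 (shs_ofReal_im x)
  obtain ⟨r, hr⟩ := hDen_real κ ρ ξ q u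
  refine ⟨((u ^ 2 - q * u) / 2 * b / r - u ^ 2 / 2) / q, ?_⟩
  unfold hN hBt; rw [← hr, ← hx, ← hb]; push_cast; ring

lemma hL_real (κ ρ ξ q u : ℝ) (h : ‖hDen κ ρ ξ q u - 1‖ ≤ 1 / 4) : (hL κ ρ ξ q u).im = 0 := by
  obtain ⟨r, hr⟩ := hDen_real κ ρ ξ q u
  have : 0 < r := by
    have := (abs_le.1 ((Complex.abs_re_le_norm _).trans h)).1
    rw [← hr] at this
    simp at this; linarith
  rw [im_zero_iff]
  refine ⟨(Real.log r - (κ * q ^ 2 / 2 - ρ * ξ * u * q / 2)) / q ^ 2, ?_⟩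
  unfold hL hC
  rw [← hr, ← Complex.ofReal_log this.le]; push_cast; ring

lemma riccati_abs (F F1 : ℝ → ℂ) (c g : ℂ) (hF : ∀ s, HasDerivAt F (F1 s) s)
    (hF1 : ∀ s, HasDerivAt F1 (-c * F1 s - g * F s) s) (h0 : F 0 = 1) (h10 : F1 0 = 0)
    (hgi : g.im = 0 ∨ True) (hc : c.im ^ 2 ≤ -4 * g.re) (s : ℝ) (hs : 0 ≤ s) :
    1 ≤ (F s).re ^ 2 + (F s).im ^ 2 ∧ 0 ≤ (F s).re * (F1 s).re + (F s).im * (F1 s).im := by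
  have re' : ∀ (f : ℝ → ℂ) (f' : ℂ) (x : ℝ), HasDerivAt f f' x → HasDerivAt (fun x => (f x).re) f'.re x :=
    fun f f' x h => Complex.reCLM.hasFDerivAt.comp_hasDerivAt x h
  have im' : ∀ (f : ℝ → ℂ) (f' : ℂ) (x : ℝ), HasDerivAt f f' x → HasDerivAt (fun x => (f x).im) f'.im x :=
    fun f f' x h => Complex.imCLM.hasFDerivAt.comp_hasDerivAt x h
  set I : ℝ → ℝ := fun s => (F s).re * (F1 s).re + (F s).im * (F1 s).im with hI
  have dI : ∀ s, HasDerivAt (fun s => Real.exp (c.re * s) * I s)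
      (Real.exp (c.re * s) * (((F1 s).im + c.im * (F s).re / 2) ^ 2 + ((F1 s).re - c.im * (F s).im / 2) ^ 2
        + (-4 * g.re - c.im ^ 2) / 4 * ((F s).re ^ 2 + (F s).im ^ 2))) s := by
    intro s
    have e1 : HasDerivAt (fun s => Real.exp (c.re * s)) (Real.exp (c.re * s) * (c.re * 1)) s :=
      ((hasDerivAt_id s).const_mul c.re).exp
    have e2 := ((re' _ _ s (hF s)).mul (re' _ _ s (hF1 s))).add ((im' _ _ s (hF s)).mul (im' _ _ s (hF1 s)))
    refine (e1.mul e2).congr_deriv ?_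
    simp only [Complex.sub_re, Complex.mul_re, Complex.neg_re, Complex.neg_im, Complex.sub_im, Complex.mul_im, Pi.add_apply, Pi.mul_apply]
    ring
  have mI : MonotoneOn (fun s => Real.exp (c.re * s) * I s) (Set.Ici 0) := by
    apply monotoneOn_of_deriv_nonneg (convex_Ici 0)
    · exact fun x _ => (dI x).continuousAt.continuousWithinAt
    · exact fun x _ => (dI x).differentiableAt.differentiableWithinAt
    · intro x _
      rw [(dI x).deriv]
      have : 0 ≤ -4 * g.re - c.im ^ 2 := by linarith
      positivity
  have I0 : ∀ s, 0 ≤ s → 0 ≤ I s := by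
    intro s hs
    have := mI (Set.mem_Ici.2 le_rfl) (Set.mem_Ici.2 hs) hs
    simp only [hI, h10, Complex.zero_re, Complex.zero_im, mul_zero, add_zero] at this
    exact nonneg_of_mul_nonneg_right this (Real.exp_pos _)
  refine ⟨?_, I0 s hs⟩
  have dQ : ∀ s, HasDerivAt (fun s => (F s).re ^ 2 + (F s).im ^ 2) (2 * I s) s := by
    intro s
    refine (((re' _ _ s (hF s)).pow 2).add ((im' _ _ s (hF s)).pow 2)).congr_deriv ?_
    simp only [hI]; norm_num; ring
  have mQ : MonotoneOn (fun s => (F s).re ^ 2 + (F s).im ^ 2) (Set.Ici 0) := by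
    apply monotoneOn_of_deriv_nonneg (convex_Ici 0)
    · exact fun x _ => (dQ x).continuousAt.continuousWithinAt
    · exact fun x _ => (dQ x).differentiableAt.differentiableWithinAt
    · intro x hx
      rw [(dQ x).deriv]
      rw [interior_Ici] at hx
      have := I0 x (le_of_lt hx)
      linarith
  have := mQ (Set.mem_Ici.2 le_rfl) (Set.mem_Ici.2 hs) hs
  simpa [h0] using this

lemma hestD_ne (κ ρ ξ : ℝ) (hκ : 0 < κ) (hξ : 0 < ξ) (hρ : ρ ∈ Set.Ioo (-1 : ℝ) 1) (w : ℂ) (hw : w.im ≠ 0) :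
    hestD κ ρ ξ w ≠ 0 := by
  intro h
  have h2 := hestD_sq κ ρ ξ w
  rw [h] at h2
  have hr := congrArg Complex.re h2
  have hi := congrArg Complex.im h2
  simp [pow_two] at hr hi
  have hi' : w.im * (-2 * ρ * ξ * (κ - ρ * ξ * w.re) + (1 - 2 * w.re) * ξ ^ 2) = 0 := by linear_combination -hi
  have hi2 := (mul_eq_zero.1 hi').resolve_left hw
  have r2 : 0 < 1 - ρ ^ 2 := by nlinarith [hρ.1, hρ.2]
  have hx2 : 0 < ξ ^ 2 := by positivity
  have hy : 0 < w.im ^ 2 := by positivity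
  have hid : (1 - ρ ^ 2) * ξ ^ 2 * (w.re ^ 2 + w.im ^ 2) + κ ^ 2 = 0 := by
    linear_combination -hr - w.re * hi2
  have : 0 < (1 - ρ ^ 2) * ξ ^ 2 * (w.re ^ 2 + w.im ^ 2) := by positivity
  nlinarith

lemma far_region (κ ρ ξ q : ℝ) (hκ : 0 < κ) (hξ : 0 < ξ) (hρ : ρ ∈ Set.Ioo (-1 : ℝ) 1) (hq : 0 < q) (z : ℂ)
    (hz : z.im ≠ 0) (hfar : z.re ^ 2 - q * z.re ≤ (1 - ρ ^ 2) * z.im ^ 2) :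
    hDen κ ρ ξ q z ≠ 0 ∧ (hC κ ρ ξ q z).re - Real.log ‖hDen κ ρ ξ q z‖ ≤ 0 ∧ (hBt κ ρ ξ q z).re ≤ 0 := by
  have hq' : (q : ℂ) ≠ 0 := by exact_mod_cast hq.ne'
  have hwim : (z / q).im = z.im / q := Complex.div_ofReal_im z q
  have hwre : (z / q).re = z.re / q := Complex.div_ofReal_re z q
  have hd : hestD κ ρ ξ (z / q) ≠ 0 := hestD_ne κ ρ ξ hκ hξ hρ _ (by rw [hwim]; exact div_ne_zero hz hq.ne')
  have hsq := hestD_sq κ ρ ξ (z / q)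
  have hXe := hX_eq κ ρ ξ q hq z
  have hden := repr_den κ ρ ξ q hξ hq z hd
  have hzw : z = (z / q) * q := by field_simp
  have hBt_def : hBt κ ρ ξ q z = (z ^ 2 - q * z) / 2 * shs (hX κ ρ ξ q z) / hDen κ ρ ξ q z := rfl
  have hCc : hC κ ρ ξ q z = (κ - ρ * ξ * (z / q)) * (q^2 : ℝ) / 2 := by unfold hC; push_cast; field_simp
  have hsh := mul_shs_sq (hestD κ ρ ξ (z / q) * (q ^ 2 : ℝ) / 2)
  rw [← hXe] at hsh
  set w := z / q with hw
  set d := hestD κ ρ ξ w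
  set c : ℂ := (κ : ℂ) - ρ * ξ * w with hc
  set g : ℂ := (ξ : ℂ) ^ 2 / 4 * (w ^ 2 - w) with hg
  set F : ℝ → ℂ := fun s => ((c + d) * Complex.exp ((d - c) / 2 * s) - (c - d) * Complex.exp (-(c + d) / 2 * s)) / (2 * d) with hF
  set F1 : ℝ → ℂ := fun s => -(2 * g / d) / 2 * (Complex.exp ((d - c) / 2 * s) - Complex.exp (-(c + d) / 2 * s)) with hF1
  have hcd : c ^ 2 - d ^ 2 = 4 * g := by rw [hg]; linear_combination -hsq
  have de : ∀ (a : ℂ) (s : ℝ), HasDerivAt (fun s : ℝ => Complex.exp (a * s)) (Complex.exp (a * s) * (a * 1)) s := by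
    intro a s
    have h1 : HasDerivAt (fun s : ℝ => (s : ℂ)) 1 s := Complex.ofRealCLM.hasDerivAt
    exact (h1.const_mul a).cexp
  have dF : ∀ s, HasDerivAt F (F1 s) s := by
    intro s
    refine ((((de ((d - c) / 2) s).const_mul (c + d)).sub ((de (-(c + d) / 2) s).const_mul (c - d))).div_const (2 * d)).congr_deriv ?_
    rw [hF1]
    simp only
    field_simp
    linear_combination (-(Complex.exp ((d - c) * s / 2)) + Complex.exp (-((c + d) * s / 2))) * hcd
  have dF1 : ∀ s, HasDerivAt F1 (-c * F1 s - g * F s) s := by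
    intro s
    refine (((de ((d - c) / 2) s).sub (de (-(c + d) / 2) s)).const_mul (-(2 * g / d) / 2)).congr_deriv ?_
    rw [hF1, hF]
    simp only
    field_simp
    ring
  have hF0 : F 0 = 1 := by simp [hF]; field_simp; ring
  have hF10 : F1 0 = 0 := by simp [hF1]
  have hcim : c.im = -(ρ * ξ * w.im) := by simp [hc]
  have hgre : g.re = ξ ^ 2 / 4 * (w.re ^ 2 - w.im ^ 2 - w.re) := by
    have : g = ((ξ ^ 2 / 4 : ℝ) : ℂ) * (w ^ 2 - w) := by rw [hg]; push_cast; ring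
    rw [this, Complex.re_ofReal_mul]; simp [pow_two]
  have hcond : c.im ^ 2 ≤ -4 * g.re := by
    rw [hcim, hgre, hwim, hwre]
    have h3 : (z.re ^ 2 - q * z.re) / q ^ 2 ≤ ((1 - ρ ^ 2) * z.im ^ 2) / q ^ 2 := by gcongr
    have h4 : (z.re ^ 2 - q * z.re) / q ^ 2 = (z.re / q) ^ 2 - z.re / q := by field_simp
    have h5 : ((1 - ρ ^ 2) * z.im ^ 2) / q ^ 2 = (1 - ρ ^ 2) * (z.im / q) ^ 2 := by ring
    rw [h4, h5] at h3
    have := mul_le_mul_of_nonneg_left h3 (sq_nonneg ξ)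
    nlinarith
  obtain ⟨k1, k2⟩ := riccati_abs F F1 c g dF dF1 hF0 hF10 (Or.inr trivial) hcond (q ^ 2) (by positivity)
  set D := d * ((q ^ 2 : ℝ) : ℂ) / 2 with hD
  have ea : Complex.exp ((d - c) / 2 * ((q ^ 2 : ℝ) : ℂ)) = Complex.exp (-hC κ ρ ξ q z) * Complex.exp D := by
    rw [← Complex.exp_add, hCc, hD]; congr 1; ring
  have eb : Complex.exp (-(c + d) / 2 * ((q ^ 2 : ℝ) : ℂ)) = Complex.exp (-hC κ ρ ξ q z) * Complex.exp (-D) := by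
    rw [← Complex.exp_add, hCc, hD]; congr 1; ring
  have eF : F (q ^ 2) = Complex.exp (-hC κ ρ ξ q z) * hDen κ ρ ξ q z := by
    have : d * F (q ^ 2) = d * (Complex.exp (-hC κ ρ ξ q z) * hDen κ ρ ξ q z) := by
      rw [← mul_left_comm, hden]
      simp only [hF]
      rw [ea, eb, Complex.cosh, Complex.sinh]; field_simp; ring
    exact mul_left_cancel₀ hd this
  have eF1 : F1 (q ^ 2) = -(ξ ^ 2 / 4 * (z ^ 2 - q * z)) * (Complex.exp (-hC κ ρ ξ q z) * shs (hX κ ρ ξ q z)) := by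
    simp only [hF1]
    rw [ea, eb]
    have : Complex.exp (-hC κ ρ ξ q z) * Complex.exp D - Complex.exp (-hC κ ρ ξ q z) * Complex.exp (-D) =
      Complex.exp (-hC κ ρ ξ q z) * (2 * Complex.sinh D) := by rw [Complex.sinh]; ring
    have hDq : D = d * q ^ 2 / 2 := by rw [hD]; push_cast; ring
    rw [this, ← hsh, hg, hDq]
    have e5 : z ^ 2 - q * z = q ^ 2 * (w ^ 2 - w) := by
      conv_lhs => rw [hzw]
      ring
    rw [e5]; field_simp
  have hE := Complex.exp_ne_zero (-hC κ ρ ξ q z)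
  have hFn : (F (q^2)).re ^ 2 + (F (q^2)).im ^ 2 = ‖F (q^2)‖ ^ 2 := by
    rw [← Complex.normSq_eq_norm_sq, Complex.normSq_apply]; ring
  have hF1n : 1 ≤ ‖F (q^2)‖ := by
    rw [hFn] at k1; nlinarith [norm_nonneg (F (q^2))]
  have hFne : F (q ^ 2) ≠ 0 := by intro h; rw [h] at hF1n; norm_num at hF1n
  have hDne : hDen κ ρ ξ q z ≠ 0 := by intro h; rw [eF, h, mul_zero] at hFne; exact hFne rfl
  refine ⟨hDne, ?_, ?_⟩
  · rw [eF, norm_mul, Complex.norm_exp] at hF1n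
    have := Real.log_nonneg hF1n
    rw [Real.log_mul (Real.exp_pos _).ne' (norm_ne_zero_iff.2 hDne), Real.log_exp, Complex.neg_re] at this
    linarith
  · have hxc : (ξ : ℂ) ≠ 0 := by exact_mod_cast hξ.ne'
    have : hBt κ ρ ξ q z = ((-(2 / ξ ^ 2) : ℝ) : ℂ) * (F1 (q^2) / F (q^2)) := by
      rw [eF, eF1, hBt_def]; push_cast; field_simp; ring
    rw [this, Complex.re_ofReal_mul, Complex.div_re]
    have h9 : 0 ≤ (F1 (q ^ 2)).re * (F (q ^ 2)).re / Complex.normSq (F (q ^ 2)) +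
      (F1 (q ^ 2)).im * (F (q ^ 2)).im / Complex.normSq (F (q ^ 2)) := by
      rw [← add_div]
      exact div_nonneg (by linarith) (Complex.normSq_nonneg _)
    have : 0 ≤ 2 / ξ ^ 2 := by positivity
    nlinarith

/-- `1 - 2 β B` in rescaled form. -/
def bF (β q : ℝ) (N : ℂ → ℂ) (z : ℂ) : ℂ := 1 - β * z ^ 2 - 2 * β * q * N z

/-- the rescaled forward log-mgf in regular form. -/
def GF (β V m q : ℝ) (N L : ℂ → ℂ) (z : ℂ) : ℂ :=
  -(m : ℂ) * (q ^ 2 * L z) + V / (2 * β) * (1 / bF β q N z - 1) - m * Complex.log (bF β q N z)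

lemma bF_hasDerivAt (β q : ℝ) (N : ℂ → ℂ) (z N' : ℂ) (h : HasDerivAt N N' z) :
    HasDerivAt (bF β q N) (-2 * β * (z + q * N')) z := by
  have h1 : HasDerivAt (fun z : ℂ => 1 - (β : ℂ) * z ^ 2 - 2 * β * q * N z)
      (0 - (β : ℂ) * ((2 : ℕ) * z ^ (2 - 1) * 1) - 2 * β * q * N') z :=
    ((hasDerivAt_const _ _).sub (((hasDerivAt_id z).pow 2).const_mul _)).sub (h.const_mul _)
  have h2 : HasDerivAt (bF β q N) _ z := h1
  exact h2.congr_deriv (by norm_num; ring)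

lemma GF_hasDerivAt (β V m q : ℝ) (N L : ℂ → ℂ) (z L' b' : ℂ)
    (hL : HasDerivAt L L' z) (hb : HasDerivAt (bF β q N) b' z)
    (hs : bF β q N z ∈ Complex.slitPlane) :
    HasDerivAt (GF β V m q N L) (-(m : ℂ) * (q ^ 2 * L') - V / (2 * β) * (b' / bF β q N z ^ 2)
      - m * (b' / bF β q N z)) z := by
  have hne := Complex.slitPlane_ne_zero hs
  have h1 := (((hL.const_mul ((q : ℂ) ^ 2)).const_mul (-(m : ℂ))).add
    (((hb.inv hne).sub_const 1).const_mul ((V : ℂ) / (2 * β)))).sub ((hb.clog hs).const_mul (m : ℂ))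
  have h2 : GF β V m q N L = (fun x => -(m : ℂ) * (q ^ 2 * L x)) +
    (fun x => (V : ℂ) / (2 * β) * ((bF β q N)⁻¹ x - 1)) - fun x => m * Complex.log (bF β q N x) := by
    ext x; simp [GF]
  rw [h2]
  have h3 := h1.congr_deriv (g' := -(m : ℂ) * (q ^ 2 * L') - V / (2 * β) * (b' / bF β q N z ^ 2)
      - m * (b' / bF β q N z)) (by ring)
  exact h3

lemma bF_real (β q u : ℝ) (N : ℂ → ℂ) (h : ∃ r : ℝ, (r : ℂ) = N u) :
    ∃ r : ℝ, (r : ℂ) = bF β q N u := by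
  obtain ⟨r, hr⟩ := h
  exact ⟨1 - β * u ^ 2 - 2 * β * q * r, by rw [bF, ← hr]; push_cast; ring⟩

lemma bF_hBt (β κ ρ ξ q : ℝ) (hq : 0 < q) (z : ℂ) :
    1 - 2 * (β : ℂ) * hBt κ ρ ξ q z = bF β q (hN κ ρ ξ q) z := by
  have hq' : (q : ℂ) ≠ 0 := by exact_mod_cast hq.ne'
  unfold bF hN; field_simp; ring

lemma repr_G (κ θ ξ v ρ t q : ℝ) (hκ : 0 < κ) (hξ : 0 < ξ) (ht : 0 < t) (hq : 0 < q) (z : ℂ)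
    (hd : hestD κ ρ ξ (z / q) ≠ 0)
    (h0 : z ≠ 0) (h1 : z ≠ q) (hX1 : ‖hX κ ρ ξ q z‖ ≤ 1) (hH : ‖hDen κ ρ ξ q z - 1‖ ≤ 1 / 4)
    (hlog : ‖Complex.log (hDen κ ρ ξ q z)‖ ≤ 1) (hβ : betaT κ ξ t ≠ 0)
    (hb : bF (betaT κ ξ t) q (hN κ ρ ξ q) z ≠ 0) :
    hestG κ θ ξ v ρ t (z / q) (q ^ 2) = GF (betaT κ ξ t) (v * Real.exp (-(κ * t))) (2 * κ * θ / ξ ^ 2)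
      q (hN κ ρ ξ q) (hL κ ρ ξ q) z := by
  unfold hestG GF
  rw [repr_B κ ρ ξ q hξ hq z hd h0 h1, bF_hBt _ _ _ _ _ hq,
    repr_A κ θ ρ ξ q hξ hq z hd h0 h1 (Complex.slitPlane_ne_zero (slit_of_near_one hH)) hlog hX1]
  have hβ' : (betaT κ ξ t : ℂ) ≠ 0 := by exact_mod_cast hβ
  have e : hBt κ ρ ξ q z = (1 - bF (betaT κ ξ t) q (hN κ ρ ξ q) z) / (2 * betaT κ ξ t) := by
    rw [← bF_hBt _ _ _ _ _ hq]; field_simp; ring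
  rw [e]
  congr 2
  push_cast
  field_simp

lemma betaT_pos (κ ξ t : ℝ) (hκ : 0 < κ) (hξ : 0 < ξ) (ht : 0 < t) : 0 < betaT κ ξ t := by
  unfold betaT
  have : Real.exp (-(κ * t)) < 1 := by
    rw [Real.exp_lt_one_iff]; nlinarith [mul_pos hκ ht]
  have : 0 < 1 - Real.exp (-(κ * t)) := by linarith
  positivity

lemma hestD_zero_iff (κ ρ ξ q u : ℝ) (hq : 0 < q) :
    hestD κ ρ ξ ((u : ℂ) / q) = 0 → (κ * q - ρ * ξ * u) ^ 2 + u * (q - u) * ξ ^ 2 = 0 := by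
  intro h
  have hq' : (q : ℂ) ≠ 0 := by exact_mod_cast hq.ne'
  have h2 := hestD_sq κ ρ ξ ((u : ℂ) / q)
  rw [h] at h2
  have h3 : ((q : ℂ) ^ 2) * (((κ : ℂ) - (ρ : ℂ) * (ξ : ℂ) * (u / q)) ^ 2 + u / q * (1 - u / q) * (ξ : ℂ) ^ 2) = 0 := by
    rw [← h2]; ring
  have h4 : ((κ * q - ρ * ξ * u) ^ 2 + u * (q - u) * ξ ^ 2 : ℂ) = 0 := by
    rw [← h3]; field_simp
  exact_mod_cast h4

lemma nonjunk_punctured (κ ρ ξ q U : ℝ) (hξ : 0 < ξ) (hρ : ρ ∈ Set.Ioo (-1 : ℝ) 1) (hq : 0 < q) :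
    ∀ᶠ u : ℝ in 𝓝[≠] U, hestD κ ρ ξ ((u : ℂ) / q) ≠ 0 ∧ u ≠ 0 ∧ u ≠ q := by
  have hA : ξ ^ 2 * (ρ ^ 2 - 1) ≠ 0 := by
    apply mul_ne_zero (by positivity); nlinarith [hρ.1, hρ.2]
  set p : Polynomial ℝ := Polynomial.C (ξ ^ 2 * (ρ ^ 2 - 1)) * Polynomial.X ^ 2 +
    Polynomial.C (q * ξ ^ 2 - 2 * κ * q * ρ * ξ) * Polynomial.X + Polynomial.C (κ ^ 2 * q ^ 2) with hp
  have hp0 : p ≠ 0 := by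
    intro h
    have := Polynomial.natDegree_quadratic (a := ξ ^ 2 * (ρ ^ 2 - 1)) (b := q * ξ ^ 2 - 2 * κ * q * ρ * ξ)
      (c := κ ^ 2 * q ^ 2) hA
    rw [← hp, h] at this
    simp at this
  have hfin := Polynomial.finite_setOf_isRoot hp0
  have hfin2 : (({x | Polynomial.IsRoot p x} ∪ {0, q}) \ {U}).Finite := (hfin.union (by simp)).diff
  have : (({x | Polynomial.IsRoot p x} ∪ {0, q}) \ {U})ᶜ ∈ 𝓝 U :=
    hfin2.isClosed.isOpen_compl.mem_nhds (by simp)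
  have h3 : ∀ᶠ u in 𝓝[≠] U, u ≠ U := eventually_mem_nhdsWithin
  filter_upwards [mem_nhdsWithin_of_mem_nhds this, h3] with u hu huU
  simp only [Set.mem_compl_iff, Set.mem_diff, Set.mem_union, Set.mem_setOf_eq, Set.mem_insert_iff,
    Set.mem_singleton_iff, not_and, not_not] at hu
  refine ⟨fun h => huU (hu (Or.inl ?_)), fun h => huU (hu (Or.inr (Or.inl h))), fun h => huU (hu (Or.inr (Or.inr h)))⟩
  have := hestD_zero_iff κ ρ ξ q u hq h
  simp only [hp, Polynomial.IsRoot.def, Polynomial.eval_add, Polynomial.eval_mul, Polynomial.eval_C, Polynomial.eval_pow, Polynomial.eval_X]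
  linarith

/-- regularity package on a ball. -/
structure Nice (R M : ℝ) (N L : ℂ → ℂ) : Prop where
  dN : DifferentiableOn ℂ N (Metric.ball 0 (R + 2))
  dL : DifferentiableOn ℂ L (Metric.ball 0 (R + 2))
  bN : ∀ z ∈ Metric.ball (0:ℂ) (R + 2), ‖N z‖ ≤ M
  bL : ∀ z ∈ Metric.ball (0:ℂ) (R + 2), ‖L z‖ ≤ M
  rN : ∀ u : ℝ, ∃ r : ℝ, (r : ℂ) = N u
  rL : ∀ u : ℝ, (u : ℂ) ∈ Metric.ball (0:ℂ) (R + 2) → (L u).im = 0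

lemma nice_heston (κ ρ ξ R : ℝ) (hR : 0 < R) :
    ∃ q0 > 0, ∃ M > 0, ∀ q : ℝ, 0 < q → q < q0 → Nice R M (hN κ ρ ξ q) (hL κ ρ ξ q) ∧
      ∀ z ∈ Metric.ball (0:ℂ) (R + 2),
      ‖hX κ ρ ξ q z‖ ≤ 1 ∧ ‖hDen κ ρ ξ q z - 1‖ ≤ 1 / 4 ∧ ‖Complex.log (hDen κ ρ ξ q z)‖ ≤ 1 := by
  obtain ⟨q0, hq0, M, hM, h⟩ := den_bounds κ ρ ξ (R + 2) (by linarith)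
  refine ⟨q0, hq0, M, hM, fun q h1 h2 => ⟨⟨?_, ?_, ?_, ?_, ?_, ?_⟩, ?_⟩⟩
  · exact fun z hz => (hN_diffAt κ ρ ξ q z (h q h1 h2 z hz).2.1).differentiableWithinAt
  · exact fun z hz => (hL_diffAt κ ρ ξ q z (h q h1 h2 z hz).2.1).differentiableWithinAt
  · exact fun z hz => (h q h1 h2 z hz).2.2.2.1
  · exact fun z hz => (h q h1 h2 z hz).2.2.2.2
  · exact fun u => hN_real κ ρ ξ q u
  · exact fun u hu => hL_real κ ρ ξ q u (h q h1 h2 _ hu).2.1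
  · exact fun z hz => ⟨(h q h1 h2 z hz).1, (h q h1 h2 z hz).2.1, (h q h1 h2 z hz).2.2.1⟩

lemma GF_im_neg (β V m q u r : ℝ) (N L : ℂ → ℂ) (hr : (r : ℂ) = bF β q N u) (hr0 : r < 0)
    (hL : (L u).im = 0) : (GF β V m q N L u).im = -(m * Real.pi) := by
  obtain ⟨l, hl⟩ := im_zero_iff.1 hL
  unfold GF
  rw [← hr, ← hl]
  have e : -(m : ℂ) * (q ^ 2 * l) + V / (2 * β) * (1 / r - 1) =
    ((-m * (q ^ 2 * l) + V / (2 * β) * (1 / r - 1) : ℝ) : ℂ) := by push_cast; ring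
  rw [e, Complex.sub_im, Complex.ofReal_im, Complex.im_ofReal_mul, Complex.log_im,
    Complex.arg_ofReal_of_neg hr0]
  ring

lemma GF_im_pos (β V m q u r : ℝ) (N L : ℂ → ℂ) (hr : (r : ℂ) = bF β q N u) (hr0 : 0 < r)
    (hL : (L u).im = 0) : (GF β V m q N L u).im = 0 := by
  obtain ⟨l, hl⟩ := im_zero_iff.1 hL
  unfold GF
  rw [← hr, ← hl]
  have e : -(m : ℂ) * (q ^ 2 * l) + V / (2 * β) * (1 / r - 1) =
    ((-m * (q ^ 2 * l) + V / (2 * β) * (1 / r - 1) : ℝ) : ℂ) := by push_cast; ring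
  rw [e, Complex.sub_im, Complex.ofReal_im, Complex.im_ofReal_mul, Complex.log_im,
    Complex.arg_ofReal_of_nonneg hr0.le]
  ring

lemma lambda_eq (κ θ ξ v ρ t q : ℝ) (hq : 0 < q) (z : ℂ) :
    hestLambdaC κ θ ξ v ρ t (q ^ 2) z = q * hestG κ θ ξ v ρ t (z / q) (q ^ 2) := by
  unfold hestLambdaC; rw [Real.sqrt_sq hq.le]

set_option maxHeartbeats 1600000 in
lemma saddle (κ θ ξ v ρ t : ℝ) (hκ : 0 < κ) (hθ : 0 < θ) (hξ : 0 < ξ)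
    (hv : 0 < v) (hρ : ρ ∈ Set.Ioo (-1 : ℝ) 1) (ht : 0 < t) (k : ℝ) (hk : k ≠ 0) (R : ℝ)
    (hR : 1 / Real.sqrt (betaT κ ξ t) + 1 < R) :
    ∀ᶠ q in 𝓝[>] (0:ℝ), ∀ U ∈ hestDom κ θ ξ v ρ t (q ^ 2),
      deriv (hestLambda κ θ ξ v ρ t (q ^ 2)) U = (k : ℂ) →
      |U| < 1 / Real.sqrt (betaT κ ξ t) + 1 ∧ ∃ ε : ℝ, 0 < ε ∧
        (ε : ℂ) = bF (betaT κ ξ t) q (hN κ ρ ξ q) U ∧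
        (k : ℂ) = q * (-((2 * κ * θ / ξ ^ 2 : ℝ) : ℂ) * (q ^ 2 * deriv (hL κ ρ ξ q) U)
          - ((v * Real.exp (-(κ * t)) : ℝ) : ℂ) / (2 * betaT κ ξ t) *
            (-2 * betaT κ ξ t * (U + q * deriv (hN κ ρ ξ q) U) / ε ^ 2)
          - ((2 * κ * θ / ξ ^ 2 : ℝ) : ℂ) * (-2 * betaT κ ξ t * (U + q * deriv (hN κ ρ ξ q) U) / ε)) ∧
        hestG κ θ ξ v ρ t ((U : ℂ) / q) (q ^ 2) =
          GF (betaT κ ξ t) (v * Real.exp (-(κ * t))) (2 * κ * θ / ξ ^ 2) q (hN κ ρ ξ q) (hL κ ρ ξ q) U := by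
  set β := betaT κ ξ t with hβd
  set V := v * Real.exp (-(κ * t)) with hV
  set m := 2 * κ * θ / ξ ^ 2 with hm
  set a0 := 1 / Real.sqrt β with ha0
  have hβ : 0 < β := betaT_pos κ ξ t hκ hξ ht
  have hm0 : 0 < m := by rw [hm]; positivity
  have ha0p : 0 < a0 := by rw [ha0]; positivity
  have hβa : β * a0 ^ 2 = 1 := by
    rw [ha0, div_pow, Real.sq_sqrt hβ.le]; field_simp
  obtain ⟨q0, hq0, M, hM, hnice⟩ := nice_heston κ ρ ξ R (by linarith)
  have T : ∀ u1 : ℝ, u1 = a0 + 1 ∨ u1 = -(a0 + 1) → ∀ᶠ q in 𝓝[>] (0:ℝ),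
      (κ * q - ρ * ξ * u1) ^ 2 + u1 * (q - u1) * ξ ^ 2 < 0 := by
    intro u1 hu1
    have hc : Continuous (fun q : ℝ => (κ * q - ρ * ξ * u1) ^ 2 + u1 * (q - u1) * ξ ^ 2) := by fun_prop
    have hu2 : u1 ≠ 0 := by rcases hu1 with h | h <;> rw [h] <;> intro h2 <;> linarith
    have := (hc.tendsto 0)
    refine (this.mono_left nhdsWithin_le_nhds).eventually_lt_const ?_
    have h1 : 0 < ξ ^ 2 * u1 ^ 2 := by positivity
    have h2 : ρ ^ 2 < 1 := by nlinarith [hρ.1, hρ.2]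
    nlinarith
  have hsmall : ∀ c > (0:ℝ), ∀ᶠ q in 𝓝[>] (0:ℝ), q < c := fun c hc =>
    mem_nhdsWithin_of_mem_nhds (Iio_mem_nhds hc)
  have hpos : ∀ᶠ q in 𝓝[>] (0:ℝ), 0 < q := eventually_mem_nhdsWithin
  filter_upwards [hpos, hsmall q0 hq0, hsmall 1 one_pos, hsmall (a0 / (4 * M)) (by positivity),
    hsmall (1 / (4 * β * M)) (by positivity),
    T _ (Or.inl rfl), T _ (Or.inr rfl)] with q hq hqq0 hq1 hqa hqb hT1 hT2 U hU hderiv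
  obtain ⟨nice, hball⟩ := hnice q hq hqq0
  set N := hN κ ρ ξ q with hNd
  set L := hL κ ρ ξ q with hLd
  rw [lt_div_iff₀ (by positivity)] at hqa hqb
  -- general representation
  have G1 : ∀ u : ℝ, |u| < R + 2 → hestD κ ρ ξ ((u : ℂ) / q) ≠ 0 → u ≠ 0 → u ≠ q → bF β q N u ≠ 0 →
      hestLambda κ θ ξ v ρ t (q ^ 2) u = q * GF β V m q N L u := by
    intro u hu hd h0 h1 hb
    have hub : (u : ℂ) ∈ Metric.ball (0:ℂ) (R + 2) := by simpa using hu
    obtain ⟨b1, b2, b3⟩ := hball u hub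
    unfold hestLambda
    rw [lambda_eq _ _ _ _ _ _ _ hq, repr_G κ θ ξ v ρ t q hκ hξ ht hq u hd (by exact_mod_cast h0)
      (by exact_mod_cast h1) b1 b2 b3 hβ.ne' hb]
  have Gneg : ∀ u r : ℝ, |u| < R + 2 → hestD κ ρ ξ ((u : ℂ) / q) ≠ 0 → u ≠ 0 → u ≠ q → (r : ℂ) = bF β q N u →
      r < 0 → (hestLambda κ θ ξ v ρ t (q ^ 2) u).im ≠ 0 := by
    intro u r hu hd h0 h1 hb hr
    rw [G1 u hu hd h0 h1 (by rw [← hb]; exact_mod_cast hr.ne), Complex.im_ofReal_mul,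
      GF_im_neg β V m q u r N L hb hr (nice.rL u (by simpa using hu))]
    have := Real.pi_pos
    have : 0 < q * (m * Real.pi) := by positivity
    intro h; linarith
  -- the end points are not in the domain
  have ends : ∀ u1 : ℝ, u1 = a0 + 1 ∨ u1 = -(a0 + 1) →
      (κ * q - ρ * ξ * u1) ^ 2 + u1 * (q - u1) * ξ ^ 2 < 0 →
      (hestLambda κ θ ξ v ρ t (q ^ 2) u1).im ≠ 0 := by
    intro u1 hu1 hT
    have habs : |u1| = a0 + 1 := by
      rcases hu1 with h | h <;> rw [h]
      · exact abs_of_pos (by linarith)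
      · rw [abs_neg]; exact abs_of_pos (by linarith)
    have hsq : u1 ^ 2 = (a0 + 1) ^ 2 := by rw [← habs, sq_abs]
    obtain ⟨n, hn⟩ := nice.rN u1
    have hbn : |n| ≤ M := by
      have := nice.bN u1 (by simp [habs]; linarith)
      rw [← hn] at this; simpa using this
    refine Gneg u1 (1 - β * u1 ^ 2 - 2 * β * q * n) (by linarith) (fun h => hT.ne (hestD_zero_iff κ ρ ξ q u1 hq h)) ?_ ?_ ?_ ?_
    · rcases hu1 with h | h <;> rw [h] <;> intro h2 <;> linarith
    · intro h; rw [h, abs_of_pos hq] at habs; linarith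
    · rw [bF, ← hn]; push_cast; ring
    · rw [hsq]
      have h1 := (abs_le.1 hbn).1
      have h2 : 2 * β * q * (-n) ≤ 2 * β * q * M := by
        apply mul_le_mul_of_nonneg_left (by linarith) (by positivity)
      have h3 : 2 * β * (q * (4 * M)) < 2 * β * a0 := by
        apply mul_lt_mul_of_pos_left hqa (by positivity)
      nlinarith
  have hSub : ∀ x ∈ interior {u : ℝ | (hestLambda κ θ ξ v ρ t (q ^ 2) u).im = 0},
      (hestLambda κ θ ξ v ρ t (q ^ 2) x).im = 0 := by
    intro x hx
    have h := interior_subset hx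
    rwa [Set.mem_ofPred_eq] at h
  have hS := connectedComponentIn_subset (interior {u : ℝ | (hestLambda κ θ ξ v ρ t (q ^ 2) u).im = 0}) 0
  have h0S : (0:ℝ) ∈ interior {u : ℝ | (hestLambda κ θ ξ v ρ t (q ^ 2) u).im = 0} := by
    by_contra h
    unfold hestDom at hU
    rw [connectedComponentIn_eq_empty h] at hU
    exact hU
  have h0D : (0:ℝ) ∈ hestDom κ θ ξ v ρ t (q ^ 2) := mem_connectedComponentIn h0S
  have hoc : (hestDom κ θ ξ v ρ t (q ^ 2)).OrdConnected := isPreconnected_connectedComponentIn.ordConnected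
  have hUint := hS hU
  have hDS : ∀ x ∈ hestDom κ θ ξ v ρ t (q ^ 2), (hestLambda κ θ ξ v ρ t (q ^ 2) x).im = 0 :=
    fun x hx => hSub x (hS hx)
  have hUb : |U| < a0 + 1 := by
    rw [abs_lt]
    constructor
    · by_contra! h
      exact ends _ (Or.inr rfl) hT2 (hDS _ (hoc.out hU h0D ⟨h, by linarith⟩))
    · by_contra! h
      exact ends _ (Or.inl rfl) hT1 (hDS _ (hoc.out h0D hU ⟨by linarith, h⟩))
  have hUball : (U : ℂ) ∈ Metric.ball (0:ℂ) (R + 2) := by simp; linarith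
  have hND : HasDerivAt N (deriv N U) U :=
    ((nice.dN U hUball).differentiableAt (Metric.isOpen_ball.mem_nhds hUball)).hasDerivAt
  have hLD : HasDerivAt L (deriv L U) U :=
    ((nice.dL U hUball).differentiableAt (Metric.isOpen_ball.mem_nhds hUball)).hasDerivAt
  have hbD := bF_hasDerivAt β q N U _ hND
  have hbr := bF_real β q U N (nice.rN U)
  obtain ⟨ε, hε⟩ := hbr
  have hbDr : HasDerivAt (fun u : ℝ => (bF β q N u).re) (-2 * β * (U + q * deriv N U) : ℂ).re U :=
    hbD.real_of_complex
  have hN' : ‖deriv N U‖ ≤ 2 * M :=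
    (taylor_two nice.dN nice.bN).1 U (by simp; linarith)
  have near : ∀ᶠ u : ℝ in 𝓝[≠] U, hestD κ ρ ξ ((u : ℂ) / q) ≠ 0 ∧ u ≠ 0 ∧ u ≠ q ∧ |u| < R + 2 ∧
      0 ≤ (bF β q N u).re := by
    have h1 : ∀ᶠ u : ℝ in 𝓝[≠] U, u ∈ interior {u : ℝ | (hestLambda κ θ ξ v ρ t (q ^ 2) u).im = 0} :=
      mem_nhdsWithin_of_mem_nhds (isOpen_interior.mem_nhds hUint)
    have h2 : ∀ᶠ u : ℝ in 𝓝[≠] U, |u| < R + 2 :=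
      mem_nhdsWithin_of_mem_nhds ((continuous_abs.tendsto U).eventually_lt_const (by linarith))
    filter_upwards [h1, h2, nonjunk_punctured κ ρ ξ q U hξ hρ hq] with u hu1 hu2 ⟨hu3, hu4, hu5⟩
    refine ⟨hu3, hu4, hu5, hu2, ?_⟩
    by_contra! hneg
    obtain ⟨r, hr⟩ := bF_real β q u N (nice.rN u)
    rw [← hr] at hneg
    exact Gneg u r hu2 hu3 hu4 hu5 hr (by simpa using hneg) (hSub u hu1)
  have hε0 : 0 ≤ ε := by
    have h1 : Tendsto (fun u : ℝ => (bF β q N u).re) (𝓝[≠] U) (𝓝 (bF β q N U).re) :=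
      hbDr.continuousAt.tendsto.mono_left nhdsWithin_le_nhds
    have := ge_of_tendsto h1 (near.mono fun u hu => hu.2.2.2.2)
    rw [← hε] at this
    simpa using this
  have hεpos : 0 < ε := by
    rcases hε0.lt_or_eq with h | h
    · exact h
    exfalso
    have hloc : IsLocalMin (fun u : ℝ => (bF β q N u).re) U := by
      have hbU : (bF β q N U).re = 0 := by rw [← hε, ← h]; simp
      have h1 : ∀ᶠ u : ℝ in 𝓝[≠] U, (bF β q N U).re ≤ (bF β q N u).re := by
        filter_upwards [near] with u hu
        rw [hbU]; exact hu.2.2.2.2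
      have := eventually_nhdsWithin_iff.1 h1
      filter_upwards [this] with u hu
      by_cases hx : u = U
      · rw [hx]
      · exact hu hx
    have hz := hloc.hasDerivAt_eq_zero hbDr
    obtain ⟨n, hn⟩ := nice.rN U
    have hbn : |n| ≤ M := by
      have := nice.bN U hUball
      rw [← hn] at this; simpa using this
    have e1 : 1 - β * U ^ 2 - 2 * β * q * n = 0 := by
      have : ((1 - β * U ^ 2 - 2 * β * q * n : ℝ) : ℂ) = 0 := by
        have h3 := hε
        rw [← h, bF, ← hn] at h3
        push_cast; rw [← Complex.ofReal_zero, h3]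
      exact_mod_cast this
    have e2 : U = -q * (deriv N U).re := by
      have e3 : (-2 * β * (U + q * deriv N U) : ℂ).re = -2 * β * (U + q * (deriv N U).re) := by
        have : (-2 * β * (U + q * deriv N U) : ℂ) = ((-2 * β : ℝ) : ℂ) * (U + q * deriv N U) := by push_cast; ring
        rw [this, Complex.re_ofReal_mul, Complex.add_re, Complex.re_ofReal_mul]; simp
      rw [e3] at hz
      have : U + q * (deriv N U).re = 0 := by
        rcases mul_eq_zero.1 hz with h4 | h4
        · nlinarith
        · exact h4
      linarith
    have e4 : |U| ≤ q * (2 * M) := by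
      rw [e2, abs_mul, abs_neg, abs_of_pos hq]
      gcongr
      exact (Complex.abs_re_le_norm _).trans hN'
    have e5 : |U| ≤ a0 / 2 := by linarith
    have e6 : U ^ 2 ≤ (a0 / 2) ^ 2 := by rw [← sq_abs]; gcongr
    have e7 : 2 * β * q * n ≤ 2 * β * q * M := by gcongr; exact (abs_le.1 hbn).2
    nlinarith
  have hslit : bF β q N U ∈ Complex.slitPlane := by rw [← hε]; simpa using hεpos
  have hGD := GF_hasDerivAt β V m q N L U _ _ hLD hbD hslit
  have hΛD := (hGD.comp_ofReal).const_mul (q : ℂ)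
  have hdiff : DifferentiableAt ℝ (hestLambda κ θ ξ v ρ t (q ^ 2)) U := by
    apply differentiableAt_of_deriv_ne_zero
    rw [hderiv]; exact_mod_cast hk
  have hev : hestLambda κ θ ξ v ρ t (q ^ 2) =ᶠ[𝓝[≠] U] fun u : ℝ => (q : ℂ) * GF β V m q N L u := by
    have h1 : ∀ᶠ u : ℝ in 𝓝[≠] U, 0 < (bF β q N u).re := by
      have h2 : 0 < (bF β q N U).re := by rw [← hε]; simpa using hεpos
      exact (hbDr.continuousAt.tendsto.mono_left nhdsWithin_le_nhds).eventually_const_lt h2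
    filter_upwards [near, h1] with u hu hu1
    exact G1 u hu.2.2.2.1 hu.1 hu.2.1 hu.2.2.1 (fun h => by rw [h] at hu1; simp at hu1)
  have hev2 := (ContinuousAt.eventuallyEq_nhds_iff_eventuallyEq_nhdsNE hdiff.continuousAt hΛD.continuousAt).1 hev
  have hval := hev2.self_of_nhds
  have hder := hev2.deriv_eq
  rw [hderiv, hΛD.deriv] at hder
  refine ⟨hUb, ε, hεpos, hε, ?_, ?_⟩
  · rw [hder, ← hε]
  · have : (q : ℂ) ≠ 0 := by exact_mod_cast hq.ne'
    unfold hestLambda at hval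
    rw [lambda_eq _ _ _ _ _ _ _ hq] at hval
    exact mul_left_cancel₀ this hval

lemma tendsto_mul_bdd {l : Filter ℝ} {f g : ℝ → ℝ} (C : ℝ) (hf : Tendsto f l (𝓝 0))
    (hg : ∀ᶠ s in l, |g s| ≤ C) : Tendsto (fun s => f s * g s) l (𝓝 0) := by
  have h1 : Tendsto (fun s => |f s| * C) l (𝓝 0) := by simpa using hf.abs.mul_const C
  refine squeeze_zero_norm' ?_ h1
  filter_upwards [hg] with s hs
  rw [Real.norm_eq_abs, abs_mul]
  gcongr

set_option maxHeartbeats 1600000 in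
lemma asym (β V m k M a0 : ℝ) (hβ : 0 < β) (hV : 0 < V) (hm : 0 < m) (hk : 0 < k) (ha : 0 < a0)
    (hβa : β * a0 ^ 2 = 1) (U ε n n1 l1 : ℝ → ℝ)
    (H : ∀ᶠ s in 𝓝[>] (0:ℝ), 0 < ε s ∧ |U s| ≤ a0 + 1 ∧ |n s| ≤ M ∧ |n1 s| ≤ M ∧ |l1 s| ≤ M ∧
      k + m * s ^ 6 * l1 s = (U s + s ^ 2 * n1 s) * (V * (s / ε s) ^ 2 + 2 * β * m * s * (s / ε s)) ∧
      β * U s ^ 2 = 1 - ε s - 2 * β * s ^ 2 * n s) :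
    ∃ r0 r1 : ℝ, 0 < r0 ∧ V * a0 * r0 ^ 2 = k ∧
      2 * V * r0 * r1 = -k * (-a0 / (2 * r0)) / a0 ^ 2 - 2 * β * m * r0 ∧
      Tendsto U (𝓝[>] 0) (𝓝 a0) ∧ Tendsto (fun s => s / ε s) (𝓝[>] 0) (𝓝 r0) ∧
      Tendsto (fun s => (U s - a0) / s) (𝓝[>] 0) (𝓝 (-a0 / (2 * r0))) ∧
      Tendsto (fun s => (s / ε s - r0) / s) (𝓝[>] 0) (𝓝 r1) := by
  have hs0 : Tendsto (fun s : ℝ => s) (𝓝[>] 0) (𝓝 0) := tendsto_nhdsWithin_of_tendsto_nhds tendsto_id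
  have hpos : ∀ᶠ s in 𝓝[>] (0:ℝ), 0 < s := eventually_mem_nhdsWithin
  have hpow : ∀ j : ℕ, j ≠ 0 → Tendsto (fun s : ℝ => s ^ j) (𝓝[>] 0) (𝓝 0) := by
    intro j hj; simpa [hj] using hs0.pow j
  have t1 : Tendsto (fun s => s ^ 6 * l1 s) (𝓝[>] 0) (𝓝 0) :=
    tendsto_mul_bdd M (hpow 6 (by norm_num)) (H.mono fun s h => h.2.2.2.2.1)
  have t2 : Tendsto (fun s => s ^ 2 * n1 s) (𝓝[>] 0) (𝓝 0) :=
    tendsto_mul_bdd M (hpow 2 (by norm_num)) (H.mono fun s h => h.2.2.2.1)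
  have t3 : Tendsto (fun s => s ^ 2 * n s) (𝓝[>] 0) (𝓝 0) :=
    tendsto_mul_bdd M (hpow 2 (by norm_num)) (H.mono fun s h => h.2.2.1)
  have t4 : Tendsto (fun s => s * n s) (𝓝[>] 0) (𝓝 0) :=
    tendsto_mul_bdd M hs0 (H.mono fun s h => h.2.2.1)
  have t4' : Tendsto (fun s => s * n1 s) (𝓝[>] 0) (𝓝 0) :=
    tendsto_mul_bdd M hs0 (H.mono fun s h => h.2.2.2.1)
  have t5 : Tendsto (fun s => s ^ 5 * l1 s) (𝓝[>] 0) (𝓝 0) :=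
    tendsto_mul_bdd M (hpow 5 (by norm_num)) (H.mono fun s h => h.2.2.2.2.1)
  have c1 : ∀ᶠ s in 𝓝[>] (0:ℝ), k / 2 < k + m * s ^ 6 * l1 s := by
    have : Tendsto (fun s => k + m * (s ^ 6 * l1 s)) (𝓝[>] 0) (𝓝 (k + m * 0)) := (t1.const_mul m).const_add k
    filter_upwards [this.eventually_const_lt (show k / 2 < k + m * 0 by linarith)] with s hs
    linarith
  have c2 : ∀ᶠ s in 𝓝[>] (0:ℝ), |s ^ 2 * n1 s| < 1 := by
    have := t2.abs.eventually_lt_const (show |(0:ℝ)| < 1 by simp)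
    exact this
  have hlt1 : ∀ᶠ s in 𝓝[>] (0:ℝ), s < 1 := hs0.eventually_lt_const one_pos
  -- lower bound on the ratio
  set C := (a0 + 2) * (V + 2 * β * m) with hC
  have hCp : 0 < C := by positivity
  set c := min 1 (k / (2 * C)) with hc
  have hcp : 0 < c := by rw [hc]; positivity
  have c3 : ∀ᶠ s in 𝓝[>] (0:ℝ), c ≤ s / ε s := by
    filter_upwards [H, c1, c2, hpos, hlt1] with s ⟨h1, h2, h3, h4, h5, h6, h7⟩ hc1 hc2 hs hs1
    by_contra! hlt
    have hr0 : 0 < s / ε s := by positivity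
    have hr1 : s / ε s < 1 := hlt.trans_le (min_le_left _ _)
    have hr2 : s / ε s < k / (2 * C) := hlt.trans_le (min_le_right _ _)
    set r := s / ε s with hr
    have e1 : U s + s ^ 2 * n1 s ≤ a0 + 2 := by
      have := (abs_le.1 h2).2
      have := (abs_lt.1 hc2).2
      linarith
    have e2 : V * r ^ 2 + 2 * β * m * s * r ≤ (V + 2 * β * m) * r := by
      have : V * r ^ 2 ≤ V * r := by nlinarith [mul_pos hV hr0]
      have : 2 * β * m * s * r ≤ 2 * β * m * 1 * r := by gcongr
      linarith
    have e3 : 0 ≤ V * r ^ 2 + 2 * β * m * s * r := by positivity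
    have e4 : (U s + s ^ 2 * n1 s) * (V * r ^ 2 + 2 * β * m * s * r) ≤ (a0 + 2) * ((V + 2 * β * m) * r) :=
      mul_le_mul e1 e2 e3 (by positivity)
    have e5 : C * r < k / 2 := by
      rw [lt_div_iff₀ (by positivity)] at hr2
      linarith
    have e6 : (a0 + 2) * ((V + 2 * β * m) * r) = C * r := by rw [hC]; ring
    linarith
  have tε : Tendsto ε (𝓝[>] 0) (𝓝 0) := by
    have h1 : Tendsto (fun s : ℝ => s / c) (𝓝[>] 0) (𝓝 0) := by simpa using hs0.div_const c
    refine squeeze_zero' (H.mono fun s h => h.1.le) ?_ h1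
    filter_upwards [H, c3, hpos] with s h hc3 hs
    rw [le_div_iff₀ h.1] at hc3
    rw [le_div_iff₀ hcp]; linarith
  have tU2 : Tendsto (fun s => U s ^ 2) (𝓝[>] 0) (𝓝 (a0 ^ 2)) := by
    have h1 : Tendsto (fun s => (1 - ε s - 2 * β * (s ^ 2 * n s)) / β) (𝓝[>] 0) (𝓝 ((1 - 0 - 2 * β * 0) / β)) :=
      ((tε.const_sub 1).sub (t3.const_mul (2 * β))).div_const β
    have e : (1 - 0 - 2 * β * 0) / β = a0 ^ 2 := by field_simp; linarith
    rw [e] at h1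
    refine h1.congr' ?_
    filter_upwards [H] with s h
    have := h.2.2.2.2.2.2
    field_simp; linarith
  have tUabs : Tendsto (fun s => |U s|) (𝓝[>] 0) (𝓝 a0) := by
    have := (Real.continuous_sqrt.tendsto _).comp tU2
    rw [Real.sqrt_sq ha.le] at this
    refine this.congr fun s => ?_
    simp [Real.sqrt_sq_eq_abs]
  have cU : ∀ᶠ s in 𝓝[>] (0:ℝ), 0 < U s := by
    have h1 := tUabs.eventually_const_lt (show a0 / 2 < a0 by linarith)
    have h2 : ∀ᶠ s in 𝓝[>] (0:ℝ), |s ^ 2 * n1 s| < a0 / 2 :=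
      t2.abs.eventually_lt_const (show |(0:ℝ)| < a0 / 2 by simpa using ha)
    filter_upwards [h1, h2, H, c1, hpos] with s g1 g2 ⟨h1, h2, h3, h4, h5, h6, h7⟩ hc1 hs
    by_contra! hU
    rw [abs_of_nonpos hU] at g1
    have e1 : U s + s ^ 2 * n1 s ≤ 0 := by
      have := (abs_lt.1 g2).2
      linarith
    have e3 : 0 ≤ V * (s / ε s) ^ 2 + 2 * β * m * s * (s / ε s) := by positivity
    have := mul_nonneg_of_nonpos_of_nonpos e1 (neg_nonpos.2 e3)
    nlinarith
  have tU : Tendsto U (𝓝[>] 0) (𝓝 a0) := by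
    refine tUabs.congr' ?_
    filter_upwards [cU] with s hs using abs_of_pos hs
  set g := fun s => (k + m * (s ^ 6 * l1 s)) / (U s + s ^ 2 * n1 s) with hg
  have tden : Tendsto (fun s => U s + s ^ 2 * n1 s) (𝓝[>] 0) (𝓝 a0) := by simpa using tU.add t2
  have tg : Tendsto g (𝓝[>] 0) (𝓝 (k / a0)) := by
    have : Tendsto g (𝓝[>] 0) (𝓝 ((k + m * 0) / a0)) := ((t1.const_mul m).const_add k).div tden ha.ne'
    simpa using this
  have cden : ∀ᶠ s in 𝓝[>] (0:ℝ), 0 < U s + s ^ 2 * n1 s := tden.eventually_const_lt ha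
  have geq : ∀ᶠ s in 𝓝[>] (0:ℝ), V * (s / ε s) ^ 2 + 2 * β * m * s * (s / ε s) = g s := by
    filter_upwards [H, cden] with s ⟨h1, h2, h3, h4, h5, h6, h7⟩ hd
    rw [hg]; simp only
    rw [eq_div_iff hd.ne']
    linarith
  have crb : ∀ᶠ s in 𝓝[>] (0:ℝ), |s / ε s| ≤ (k / a0 + 1) / V + 1 := by
    filter_upwards [geq, tg.eventually_lt_const (show k / a0 < k / a0 + 1 by linarith), H, hpos] with s h1 h2 h3 hs
    have hr : 0 < s / ε s := div_pos hs h3.1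
    rw [abs_of_pos hr]
    have : 0 < 2 * β * m * s * (s / ε s) := by positivity
    have h4 : (s / ε s) ^ 2 ≤ (k / a0 + 1) / V := by rw [le_div_iff₀ hV]; linarith
    nlinarith
  have tsr : Tendsto (fun s => s * (s / ε s)) (𝓝[>] 0) (𝓝 0) := tendsto_mul_bdd _ hs0 crb
  set r0 := Real.sqrt (k / a0 / V) with hr0
  have hr0p : 0 < r0 := by rw [hr0]; positivity
  have hr0sq : r0 ^ 2 = k / a0 / V := Real.sq_sqrt (by positivity)
  have tr : Tendsto (fun s => s / ε s) (𝓝[>] 0) (𝓝 r0) := by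
    have h1 : Tendsto (fun s => (g s - 2 * β * m * (s * (s / ε s))) / V) (𝓝[>] 0) (𝓝 ((k / a0 - 2 * β * m * 0) / V)) :=
      (tg.sub (tsr.const_mul _)).div_const V
    have h2 := (Real.continuous_sqrt.tendsto _).comp h1
    have e : Real.sqrt ((k / a0 - 2 * β * m * 0) / V) = r0 := by rw [hr0]; congr 1; ring
    rw [e] at h2
    refine h2.congr' ?_
    filter_upwards [geq, H, hpos] with s h3 h4 hs
    have hr : 0 < s / ε s := div_pos hs h4.1
    simp only [Function.comp]
    rw [← h3]
    have : (V * (s / ε s) ^ 2 + 2 * β * m * s * (s / ε s) - 2 * β * m * (s * (s / ε s))) / V = (s / ε s) ^ 2 := by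
      field_simp; ring
    rw [this, Real.sqrt_sq hr.le]
  have trinv : Tendsto (fun s => (s / ε s)⁻¹) (𝓝[>] 0) (𝓝 r0⁻¹) := tr.inv₀ hr0p.ne'
  have tUa : Tendsto (fun s => (U s - a0) / s) (𝓝[>] 0) (𝓝 (-a0 / (2 * r0))) := by
    have h1 : Tendsto (fun s => (-(s / ε s)⁻¹ / β - 2 * (s * n s)) / (U s + a0)) (𝓝[>] 0)
        (𝓝 ((-r0⁻¹ / β - 2 * 0) / (a0 + a0))) :=
      (((trinv.neg).div_const β).sub (t4.const_mul 2)).div (tU.add_const a0) (by positivity)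
    have e : (-r0⁻¹ / β - 2 * 0) / (a0 + a0) = -a0 / (2 * r0) := by
      field_simp
      nlinarith
    rw [e] at h1
    refine h1.congr' ?_
    filter_upwards [H, hpos, cU] with s ⟨h1, h2, h3, h4, h5, h6, h7⟩ hs hU
    have : 0 < U s + a0 := by linarith
    rw [div_eq_div_iff this.ne' hs.ne', inv_div]
    have e2 : (U s - a0) * (U s + a0) = -ε s / β - 2 * s ^ 2 * n s := by
      field_simp
      nlinarith
    rw [e2]; field_simp
  set r1 := (-k * (-a0 / (2 * r0)) / a0 ^ 2 - 2 * β * m * r0) / (2 * V * r0) with hr1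
  refine ⟨r0, r1, hr0p, by rw [hr0sq]; field_simp, by rw [hr1]; field_simp, tU, tr, tUa, ?_⟩
  have h1 : Tendsto (fun s => ((m * (s ^ 5 * l1 s) * a0 - k * ((U s - a0) / s + s * n1 s)) / ((U s + s ^ 2 * n1 s) * a0)
      - 2 * β * m * (s / ε s)) / (V * (s / ε s + r0))) (𝓝[>] 0)
      (𝓝 (((m * 0 * a0 - k * (-a0 / (2 * r0) + 0)) / (a0 * a0) - 2 * β * m * r0) / (V * (r0 + r0)))) := by
    refine Tendsto.div (Tendsto.sub (Tendsto.div (Tendsto.sub ((t5.const_mul m).mul_const a0)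
      ((tUa.add t4').const_mul k)) (tden.mul_const a0) (by positivity)) (tr.const_mul _))
      ((tr.add_const r0).const_mul V) (by positivity)
  have e : ((m * 0 * a0 - k * (-a0 / (2 * r0) + 0)) / (a0 * a0) - 2 * β * m * r0) / (V * (r0 + r0)) = r1 := by
    rw [hr1]; field_simp; ring
  rw [e] at h1
  refine h1.congr' ?_
  filter_upwards [H, hpos, cU, cden, geq] with s ⟨h1, h2, h3, h4, h5, h6, h7⟩ hs hU hd hge
  have hr : 0 < s / ε s := div_pos hs h1
  set r := s / ε s with hrr
  have : 0 < r + r0 := by linarith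
  rw [div_eq_div_iff (by positivity) hs.ne']
  have e2 : (r - r0) * (V * (r + r0)) = V * r ^ 2 - k / a0 := by
    have : V * r0 ^ 2 = k / a0 := by rw [hr0sq]; field_simp
    linear_combination -this
  have e3 : V * r ^ 2 = (k + m * s ^ 6 * l1 s) / (U s + s ^ 2 * n1 s) - 2 * β * m * s * r := by
    rw [eq_sub_iff_add_eq, eq_div_iff hd.ne']; linarith
  rw [e2, e3]
  field_simp
  ring

lemma log_three (e : ℂ) (he : ‖e‖ ≤ 1 / 2) : ‖Complex.log (1 + e) - e + e ^ 2 / 2‖ ≤ ‖e‖ ^ 3 := by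
  have h := Complex.norm_log_sub_logTaylor_le 2 (show ‖e‖ < 1 by linarith)
  have e1 : Complex.logTaylor (2 + 1) e = e - e ^ 2 / 2 := by
    simp [Complex.logTaylor_succ, Complex.logTaylor_zero]; ring
  rw [e1] at h
  have e2 : Complex.log (1 + e) - e + e ^ 2 / 2 = Complex.log (1 + e) - (e - e ^ 2 / 2) := by ring
  rw [e2]
  refine h.trans ?_
  have h3 : (1 - ‖e‖)⁻¹ ≤ 2 := by
    rw [inv_le_comm₀ (by linarith) (by norm_num)]; linarith
  have h4 : 0 ≤ ‖e‖ ^ 3 := by positivity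
  have h5 : ‖e‖ ^ (2 + 1) * (1 - ‖e‖)⁻¹ ≤ ‖e‖ ^ 3 * 2 := by gcongr
  push_cast
  linarith

lemma inv_five (e : ℂ) (he : ‖e‖ ≤ 1 / 2) :
    ‖e ^ 2 / (1 + e) - (e ^ 2 - e ^ 3 + e ^ 4)‖ ≤ 2 * ‖e‖ ^ 5 := by
  have h1 : 1 / 2 ≤ ‖1 + e‖ := by
    have := norm_sub_le (1 + e) e
    have h2 : (1 + e) - e = 1 := by ring
    rw [h2, norm_one] at this
    linarith
  have hne : 1 + e ≠ 0 := by intro h; rw [h] at h1; simp at h1; linarith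
  have : e ^ 2 / (1 + e) - (e ^ 2 - e ^ 3 + e ^ 4) = -(e ^ 5 / (1 + e)) := by field_simp; ring
  rw [this, norm_neg, norm_div, norm_pow, div_le_iff₀ (by linarith)]
  nlinarith [pow_nonneg (norm_nonneg e) 5]

set_option maxHeartbeats 1600000 in
/-- expansion of the exponent with explicit remainder. -/
lemma exp_rem (C : ℝ) (hC : 1 ≤ C) (h u w m : ℝ) (hh : 0 < h) (hw : 1 ≤ w) (huw : |u| ≤ w)
    (hhw : 6 * C * (h * w) ≤ 1)
    (K P S σ D : ℂ) (hK : ‖K‖ ≤ C) (hP : ‖P‖ ≤ C) (hS : ‖S‖ ≤ C) (hm : |m| ≤ C)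
    (hσ : ‖σ - S * h ^ 4 * u ^ 2‖ ≤ C * (h ^ 8 * u ^ 2)) (hD : ‖D‖ ≤ C * (h ^ 6 * u ^ 2)) :
    ‖h * u * P + σ‖ ≤ 1 / 2 ∧
    ‖(K / h ^ 2 * ((h * u * P + σ) ^ 2 / (1 + (h * u * P + σ)) - σ)
      - m * (Complex.log (1 + (h * u * P + σ)) - (h * u * P + σ) + σ) - m * (h ^ 8 * D)) -
      (K * P ^ 2 * u ^ 2 - h * (K * P ^ 3) * u ^ 3 +
        h ^ 2 * (K * P ^ 4 * u ^ 4 + (m * P ^ 2 / 2 - K * S) * u ^ 2))‖ ≤ 3000 * C ^ 6 * (h ^ 3 * w ^ 5) := by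
  set p : ℂ := h * u * P with hp
  set e : ℂ := p + σ with he
  have hw0 : 0 < w := by linarith
  have hC0 : 0 < C := by linarith
  set W := h * w with hW
  have hWp : 0 < W := by positivity
  have hW1 : W ≤ 1 := by nlinarith
  have hh1 : h ≤ W := by rw [hW]; nlinarith
  have hu2 : u ^ 2 ≤ w ^ 2 := by rw [← sq_abs]; gcongr
  have hu2' : ‖(u : ℂ) ^ 2‖ ≤ w ^ 2 := by
    rw [norm_pow, Complex.norm_real, Real.norm_eq_abs]; gcongr
  have hhn : ‖(h : ℂ)‖ = h := by rw [Complex.norm_real, Real.norm_eq_abs, abs_of_pos hh]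
  have hun : ‖(u : ℂ)‖ ≤ w := by rw [Complex.norm_real, Real.norm_eq_abs]; exact huw
  have hmn : ‖(m : ℂ)‖ ≤ C := by rw [Complex.norm_real, Real.norm_eq_abs]; exact hm
  have b1 : ‖p‖ ≤ C * W := by
    rw [hp, norm_mul, norm_mul, hhn]
    calc h * ‖(u:ℂ)‖ * ‖P‖ ≤ h * w * C := by gcongr
      _ = C * W := by rw [hW]; ring
  have bs' : ‖σ - S * h ^ 4 * u ^ 2‖ ≤ C * (h ^ 2 * (W ^ 2 * h ^ 4)) := by
    refine hσ.trans ?_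
    have : h ^ 8 * u ^ 2 ≤ h ^ 8 * w ^ 2 := by gcongr
    calc C * (h ^ 8 * u ^ 2) ≤ C * (h ^ 8 * w ^ 2) := by gcongr
      _ = _ := by rw [hW]; ring
  have hh4 : h ^ 4 ≤ 1 := pow_le_one₀ hh.le (hh1.trans hW1)
  have bs : ‖σ‖ ≤ 2 * C * (h ^ 2 * W ^ 2) := by
    have h1 : ‖S * h ^ 4 * u ^ 2‖ ≤ C * (h ^ 2 * W ^ 2) := by
      rw [norm_mul, norm_mul, norm_pow, hhn]
      calc ‖S‖ * h ^ 4 * ‖(u:ℂ) ^ 2‖ ≤ C * h ^ 4 * w ^ 2 := by gcongr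
        _ = _ := by rw [hW]; ring
    have h2 := norm_add_le (σ - S * h ^ 4 * u ^ 2) (S * h ^ 4 * u ^ 2)
    rw [sub_add_cancel] at h2
    have h3 : C * (h ^ 2 * (W ^ 2 * h ^ 4)) ≤ C * (h ^ 2 * (W ^ 2 * 1)) := by gcongr
    linarith
  have hh2 : h ^ 2 ≤ 1 := pow_le_one₀ hh.le (hh1.trans hW1)
  have bs2 : ‖σ‖ ≤ 2 * C * W := by
    refine bs.trans ?_
    have : h ^ 2 * W ^ 2 ≤ 1 * W := by
      apply mul_le_mul hh2 _ (by positivity) (by norm_num); nlinarith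
    nlinarith
  have be : ‖e‖ ≤ 3 * C * W := by
    rw [he]; refine (norm_add_le _ _).trans ?_; linarith
  have be2 : ‖e‖ ≤ 1 / 2 := be.trans (by linarith)
  refine ⟨be2, ?_⟩
  have hhc : (h : ℂ) ≠ 0 := by exact_mod_cast hh.ne'
  have hp2 : p ^ 2 = h ^ 2 * (P ^ 2 * u ^ 2) := by rw [hp]; ring
  have key : (K / h ^ 2 * (e ^ 2 / (1 + e) - σ) - m * (Complex.log (1 + e) - e + σ) - m * (h ^ 8 * D)) -
      (K * P ^ 2 * u ^ 2 - h * (K * P ^ 3) * u ^ 3 +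
        h ^ 2 * (K * P ^ 4 * u ^ 4 + (m * P ^ 2 / 2 - K * S) * u ^ 2)) =
      K / h ^ 2 * (e ^ 2 / (1 + e) - (e ^ 2 - e ^ 3 + e ^ 4)) +
      K / h ^ 2 * (σ * ((e + p) - (e ^ 2 + e * p + p ^ 2) + (e + p) * (e ^ 2 + p ^ 2)))
      - K / h ^ 2 * (σ - S * h ^ 4 * u ^ 2) - m * (Complex.log (1 + e) - e + e ^ 2 / 2)
      + m * (σ * (e + p) / 2) - m * σ - m * (h ^ 8 * D) := by
    have e3 : K / h ^ 2 * p ^ 2 = K * P ^ 2 * u ^ 2 := by rw [hp]; field_simp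
    have e4 : K / h ^ 2 * p ^ 3 = h * (K * P ^ 3) * u ^ 3 := by rw [hp]; field_simp
    have e5 : K / h ^ 2 * p ^ 4 = h ^ 2 * (K * P ^ 4 * u ^ 4) := by rw [hp]; field_simp
    have e6 : K / h ^ 2 * (S * h ^ 4 * u ^ 2) = h ^ 2 * (K * S * u ^ 2) := by field_simp
    have e7 : σ = e - p := by rw [he]; ring
    linear_combination (e3 - e4 + e5) + (-1) * (-1) * e6 * (-1) + (m : ℂ) / 2 * hp2 * (1) + (K / h ^ 2 * ((e + p) - (e ^ 2 + e * p + p ^ 2) + (e + p) * (e ^ 2 + p ^ 2)) + m * (e + p) / 2) * e7 * (-1)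
  rw [key]
  have hWw : W ^ 3 ≤ h ^ 3 * w ^ 5 := by
    rw [hW, mul_pow]; gcongr <;> norm_num
  have hK2 : ‖K / (h:ℂ) ^ 2‖ ≤ C / h ^ 2 := by
    rw [norm_div, norm_pow, hhn]; gcongr
  have hhle : h ≤ 1 := hh1.trans hW1
  have hCn : ∀ i j : ℕ, i ≤ j → C ^ i ≤ C ^ j := fun i j hij => pow_le_pow_right₀ hC hij
  set Q := C ^ 6 * (h ^ 3 * w ^ 5) with hQ
  have hQ3 : ∀ j : ℕ, j ≤ 6 → C ^ j * W ^ 3 ≤ Q := by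
    intro j hj; rw [hQ]; gcongr
  have T1 : ‖K / h ^ 2 * (e ^ 2 / (1 + e) - (e ^ 2 - e ^ 3 + e ^ 4))‖ ≤ 486 * Q := by
    rw [norm_mul]
    calc _ ≤ C / h ^ 2 * (2 * (3 * C * W) ^ 5) := by
          gcongr
          exact (inv_five e be2).trans (by gcongr)
      _ = _ := by rw [hQ, hW]; field_simp; ring
  have T2 : ‖K / h ^ 2 * (σ * ((e + p) - (e ^ 2 + e * p + p ^ 2) + (e + p) * (e ^ 2 + p ^ 2)))‖ ≤ 114 * Q := by
    have c1 : ‖e + p‖ ≤ 4 * C * W := (norm_add_le _ _).trans (by linarith)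
    have c2 : ‖e ^ 2 + e * p + p ^ 2‖ ≤ 13 * C ^ 2 * W ^ 2 := by
      refine (norm_add₃_le).trans ?_
      rw [norm_pow, norm_mul, norm_pow]
      calc _ ≤ (3 * C * W) ^ 2 + (3 * C * W) * (C * W) + (C * W) ^ 2 := by gcongr
        _ = _ := by ring
    have c3 : ‖e ^ 2 + p ^ 2‖ ≤ 10 * C ^ 2 * W ^ 2 := by
      refine (norm_add_le _ _).trans ?_
      rw [norm_pow, norm_pow]
      calc _ ≤ (3 * C * W) ^ 2 + (C * W) ^ 2 := by gcongr
        _ = _ := by ring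
    have c4 : ‖(e + p) - (e ^ 2 + e * p + p ^ 2) + (e + p) * (e ^ 2 + p ^ 2)‖ ≤ 57 * (C ^ 3 * W) := by
      refine (norm_add_le _ _).trans ?_
      rw [norm_mul]
      have d1 := norm_sub_le (e + p) (e ^ 2 + e * p + p ^ 2)
      have d2 : ‖e + p‖ * ‖e ^ 2 + p ^ 2‖ ≤ (4 * C * W) * (10 * C ^ 2 * W ^ 2) := by gcongr
      have d3 : (4 * C * W) * (10 * C ^ 2 * W ^ 2) ≤ 40 * (C ^ 3 * W) := by
        have : (4 * C * W) * (10 * C ^ 2 * W ^ 2) = 40 * (C ^ 3 * W) * W ^ 2 := by ring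
        rw [this]
        exact mul_le_of_le_one_right (by positivity) (pow_le_one₀ hWp.le hW1)
      have d4 : 13 * C ^ 2 * W ^ 2 ≤ 13 * (C ^ 3 * W) := by
        have : W ^ 2 ≤ W := by nlinarith
        have := hCn 2 3 (by norm_num)
        calc 13 * C ^ 2 * W ^ 2 ≤ 13 * C ^ 3 * W := by gcongr
          _ = _ := by ring
      have d5 : 4 * C * W ≤ 4 * (C ^ 3 * W) := by
        have := hCn 1 3 (by norm_num)
        rw [pow_one] at this
        nlinarith
      linarith
    rw [norm_mul, norm_mul]
    calc _ ≤ C / h ^ 2 * ((2 * C * (h ^ 2 * W ^ 2)) * (57 * (C ^ 3 * W))) := by gcongr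
      _ = 114 * (C ^ 5 * W ^ 3) := by field_simp; ring
      _ ≤ _ := by have := hQ3 5 (by norm_num); linarith
  have hh4W : h ^ 4 ≤ W := by
    calc h ^ 4 ≤ h ^ 1 := pow_le_pow_of_le_one hh.le hhle (by norm_num)
      _ ≤ W := by rw [pow_one]; exact hh1
  have hh2W : h ^ 2 ≤ W := by
    calc h ^ 2 ≤ h ^ 1 := pow_le_pow_of_le_one hh.le hhle (by norm_num)
      _ ≤ W := by rw [pow_one]; exact hh1
  have T3 : ‖K / h ^ 2 * (σ - S * h ^ 4 * u ^ 2)‖ ≤ Q := by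
    rw [norm_mul]
    calc _ ≤ C / h ^ 2 * (C * (h ^ 2 * (W ^ 2 * W))) := by
          gcongr
          exact bs'.trans (by gcongr)
      _ = C ^ 2 * W ^ 3 := by field_simp
      _ ≤ _ := hQ3 2 (by norm_num)
  have T4 : ‖(m : ℂ) * (Complex.log (1 + e) - e + e ^ 2 / 2)‖ ≤ 27 * Q := by
    rw [norm_mul]
    calc _ ≤ C * (3 * C * W) ^ 3 := by
          gcongr
          exact (log_three e be2).trans (by gcongr)
      _ = 27 * (C ^ 4 * W ^ 3) := by ring
      _ ≤ _ := by have := hQ3 4 (by norm_num); linarith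
  have T5 : ‖(m : ℂ) * (σ * (e + p) / 2)‖ ≤ 4 * Q := by
    have c1 : ‖e + p‖ ≤ 4 * C * W := (norm_add_le _ _).trans (by linarith)
    rw [norm_mul, norm_div, norm_mul]
    have : ‖(2:ℂ)‖ = 2 := by simp
    rw [this]
    calc _ ≤ C * ((2 * C * (1 * W ^ 2)) * (4 * C * W) / 2) := by
          gcongr
          exact bs.trans (by gcongr)
      _ = 4 * (C ^ 3 * W ^ 3) := by ring
      _ ≤ _ := by have := hQ3 3 (by norm_num); linarith
  have T6 : ‖(m : ℂ) * σ‖ ≤ 2 * Q := by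
    rw [norm_mul]
    calc _ ≤ C * (2 * C * (W * W ^ 2)) := by
          gcongr
          exact bs.trans (by gcongr)
      _ = 2 * (C ^ 2 * W ^ 3) := by ring
      _ ≤ _ := by have := hQ3 2 (by norm_num); linarith
  have T7 : ‖(m : ℂ) * (h ^ 8 * D)‖ ≤ Q := by
    rw [norm_mul, norm_mul, norm_pow, hhn]
    have : h ^ 12 ≤ W := by
      calc h ^ 12 ≤ h ^ 1 := pow_le_pow_of_le_one hh.le hhle (by norm_num)
        _ ≤ W := by rw [pow_one]; exact hh1
    calc _ ≤ C * (h ^ 8 * (C * (h ^ 6 * w ^ 2))) := by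
          gcongr
          exact hD.trans (by gcongr)
      _ = C ^ 2 * (h ^ 12 * W ^ 2) := by rw [hW]; ring
      _ ≤ C ^ 2 * (W * W ^ 2) := by gcongr
      _ = C ^ 2 * W ^ 3 := by ring
      _ ≤ _ := hQ3 2 (by norm_num)
  have hQ0 : 0 ≤ Q := by positivity
  have hfin : ∀ a b c d f g i : ℂ, ‖a + b - c - d + f - g - i‖ ≤ ‖a‖ + ‖b‖ + ‖c‖ + ‖d‖ + ‖f‖ + ‖g‖ + ‖i‖ := by
    intro a b c d f g i
    have h1 := norm_sub_le (a + b - c - d + f - g) i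
    have h2 := norm_sub_le (a + b - c - d + f) g
    have h3 := norm_add_le (a + b - c - d) f
    have h4 := norm_sub_le (a + b - c) d
    have h5 := norm_sub_le (a + b) c
    have h6 := norm_add_le a b
    linarith
  refine (hfin _ _ _ _ _ _ _).trans ?_
  have : 3000 * C ^ 6 * (h ^ 3 * w ^ 5) = 3000 * Q := by rw [hQ]; ring
  linarith

lemma bF_taylor (β q y U : ℝ) (N : ℂ → ℂ) (N' : ℂ) :
    bF β q N (U + Complex.I * y) = bF β q N U + Complex.I * y * (-2 * β * (U + q * N')) +
      (β * y ^ 2 - 2 * β * q * (N (U + Complex.I * y) - N U - N' * ((U + Complex.I * y) - U))) := by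
  unfold bF
  have := Complex.I_sq
  linear_combination (-(β : ℂ) * y ^ 2) * this

set_option maxHeartbeats 1600000 in
lemma GF_expand (C β V m R M k U ε h u : ℝ) (q r w : ℝ) (N L : ℂ → ℂ) (hβ : 0 < β) (hV : 0 < V)
    (hC : 1 ≤ C) (nice : Nice R M N L) (hh : 0 < h) (hq : q = h ^ 4) (hr : r = h ^ 2 / ε)
    (hw : w = 1 + |u|) (hε : 0 < ε) (hbε : (ε : ℂ) = bF β q N U) (hU : |U| < R) (hz : |U| + h ^ 3 * |u| < R)
    (hk : (k : ℂ) = q * (-(m : ℂ) * (q ^ 2 * deriv L U) - (V : ℂ) / (2 * β) *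
            (-2 * β * (U + q * deriv N U) / ε ^ 2)
          - (m : ℂ) * (-2 * β * (U + q * deriv N U) / ε)))
    (hhw : 6 * C * (h * w) ≤ 1) (hm : |m| ≤ C)
    (c1 : V * r / (2 * β) ≤ C) (c2 : ‖-2 * Complex.I * β * r * (U + q * deriv N U)‖ ≤ C)
    (c3 : β * r ≤ C) (c4 : 8 * β * M * r ≤ C) (c5 : 4 * M ≤ C) :
    bF β q N (U + Complex.I * (h ^ 3 * u : ℝ)) ≠ 0 ∧
    ‖(GF β V m q N L (U + Complex.I * (h ^ 3 * u : ℝ)) - GF β V m q N L U - Complex.I * u * k / h) -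
      (((V * r / (2 * β) : ℝ) : ℂ) * (-2 * Complex.I * β * r * (U + q * deriv N U)) ^ 2 * u ^ 2
        - h * (((V * r / (2 * β) : ℝ) : ℂ) * (-2 * Complex.I * β * r * (U + q * deriv N U)) ^ 3) * u ^ 3 +
        h ^ 2 * (((V * r / (2 * β) : ℝ) : ℂ) * (-2 * Complex.I * β * r * (U + q * deriv N U)) ^ 4 * u ^ 4 +
          (m * (-2 * Complex.I * β * r * (U + q * deriv N U)) ^ 2 / 2
            - ((V * r / (2 * β) : ℝ) : ℂ) * ((β * r : ℝ) : ℂ)) * u ^ 2))‖ ≤ 3000 * C ^ 6 * (h ^ 3 * w ^ 5) := by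
  set z : ℂ := U + Complex.I * (h ^ 3 * u : ℝ) with hzd
  set P : ℂ := -2 * Complex.I * β * r * (U + q * deriv N U) with hP
  have hUb : (U : ℂ) ∈ Metric.ball (0:ℂ) R := by simpa using hU
  have hzU : ‖z - U‖ = h ^ 3 * |u| := by
    rw [hzd, add_sub_cancel_left, norm_mul, Complex.norm_I, one_mul, Complex.norm_real, Real.norm_eq_abs,
      abs_mul, abs_of_pos (by positivity)]
  have hzb : z ∈ Metric.ball (0:ℂ) R := by
    rw [mem_ball_zero_iff]
    have := norm_add_le (U : ℂ) (z - U)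
    rw [hzU, Complex.norm_real, Real.norm_eq_abs, add_sub_cancel] at this
    linarith
  have hzU2 : ‖z - U‖ ^ 2 = h ^ 6 * u ^ 2 := by rw [hzU, mul_pow, sq_abs]; ring
  have hr0 : 0 < r := by rw [hr]; positivity
  have hM0 : 0 ≤ M := le_trans (norm_nonneg _) (nice.bN 0 (by
    simp; have := abs_nonneg U; linarith))
  set remN := N z - N U - deriv N U * (z - U) with hremN
  set D := L z - L U - deriv L U * (z - U) with hDd
  have hrN : ‖remN‖ ≤ 4 * M * (h ^ 6 * u ^ 2) := by
    rw [← hzU2]; exact (taylor_two nice.dN nice.bN).2 z hzb U hUb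
  have hrL : ‖D‖ ≤ 4 * M * (h ^ 6 * u ^ 2) := by
    rw [← hzU2]; exact (taylor_two nice.dL nice.bL).2 z hzb U hUb
  set K : ℂ := ((V * r / (2 * β) : ℝ) : ℂ) with hK
  set S : ℂ := ((β * r : ℝ) : ℂ) with hS
  set σ : ℂ := (β * ((h ^ 3 * u : ℝ) : ℂ) ^ 2 - 2 * β * q * remN) / ε with hσ
  have hεc : (ε : ℂ) ≠ 0 := by exact_mod_cast hε.ne'
  have hβc : (β : ℂ) ≠ 0 := by exact_mod_cast hβ.ne'
  have hhc : (h : ℂ) ≠ 0 := by exact_mod_cast hh.ne'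
  have hrc : (r : ℂ) = h ^ 2 / ε := by rw [hr]; push_cast; ring
  have hqc : (q : ℂ) = h ^ 4 := by rw [hq]; push_cast; ring
  have hbz : bF β q N z = ε * (1 + (h * u * P + σ)) := by
    rw [hzd, bF_taylor β q (h ^ 3 * u) U N (deriv N U), ← hbε, ← hzd, ← hremN, hP, hσ, hrc]
    push_cast
    field_simp
    ring
  have hσ1 : ‖σ - S * h ^ 4 * u ^ 2‖ ≤ C * (h ^ 8 * u ^ 2) := by
    have e1 : σ - S * h ^ 4 * u ^ 2 = -((2 * β * r * h ^ 2 : ℝ) : ℂ) * remN := by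
      rw [hσ, hS]; push_cast; rw [hrc, hqc]; field_simp; ring
    rw [e1, norm_mul, norm_neg, Complex.norm_real, Real.norm_eq_abs, abs_of_pos (by positivity)]
    calc _ ≤ 2 * β * r * h ^ 2 * (4 * M * (h ^ 6 * u ^ 2)) := by gcongr
      _ = 8 * β * M * r * (h ^ 8 * u ^ 2) := by ring
      _ ≤ _ := by gcongr
  have hKn : ‖K‖ ≤ C := by
    rw [hK, Complex.norm_real, Real.norm_eq_abs, abs_of_pos (by positivity)]; exact c1
  have hSn : ‖S‖ ≤ C := by
    rw [hS, Complex.norm_real, Real.norm_eq_abs, abs_of_pos (by positivity)]; exact c3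
  obtain ⟨g1, g2⟩ := exp_rem C hC h u w m hh (by rw [hw]; linarith [abs_nonneg u]) (by rw [hw]; linarith) hhw
    K P S σ D hKn c2 hSn hm hσ1 (hrL.trans (by gcongr))
  set e : ℂ := h * u * P + σ with he
  have h1e : 1 + e ≠ 0 := by
    intro h0
    have : e = -1 := by linear_combination h0
    rw [this] at g1; norm_num at g1
  refine ⟨by rw [hbz]; exact mul_ne_zero hεc h1e, ?_⟩
  convert g2 using 2
  congr 1
  have hlog : Complex.log (bF β q N z) = Complex.log ε + Complex.log (1 + e) := by
    rw [hbz, Complex.log_ofReal_mul hε h1e, Complex.ofReal_log hε.le]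
  unfold GF
  rw [hlog, ← hbε, hbz, hk]
  have hLz : L z = D + L U + deriv L U * (z - U) := by rw [hDd]; ring
  rw [hLz]
  have hzU' : z - U = Complex.I * (h ^ 3 * u) := by rw [hzd]; push_cast; ring
  rw [hzU']
  have hKr : K / h ^ 2 = V / (2 * β * ε) := by
    rw [hK]; push_cast; rw [hrc]; field_simp
  rw [hKr]
  have heP : e - σ = Complex.I * (h ^ 3 * u) * (-2 * β * (U + q * deriv N U)) / ε := by
    rw [he, hP, hrc]; field_simp; ring
  have hX : (U + q * deriv N U) = -(e - σ) * ε / (2 * β * (Complex.I * (h ^ 3 * u))) ∨ u = 0 := by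
    by_cases hu : u = 0
    · right; exact hu
    left
    have huc : (u : ℂ) ≠ 0 := by exact_mod_cast hu
    rw [heP]; field_simp
  have hinv : 1 / (ε * (1 + e)) - 1 / (ε : ℂ) = 1 / ε * (e ^ 2 / (1 + e) - e) := by
    field_simp; ring
  have hI : Complex.I * u * (q * (-(m : ℂ) * (q ^ 2 * deriv L U) - (V : ℂ) / (2 * β) *
            (-2 * β * (U + q * deriv N U) / ε ^ 2)
          - (m : ℂ) * (-2 * β * (U + q * deriv N U) / ε))) / h =
      -(m : ℂ) * (q ^ 2 * (deriv L U * (Complex.I * (h ^ 3 * u)))) - V / (2 * β) * ((e - σ) / ε) - m * (e - σ) := by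
    rw [heP, hqc]; field_simp
  rw [hI]
  have hq2 : (q : ℂ) ^ 2 = h ^ 8 := by rw [hqc]; ring
  rw [hq2]
  have hV2 : (V : ℂ) / (2 * β * ε) = V / (2 * β) * (1 / ε) := by field_simp
  rw [hV2]
  linear_combination ((V : ℂ) / (2 * β)) * hinv

lemma inv_gap (ε X Y T : ℝ) (hε : 0 < ε) (hX : ε / 2 ≤ X) (h1 : -(Y ^ 2 / 2) ≤ X ^ 2 - ε * X) (hT : 0 ≤ T)
    (hTY : T ≤ Y ^ 2) : X / (X ^ 2 + Y ^ 2) ≤ 1 / ε - 1 / (8 * ε) * (T / (ε ^ 2 + T)) := by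
  have hX0 : 0 < X := by linarith
  have hden : 0 < X ^ 2 + Y ^ 2 := by positivity
  have hT2 : T / (ε ^ 2 + T) ≤ Y ^ 2 / (ε ^ 2 + Y ^ 2) := by
    rw [div_le_div_iff₀ (by positivity) (by positivity)]
    nlinarith [mul_nonneg (sq_nonneg ε) (sub_nonneg.2 hTY)]
  have key : 1 / 8 * (Y ^ 2 / (ε ^ 2 + Y ^ 2)) ≤ (X ^ 2 + Y ^ 2 - ε * X) / (X ^ 2 + Y ^ 2) := by
    by_cases h : 2 * ε ≤ X
    · have g1 : Y ^ 2 / (ε ^ 2 + Y ^ 2) ≤ 1 := by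
        rw [div_le_one (by positivity)]; nlinarith [sq_nonneg ε]
      have g2 : 1 / 2 ≤ (X ^ 2 + Y ^ 2 - ε * X) / (X ^ 2 + Y ^ 2) := by
        rw [le_div_iff₀ hden]; nlinarith [sq_nonneg Y]
      linarith
    · push Not at h
      rw [← mul_div_assoc, div_le_div_iff₀ (by positivity) hden]
      have g1 : X ^ 2 ≤ 4 * ε ^ 2 := by nlinarith
      have g2 : Y ^ 2 / 2 ≤ X ^ 2 + Y ^ 2 - ε * X := by linarith
      have g3 : Y ^ 2 / 2 * (ε ^ 2 + Y ^ 2) ≤ (X ^ 2 + Y ^ 2 - ε * X) * (ε ^ 2 + Y ^ 2) := by gcongr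
      have g4 : 1 / 8 * Y ^ 2 * (X ^ 2 + Y ^ 2) ≤ 1 / 8 * Y ^ 2 * (4 * ε ^ 2 + Y ^ 2) := by gcongr
      nlinarith [mul_nonneg (sq_nonneg Y) (sq_nonneg Y)]
  have e : X / (X ^ 2 + Y ^ 2) = 1 / ε - 1 / ε * ((X ^ 2 + Y ^ 2 - ε * X) / (X ^ 2 + Y ^ 2)) := by
    field_simp; ring
  rw [e]
  have : 1 / (8 * ε) * (T / (ε ^ 2 + T)) = 1 / ε * (1 / 8 * (T / (ε ^ 2 + T))) := by field_simp
  rw [this]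
  have h3 : 1 / 8 * (T / (ε ^ 2 + T)) ≤ (X ^ 2 + Y ^ 2 - ε * X) / (X ^ 2 + Y ^ 2) := by linarith
  have := mul_le_mul_of_nonneg_left h3 (show 0 ≤ 1 / ε by positivity)
  linarith

lemma GF_re (β V m q : ℝ) (N L : ℂ → ℂ) (z : ℂ) :
    (GF β V m q N L z).re = -(m * (q ^ 2 * (L z).re)) + V / (2 * β) * ((bF β q N z).re /
      ((bF β q N z).re ^ 2 + (bF β q N z).im ^ 2) - 1) - m * Real.log ‖bF β q N z‖ := by
  unfold GF
  have e1 : -(m : ℂ) * (q ^ 2 * L z) = ((-(m * q ^ 2) : ℝ) : ℂ) * L z := by push_cast; ring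
  have e2 : (V : ℂ) / (2 * β) = ((V / (2 * β) : ℝ) : ℂ) := by push_cast; ring
  rw [e1, e2, Complex.sub_re, Complex.add_re, Complex.re_ofReal_mul, Complex.re_ofReal_mul, Complex.re_ofReal_mul,
    Complex.log_re, Complex.sub_re, one_div, Complex.inv_re, Complex.normSq_apply]
  simp only [Complex.one_re]
  ring

set_option maxHeartbeats 800000 in
lemma middle (β V m R M U U0 ε h y : ℝ) (q C1 : ℝ) (N L : ℂ → ℂ) (hβ : 0 < β) (hV : 0 < V) (hm : 0 < m)
    (hM : 0 < M) (nice : Nice R M N L) (hh : 0 < h) (hq : 0 < q) (hq1 : q ≤ 1)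
    (hε : 0 < ε) (hbε : (ε : ℂ) = bF β q N U) (hU0 : 0 < U0) (hU : U0 ≤ U) (hz : U + |y| < R)
    (hC1 : C1 = 4 * β * M * (1 + 2 * R)) (hy : h ^ 3 ≤ |y|)
    (c1 : C1 * q ≤ β * U0) (c2 : (C1 * q) ^ 2 ≤ 2 * β * ε) (c3 : 2 * ε * (C1 * q) ≤ (β * U0) ^ 2 * h ^ 3) :
    bF β q N (U + Complex.I * y) ≠ 0 ∧
    (GF β V m q N L (U + Complex.I * y)).re - (GF β V m q N L U).re ≤
      -(V / (16 * β * ε) * ((β * U0) ^ 2 * y ^ 2 / (ε ^ 2 + (β * U0) ^ 2 * y ^ 2))) + m * Real.log 2 + 2 * m * M := by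
  set z : ℂ := U + Complex.I * y with hzd
  have hUp : 0 < U := by linarith
  have hy0 : 0 < |y| := lt_of_lt_of_le (by positivity) hy
  have hUb : (U : ℂ) ∈ Metric.ball (0:ℂ) R := by simp [abs_of_pos hUp]; linarith
  have hzU : ‖z - U‖ = |y| := by simp [hzd]
  have hzb : z ∈ Metric.ball (0:ℂ) R := by
    rw [mem_ball_zero_iff]
    have := norm_add_le (U : ℂ) (z - U)
    rw [hzU, Complex.norm_real, Real.norm_eq_abs, add_sub_cancel, abs_of_pos hUp] at this
    linarith
  have hsub : Metric.ball (0:ℂ) R ⊆ Metric.ball (0:ℂ) (R + 2) := Metric.ball_subset_ball (by linarith)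
  have hdN : ‖N z - N U‖ ≤ 2 * M * |y| + 4 * M * |y| ^ 2 := by
    have t := taylor_two nice.dN nice.bN
    have t1 := t.1 U hUb
    have t2 := t.2 z hzb U hUb
    have e : N z - N U = (N z - N U - deriv N U * (z - U)) + deriv N U * (z - U) := by ring
    rw [e]
    refine (norm_add_le _ _).trans ?_
    rw [norm_mul, hzU]
    rw [hzU] at t2
    have : ‖deriv N U‖ * |y| ≤ 2 * M * |y| := by gcongr
    linarith
  set b := bF β q N z with hb
  set δ := C1 * q * |y| with hδ
  have hRy : |y| ≤ R := by linarith
  have hrem : ‖2 * β * q * (N z - N U)‖ ≤ δ := by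
    have e : ‖(2 * β * q * (N z - N U) : ℂ)‖ = 2 * β * q * ‖N z - N U‖ := by
      have : (2 * β * q * (N z - N U) : ℂ) = ((2 * β * q : ℝ) : ℂ) * (N z - N U) := by push_cast; ring
      rw [this, norm_mul, Complex.norm_real, Real.norm_eq_abs, abs_of_pos (by positivity)]
    rw [e]
    have : 2 * M * |y| + 4 * M * |y| ^ 2 ≤ 2 * M * |y| * (1 + 2 * R) := by
      have : 4 * M * |y| * |y| ≤ 4 * M * |y| * R := by gcongr
      nlinarith
    calc _ ≤ 2 * β * q * (2 * M * |y| * (1 + 2 * R)) := by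
          gcongr; linarith
      _ = δ := by rw [hδ, hC1]; ring
  have hbe : b = (ε + β * y ^ 2 : ℝ) + Complex.I * (-(2 * β * U * y) : ℝ) - 2 * β * q * (N z - N U) := by
    rw [hb, hzd, bF_taylor β q y U N 0, ← hbε, ← hzd]
    push_cast; ring
  set w : ℂ := 2 * β * q * (N z - N U) with hw
  have hre : b.re = ε + β * y ^ 2 - w.re := by
    rw [hbe, Complex.sub_re, Complex.add_re, Complex.mul_re, Complex.ofReal_re, Complex.I_re, Complex.I_im, Complex.ofReal_re, Complex.ofReal_im]; ring
  have him : b.im = -(2 * β * U * y) - w.im := by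
    rw [hbe, Complex.sub_im, Complex.add_im, Complex.mul_im, Complex.ofReal_im, Complex.I_re, Complex.I_im, Complex.ofReal_re, Complex.ofReal_im]; ring
  have hwre := (Complex.abs_re_le_norm w).trans hrem
  have hwim := (Complex.abs_im_le_norm w).trans hrem
  have hy2 : |y| ^ 2 = y ^ 2 := sq_abs y
  have hXlow : ε + β * y ^ 2 - δ ≤ b.re := by rw [hre]; linarith [(abs_le.1 hwre).2]
  have hδ2 : δ ≤ β * y ^ 2 + ε / 2 := by
    rw [hδ, ← hy2]
    have : 0 ≤ (2 * β * |y| - C1 * q) ^ 2 := sq_nonneg _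
    have h3 : 4 * β * (C1 * q * |y|) ≤ 4 * β * (β * |y| ^ 2 + ε / 2) := by nlinarith
    exact le_of_mul_le_mul_left h3 (by positivity)
  have hX : ε / 2 ≤ b.re := by linarith
  have hYlow : β * U0 * |y| ≤ |b.im| := by
    have h1 : |2 * β * U * y| ≤ |b.im| + |w.im| := by
      have : 2 * β * U * y = -(b.im + w.im) := by rw [him]; ring
      rw [this, abs_neg]; exact abs_add_le _ _
    rw [abs_mul, abs_of_pos (show 0 < 2 * β * U by positivity)] at h1
    have h2 : δ ≤ β * U0 * |y| := by rw [hδ]; gcongr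
    have h3 : 2 * β * U0 * |y| ≤ 2 * β * U * |y| := by gcongr
    linarith
  have hY2 : (β * U0) ^ 2 * y ^ 2 ≤ b.im ^ 2 := by
    rw [← sq_abs b.im, ← hy2, ← mul_pow]; gcongr
  have hXX : -(b.im ^ 2 / 2) ≤ b.re ^ 2 - ε * b.re := by
    by_cases hle : ε ≤ b.re
    · nlinarith [sq_nonneg b.im]
    · push Not at hle
      have g1 : ε - b.re ≤ δ := by nlinarith [sq_nonneg y]
      have g2 : b.re * (ε - b.re) ≤ ε * δ := by
        apply mul_le_mul hle.le g1 (by linarith) hε.le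
      have g3 : ε * δ ≤ (β * U0) ^ 2 * y ^ 2 / 2 := by
        rw [hδ, ← hy2]
        have : 2 * ε * (C1 * q) * |y| ≤ (β * U0) ^ 2 * h ^ 3 * |y| := by gcongr
        have : (β * U0) ^ 2 * h ^ 3 * |y| ≤ (β * U0) ^ 2 * |y| * |y| := by gcongr
        nlinarith
      nlinarith
  have hgap := inv_gap ε b.re b.im ((β * U0) ^ 2 * y ^ 2) hε hX hXX (by positivity) hY2
  have hbre : 0 < b.re := by linarith
  refine ⟨fun h0 => by rw [h0] at hbre; simp at hbre, ?_⟩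
  rw [GF_re, GF_re, ← hb, ← hbε]
  have hnb : ε / 2 ≤ ‖b‖ := hX.trans (Complex.re_le_norm b)
  have hlog : Real.log ε - Real.log 2 ≤ Real.log ‖b‖ := by
    rw [← Real.log_div hε.ne' (by norm_num)]
    exact Real.log_le_log (by positivity) hnb
  have hL1 : |(L z).re| ≤ M := (Complex.abs_re_le_norm _).trans (nice.bL z (hsub hzb))
  have hL2 : |(L U).re| ≤ M := (Complex.abs_re_le_norm _).trans (nice.bL U (hsub hUb))
  have hq2 : q ^ 2 ≤ 1 := pow_le_one₀ hq.le hq1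
  have hL3 : q ^ 2 * ((L U).re - (L z).re) ≤ 1 * (2 * M) := by
    have a1 := (abs_le.1 hL1).1
    have a2 := (abs_le.1 hL2).2
    have : q ^ 2 * ((L U).re - (L z).re) ≤ q ^ 2 * (2 * M) := by gcongr; linarith
    have : q ^ 2 * (2 * M) ≤ 1 * (2 * M) := by gcongr
    linarith
  simp only [Complex.ofReal_re, Complex.ofReal_im, Complex.norm_real, Real.norm_eq_abs, abs_of_pos hε]
  have e4 : ε / (ε ^ 2 + 0 ^ 2) = 1 / ε := by field_simp; ring
  rw [e4]
  have h5 := mul_le_mul_of_nonneg_left hgap (show 0 ≤ V / (2 * β) by positivity)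
  have e5 : V / (16 * β * ε) * ((β * U0) ^ 2 * y ^ 2 / (ε ^ 2 + (β * U0) ^ 2 * y ^ 2)) =
    V / (2 * β) * (1 / (8 * ε) * ((β * U0) ^ 2 * y ^ 2 / (ε ^ 2 + (β * U0) ^ 2 * y ^ 2))) := by
    field_simp; ring
  rw [e5]
  have h6 := mul_le_mul_of_nonneg_left hlog hm.le
  have h7 := mul_le_mul_of_nonneg_left hL3 hm.le
  nlinarith

lemma far (κ θ ξ v ρ t q : ℝ) (hκ : 0 < κ) (hθ : 0 < θ) (hξ : 0 < ξ) (hv : 0 < v)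
    (hρ : ρ ∈ Set.Ioo (-1 : ℝ) 1) (ht : 0 < t) (hq : 0 < q) (z : ℂ) (hz : z.im ≠ 0)
    (hfar : z.re ^ 2 - q * z.re ≤ (1 - ρ ^ 2) * z.im ^ 2) :
    (hestG κ θ ξ v ρ t (z / q) (q ^ 2)).re ≤ 0 := by
  obtain ⟨f1, f2, f3⟩ := far_region κ ρ ξ q hκ hξ hρ hq z hz hfar
  have hβ := betaT_pos κ ξ t hκ hξ ht
  have hq' : (q : ℂ) ≠ 0 := by exact_mod_cast hq.ne'
  have hd : hestD κ ρ ξ (z / q) ≠ 0 := by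
    apply hestD_ne κ ρ ξ hκ hξ hρ
    rw [Complex.div_ofReal_im]
    exact div_ne_zero hz hq.ne'
  have h0 : z ≠ 0 := by rintro rfl; simp at hz
  have h1 : z ≠ q := by rintro rfl; simp at hz
  have hA := repr_A_re κ θ ρ ξ q hξ hq z hd h0 h1 f1
  set β := betaT κ ξ t with hβd
  set b : ℂ := 1 - 2 * (β : ℂ) * hBt κ ρ ξ q z with hb
  have hbre : 1 ≤ b.re := by
    have : b = 1 - ((2 * β : ℝ) : ℂ) * hBt κ ρ ξ q z := by rw [hb]; push_cast; ring
    rw [this, Complex.sub_re, Complex.re_ofReal_mul]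
    simp only [Complex.one_re]
    nlinarith
  have hbn : 1 ≤ ‖b‖ := hbre.trans (Complex.re_le_norm b)
  have hb0 : b ≠ 0 := by intro h; rw [h] at hbn; simp at hbn; linarith
  have hβc : (β : ℂ) ≠ 0 := by exact_mod_cast hβ.ne'
  set V := v * Real.exp (-(κ * t)) with hV
  have hVp : 0 < V := by rw [hV]; positivity
  have e : hestG κ θ ξ v ρ t (z / q) (q ^ 2) = hestA κ θ ρ ξ (z / q) (q ^ 2) +
      ((V / (2 * β) : ℝ) : ℂ) * (1 / b - 1) - ((2 * κ * θ / ξ ^ 2 : ℝ) : ℂ) * Complex.log b := by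
    unfold hestG
    rw [repr_B κ ρ ξ q hξ hq z hd h0 h1, ← hb]
    congr 2
    have : hBt κ ρ ξ q z = (1 - b) / (2 * β) := by rw [hb]; field_simp; ring
    rw [this, hV]; push_cast; field_simp
  rw [e, Complex.sub_re, Complex.add_re, Complex.re_ofReal_mul, Complex.re_ofReal_mul, hA, Complex.log_re,
    Complex.sub_re, one_div, Complex.inv_re]
  have g1 : b.re / Complex.normSq b ≤ 1 := by
    rw [div_le_one (Complex.normSq_pos.2 hb0), Complex.normSq_apply]
    nlinarith [mul_self_nonneg b.im]
  have g2 := Real.log_nonneg hbn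
  have g3 : 0 ≤ 2 * κ * θ / ξ ^ 2 := by positivity
  have g4 : 0 ≤ κ * θ / ξ ^ 2 := by positivity
  have g5 : 0 ≤ V / (2 * β) := by positivity
  simp only [Complex.one_re]
  have a1 := mul_nonneg g3 g2
  have a2 := mul_nonpos_of_nonneg_of_nonpos g5 (sub_nonpos.2 g1)
  have a3 := mul_nonpos_of_nonneg_of_nonpos g4 f2
  linarith

lemma mom_int (Z : ℝ) (hZ : 0 < Z) (n : ℕ) : Integrable (fun u : ℝ => u ^ n * Real.exp (-Z * u ^ 2)) := by
  have h := integrable_rpow_mul_exp_neg_mul_sq hZ (s := n) (by have : (0:ℝ) ≤ n := n.cast_nonneg; linarith)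
  simpa using h

lemma mom_rec (Z : ℝ) (hZ : 0 < Z) (n : ℕ) :
    ∫ u : ℝ, u ^ (n + 2) * Real.exp (-Z * u ^ 2) = (n + 1) / (2 * Z) * ∫ u : ℝ, u ^ n * Real.exp (-Z * u ^ 2) := by
  have hd : ∀ u : ℝ, HasDerivAt (fun u : ℝ => u ^ (n + 1) * Real.exp (-Z * u ^ 2))
      ((n + 1) * (u ^ n * Real.exp (-Z * u ^ 2)) - 2 * Z * (u ^ (n + 2) * Real.exp (-Z * u ^ 2))) u := by
    intro u
    have h1 := hasDerivAt_pow (n + 1) u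
    have h2 : HasDerivAt (fun u : ℝ => -Z * u ^ 2) (-Z * (2 * u)) u := by
      simpa using (hasDerivAt_pow 2 u).const_mul (-Z)
    refine (h1.mul h2.exp).congr_deriv ?_
    simp only [Nat.add_sub_cancel]
    push_cast
    ring
  have := integral_eq_zero_of_hasDerivAt_of_integrable hd
    (((mom_int Z hZ n).const_mul _).sub ((mom_int Z hZ (n + 2)).const_mul _)) (mom_int Z hZ (n + 1))
  rw [integral_sub ((mom_int Z hZ n).const_mul _) ((mom_int Z hZ (n + 2)).const_mul _),
    integral_const_mul, integral_const_mul] at this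
  rw [div_mul_eq_mul_div, eq_div_iff (by positivity)]
  linarith

lemma mom_one (Z : ℝ) (hZ : 0 < Z) : ∫ u : ℝ, u ^ 1 * Real.exp (-Z * u ^ 2) = 0 := by
  have hd : ∀ u : ℝ, HasDerivAt (fun u : ℝ => u ^ 0 * Real.exp (-Z * u ^ 2))
      (-(2 * Z) * (u ^ 1 * Real.exp (-Z * u ^ 2))) u := by
    intro u
    have h2 : HasDerivAt (fun u : ℝ => -Z * u ^ 2) (-Z * (2 * u)) u := by
      simpa using (hasDerivAt_pow 2 u).const_mul (-Z)
    have h3 := h2.exp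
    simp only [pow_zero, one_mul]
    convert h3 using 1
    ring
  have := integral_eq_zero_of_hasDerivAt_of_integrable hd
    ((mom_int Z hZ 1).const_mul _) (mom_int Z hZ 0)
  rw [integral_const_mul] at this
  rcases mul_eq_zero.1 this with h | h
  · linarith
  · exact h

lemma exp_two (X : ℂ) (A : ℝ) (hA : ‖X‖ ≤ A) : ‖Complex.exp X - 1 - X‖ ≤ ‖X‖ ^ 2 * Real.exp A := by
  have h := Complex.norm_exp_sub_sum_le_norm_mul_exp X 2
  simp only [Finset.sum_range_succ, Finset.sum_range_zero, Nat.factorial] at h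
  have e : Complex.exp X - 1 - X = Complex.exp X - (0 + X ^ 0 / ((1 : ℕ) : ℂ) + X ^ 1 / (((0 + 1) * 1 : ℕ) : ℂ)) := by
    push_cast; simp; ring
  rw [e]
  refine h.trans ?_
  gcongr

lemma cexp_rem3 (X : ℂ) (A : ℝ) (hA : ‖X‖ ≤ A) : ‖Complex.exp X - 1 - X - X ^ 2 / 2‖ ≤ ‖X‖ ^ 3 * Real.exp A := by
  have h := Complex.norm_exp_sub_sum_le_norm_mul_exp X 3
  simp only [Finset.sum_range_succ, Finset.sum_range_zero, Nat.factorial] at h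
  have e : Complex.exp X - 1 - X - X ^ 2 / 2 = Complex.exp X - (0 + X ^ 0 / ((1 : ℕ) : ℂ) + X ^ 1 / (((0 + 1) * 1 : ℕ) : ℂ)
     + X ^ 2 / (((1 + 1) * ((0 + 1) * 1) : ℕ) : ℂ)) := by
    push_cast; simp; ring
  rw [e]
  refine h.trans ?_
  gcongr

/-- bounds for the exponent in the inner region -/
lemma inner_X (C h u : ℝ) (Z : ℝ) (Q1 α γ δ E : ℂ) (hh : 0 < h) (hh1 : h ≤ 1) (hC : 0 ≤ C)
    (b1 : ‖Q1‖ ≤ C) (b2 : ‖α‖ ≤ C) (b3 : ‖γ‖ ≤ C) (b4 : ‖δ‖ ≤ C)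
    (hE : ‖E - (-(Z * u ^ 2) + h * Q1 * u ^ 3 + h ^ 2 * (α * u ^ 2 + γ * u ^ 3 + δ * u ^ 4))‖ ≤ C * (h ^ 3 * (1 + |u|) ^ 5)) :
    ‖(E + Z * u ^ 2) - h * Q1 * u ^ 3‖ ≤ 4 * C * h ^ 2 * (1 + |u|) ^ 5 ∧ ‖E + Z * u ^ 2‖ ≤ 5 * C * (h * (1 + |u|) ^ 5) := by
  set w := 1 + |u| with hw
  have hw1 : 1 ≤ w := by rw [hw]; linarith [abs_nonneg u]
  have huw : |u| ≤ w := by rw [hw]; linarith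
  have hp : ∀ n ≤ 5, |u| ^ n ≤ w ^ 5 := fun n hn => (pow_le_pow_left₀ (abs_nonneg u) huw n).trans
    (pow_le_pow_right₀ hw1 hn)
  have g1 : ‖(h : ℂ) ^ 2 * (α * u ^ 2 + γ * u ^ 3 + δ * u ^ 4)‖ ≤ h ^ 2 * (C * w ^ 5 + C * w ^ 5 + C * w ^ 5) := by
    rw [norm_mul, norm_pow, Complex.norm_real, Real.norm_eq_abs, abs_of_pos hh]
    gcongr
    refine (norm_add₃_le).trans ?_
    simp only [norm_mul, norm_pow, Complex.norm_real, Real.norm_eq_abs]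
    have := hp 2 (by norm_num)
    have := hp 3 (by norm_num)
    have := hp 4 (by norm_num)
    gcongr
  have g2 : h ^ 3 ≤ h ^ 2 := pow_le_pow_of_le_one hh.le hh1 (by norm_num)
  have g3 : C * (h ^ 3 * w ^ 5) ≤ C * (h ^ 2 * w ^ 5) := by gcongr
  have m1 : ‖(E + Z * u ^ 2) - h * Q1 * u ^ 3‖ ≤ 4 * C * h ^ 2 * w ^ 5 := by
    have e : (E + Z * u ^ 2) - h * Q1 * u ^ 3 = (E - (-(Z * u ^ 2) + h * Q1 * u ^ 3 + h ^ 2 * (α * u ^ 2 + γ * u ^ 3 + δ * u ^ 4)))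
      + h ^ 2 * (α * u ^ 2 + γ * u ^ 3 + δ * u ^ 4) := by ring
    rw [e]
    refine (norm_add_le _ _).trans ?_
    linarith
  refine ⟨m1, ?_⟩
  have e : E + Z * u ^ 2 = ((E + Z * u ^ 2) - h * Q1 * u ^ 3) + h * Q1 * u ^ 3 := by ring
  rw [e]
  refine (norm_add_le _ _).trans ?_
  have g4 : ‖(h : ℂ) * Q1 * u ^ 3‖ ≤ h * C * w ^ 5 := by
    simp only [norm_mul, norm_pow, Complex.norm_real, Real.norm_eq_abs, abs_of_pos hh]
    have := hp 3 (by norm_num)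
    gcongr
  have g5 : h ^ 2 ≤ h := by nlinarith
  have g6 : 4 * C * h ^ 2 * w ^ 5 ≤ 4 * C * h * w ^ 5 := by gcongr
  linarith

lemma cexp_split (Z u : ℝ) (E : ℂ) :
    Complex.exp E = Complex.exp (E + Z * u ^ 2) * ((Real.exp (-Z * u ^ 2) : ℝ) : ℂ) := by
  rw [Complex.ofReal_exp, ← Complex.exp_add]
  congr 1
  push_cast
  ring

set_option maxHeartbeats 800000 in
lemma F_bound (C h u Z β : ℝ) (Q1 α γ δ E D : ℂ) (hh : 0 < h) (hh1 : h ≤ 1) (hC : 0 ≤ C)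
    (b1 : ‖Q1‖ ≤ C) (b2 : ‖α‖ ≤ C) (b3 : ‖γ‖ ≤ C) (b4 : ‖δ‖ ≤ C)
    (hE : h * (1 + |u|) ^ 6 ≤ 1 →
      ‖E - (-(Z * u ^ 2) + h * Q1 * u ^ 3 + h ^ 2 * (α * u ^ 2 + γ * u ^ 3 + δ * u ^ 4))‖ ≤ C * (h ^ 3 * (1 + |u|) ^ 5))
    (hO : 1 < h * (1 + |u|) ^ 6 → ‖Complex.exp E * D‖ ≤ C * h ^ 2 * (1 + u ^ 2)⁻¹)
    (hD : ‖D - β‖ ≤ C * h ^ 2 * (1 + |u|) ^ 2) :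
    ‖Complex.exp E * D - β * ((Real.exp (-Z * u ^ 2) : ℝ) : ℂ) * (1 + h * Q1 * u ^ 3)‖ ≤
      h ^ 2 * ((Real.exp (5 * C) * C + 25 * |β| * C ^ 2 * Real.exp (5 * C) + 4 * |β| * C + |β| * (1 + C) + C) *
        ((1 + |u|) ^ 15 * Real.exp (-Z * u ^ 2) + (1 + u ^ 2)⁻¹)) := by
  set w := 1 + |u| with hw
  set g := Real.exp (-Z * u ^ 2) with hg
  have hg0 : 0 < g := Real.exp_pos _
  have hw1 : 1 ≤ w := by rw [hw]; linarith [abs_nonneg u]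
  have hw0 : 0 < w := by linarith
  have huw : |u| ≤ w := by rw [hw]; linarith
  have hb0 := abs_nonneg β
  have hi0 : 0 < (1 + u ^ 2)⁻¹ := by positivity
  have hp : ∀ n ≤ 15, w ^ n ≤ w ^ 15 := fun n hn => pow_le_pow_right₀ hw1 hn
  set e := Real.exp (5 * C) with he
  have he0 : 0 < e := Real.exp_pos _
  by_cases hin : h * w ^ 6 ≤ 1
  · obtain ⟨x1, x2⟩ := inner_X C h u Z Q1 α γ δ E hh hh1 hC b1 b2 b3 b4 (hE hin)
    set X := E + Z * u ^ 2 with hX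
    have x3 : ‖X‖ ≤ 5 * C := by
      refine x2.trans ?_
      have : h * w ^ 5 ≤ 1 := by
        refine le_trans ?_ hin
        gcongr
        norm_num
      calc 5 * C * (h * w ^ 5) ≤ 5 * C * 1 := by gcongr
        _ = 5 * C := by ring
    have x4 : ‖X‖ ^ 2 ≤ 25 * C ^ 2 * h ^ 2 * w ^ 10 := by
      calc ‖X‖ ^ 2 ≤ (5 * C * (h * w ^ 5)) ^ 2 := by gcongr
        _ = _ := by ring
    have x5 := exp_two X (5 * C) x3
    have x6 : ‖Complex.exp X‖ ≤ e := by
      refine (Complex.norm_exp_le_exp_norm X).trans (Real.exp_le_exp.2 x3)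
    have id : Complex.exp E * D - β * (g : ℂ) * (1 + h * Q1 * u ^ 3) =
        g * (Complex.exp X * (D - β) + β * (Complex.exp X - 1 - X) + β * (X - h * Q1 * u ^ 3)) := by
      rw [cexp_split Z u E, ← hX, ← hg]; ring
    rw [id, norm_mul, Complex.norm_real, Real.norm_eq_abs, abs_of_pos hg0]
    have y1 : ‖Complex.exp X * (D - β)‖ ≤ e * (C * h ^ 2 * w ^ 15) := by
      rw [norm_mul]
      have := hp 2 (by norm_num)
      gcongr
      exact hD.trans (by gcongr)
    have y2 : ‖β * (Complex.exp X - 1 - X)‖ ≤ |β| * (25 * C ^ 2 * h ^ 2 * w ^ 15 * e) := by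
      rw [norm_mul, Complex.norm_real, Real.norm_eq_abs]
      gcongr
      refine x5.trans ?_
      gcongr
      refine x4.trans ?_
      have := hp 10 (by norm_num)
      gcongr
    have y3 : ‖β * (X - h * Q1 * u ^ 3)‖ ≤ |β| * (4 * C * h ^ 2 * w ^ 15) := by
      rw [norm_mul, Complex.norm_real, Real.norm_eq_abs]
      gcongr
      refine x1.trans ?_
      have := hp 5 (by norm_num)
      gcongr
    have y4 := (norm_add₃_le (a := Complex.exp X * (D - β)) (b := β * (Complex.exp X - 1 - X))
      (c := β * (X - h * Q1 * u ^ 3))).trans (add_le_add_three y1 y2 y3)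
    calc g * _ ≤ g * _ := mul_le_mul_of_nonneg_left y4 hg0.le
      _ = h ^ 2 * ((e * C + 25 * |β| * C ^ 2 * e + 4 * |β| * C + 0 + 0) * (w ^ 15 * g + 0)) := by ring
      _ ≤ _ := by
        gcongr
        · positivity
  · push Not at hin
    have z1 := hO hin
    have z2 : ‖(β : ℂ) * (g : ℂ) * (1 + h * Q1 * u ^ 3)‖ ≤ |β| * g * ((1 + C) * w ^ 3) := by
      rw [norm_mul, norm_mul, Complex.norm_real, Real.norm_eq_abs, Complex.norm_real, Real.norm_eq_abs, abs_of_pos hg0]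
      gcongr
      refine (norm_add_le _ _).trans ?_
      simp only [norm_mul, norm_pow, Complex.norm_real, Real.norm_eq_abs, abs_of_pos hh, norm_one]
      have t1 : h * ‖Q1‖ * |u| ^ 3 ≤ 1 * C * w ^ 3 := by gcongr
      have t2 : 1 ≤ w ^ 3 := one_le_pow₀ hw1
      linarith
    have z3 : w ^ 3 ≤ h ^ 2 * w ^ 15 := by
      have : 1 ≤ (h * w ^ 6) ^ 2 := one_le_pow₀ hin.le
      calc w ^ 3 = 1 * w ^ 3 := by ring
        _ ≤ (h * w ^ 6) ^ 2 * w ^ 3 := by gcongr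
        _ = _ := by ring
    have z4 : |β| * g * ((1 + C) * w ^ 3) ≤ |β| * g * ((1 + C) * (h ^ 2 * w ^ 15)) := by gcongr
    refine (norm_sub_le _ _).trans ?_
    set A := w ^ 15 * g with hA
    set B := (1 + u ^ 2)⁻¹ with hB
    have hA0 : 0 < A := by positivity
    calc _ ≤ C * h ^ 2 * B + |β| * g * ((1 + C) * (h ^ 2 * w ^ 15)) := add_le_add z1 (z2.trans z4)
      _ = h ^ 2 * (C * B + (|β| * (1 + C)) * A) := by rw [hA]; ring
      _ ≤ _ := by
        gcongr
        have : 0 ≤ (e * C + 25 * |β| * C ^ 2 * e + 4 * |β| * C) * (A + B) := by positivity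
        have : 0 ≤ |β| * (1 + C) * B := by positivity
        have : 0 ≤ C * A := by positivity
        nlinarith

lemma F_lim (C u Z β e0 : ℝ) (Q1 Q2 Q4 : ℂ) (E D α γ δ : ℝ → ℂ)
    (hα : Tendsto α (𝓝[>] 0) (𝓝 Q2)) (hγ : Tendsto γ (𝓝[>] 0) (𝓝 0)) (hδ : Tendsto δ (𝓝[>] 0) (𝓝 Q4))
    (hE : ∀ᶠ h : ℝ in 𝓝[>] 0, ‖E h - (-(Z * u ^ 2) + h * Q1 * u ^ 3 + h ^ 2 * (α h * u ^ 2 + γ h * u ^ 3 + δ h * u ^ 4))‖ ≤ C * (h ^ 3 * (1 + |u|) ^ 5))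
    (hD : Tendsto (fun h : ℝ => (D h - β) / (h : ℂ) ^ 2) (𝓝[>] 0) (𝓝 (β * e0))) :
    Tendsto (fun h : ℝ => (Complex.exp (E h) * D h - β * ((Real.exp (-Z * u ^ 2) : ℝ) : ℂ) * (1 + h * Q1 * u ^ 3)) / (h : ℂ) ^ 2)
      (𝓝[>] 0) (𝓝 (β * ((Real.exp (-Z * u ^ 2) : ℝ) : ℂ) * (e0 + Q2 * u ^ 2 + Q4 * u ^ 4 + Q1 ^ 2 / 2 * u ^ 6))) := by
  have hpos : ∀ᶠ h : ℝ in 𝓝[>] 0, 0 < h := self_mem_nhdsWithin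
  have hid : Tendsto (fun h : ℝ => (h : ℂ)) (𝓝[>] 0) (𝓝 0) := by
    have : Tendsto (fun h : ℝ => (h : ℂ)) (𝓝 0) (𝓝 ((0 : ℝ) : ℂ)) := Complex.continuous_ofReal.tendsto 0
    simpa using this.mono_left nhdsWithin_le_nhds
  set rem : ℝ → ℂ := fun h => E h - (-(Z * u ^ 2) + h * Q1 * u ^ 3 + h ^ 2 * (α h * u ^ 2 + γ h * u ^ 3 + δ h * u ^ 4)) with hrem
  have hr : Tendsto (fun h : ℝ => rem h / (h : ℂ) ^ 2) (𝓝[>] 0) (𝓝 0) := by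
    refine squeeze_zero_norm' (a := fun h : ℝ => C * (1 + |u|) ^ 5 * ‖(h : ℂ)‖) ?_ (by simpa using (hid.norm.const_mul (C * (1 + |u|) ^ 5)))
    filter_upwards [hE, hpos] with h h1 h2
    rw [norm_div, norm_pow, Complex.norm_real, Real.norm_eq_abs, abs_of_pos h2, div_le_iff₀ (by positivity)]
    refine h1.trans (le_of_eq (by ring))
  set T : ℝ → ℂ := fun h => (E h + Z * u ^ 2 - h * Q1 * u ^ 3) / (h : ℂ) ^ 2 with hT
  have hTl : Tendsto T (𝓝[>] 0) (𝓝 (Q2 * u ^ 2 + Q4 * u ^ 4)) := by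
    have : Tendsto (fun h => (α h * u ^ 2 + γ h * u ^ 3 + δ h * u ^ 4) + rem h / (h : ℂ) ^ 2) (𝓝[>] 0)
        (𝓝 ((Q2 * u ^ 2 + 0 * u ^ 3 + Q4 * u ^ 4) + 0)) :=
      (((hα.mul_const _).add (hγ.mul_const _)).add (hδ.mul_const _)).add hr
    have e : (Q2 * u ^ 2 + 0 * u ^ 3 + Q4 * u ^ 4) + 0 = Q2 * (u : ℂ) ^ 2 + Q4 * u ^ 4 := by ring
    rw [e] at this
    refine this.congr' ?_
    filter_upwards [hpos] with h h2
    have : (h : ℂ) ≠ 0 := by exact_mod_cast h2.ne'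
    simp only [hT, hrem]
    field_simp
    ring
  set Y : ℝ → ℂ := fun h => h * T h + Q1 * u ^ 3 with hY
  have hYl : Tendsto Y (𝓝[>] 0) (𝓝 (Q1 * u ^ 3)) := by
    have := (hid.mul hTl).add_const (Q1 * (u : ℂ) ^ 3)
    simpa using this
  have hXY : ∀ᶠ h : ℝ in 𝓝[>] 0, E h + Z * u ^ 2 = h * Y h := by
    filter_upwards [hpos] with h h2
    have : (h : ℂ) ≠ 0 := by exact_mod_cast h2.ne'
    simp only [hY, hT]
    field_simp
    ring
  have hX0 : Tendsto (fun h : ℝ => (h : ℂ) * Y h) (𝓝[>] 0) (𝓝 0) := by simpa using hid.mul hYl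
  have hexp : Tendsto (fun h : ℝ => Complex.exp ((h : ℂ) * Y h)) (𝓝[>] 0) (𝓝 1) := by
    have := (Complex.continuous_exp.tendsto 0).comp hX0
    rw [Complex.exp_zero] at this
    exact this
  have h3 : Tendsto (fun h : ℝ => (Complex.exp (h * Y h) - 1 - h * Y h - (h * Y h) ^ 2 / 2) / (h : ℂ) ^ 2) (𝓝[>] 0) (𝓝 0) := by
    refine squeeze_zero_norm' (a := fun h : ℝ => ‖Y h‖ ^ 2 * ‖(h : ℂ) * Y h‖ * Real.exp 1) ?_ ?_
    · have hsm : ∀ᶠ h : ℝ in 𝓝[>] 0, ‖(h : ℂ) * Y h‖ < 1 := by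
        have := hX0.norm
        rw [norm_zero] at this
        exact this.eventually (gt_mem_nhds one_pos)
      filter_upwards [hsm, hpos] with h h1 h2
      have := cexp_rem3 _ _ h1.le
      rw [norm_div, norm_pow, Complex.norm_real, Real.norm_eq_abs, abs_of_pos h2, div_le_iff₀ (by positivity)]
      refine this.trans (le_of_eq ?_)
      rw [norm_mul, Complex.norm_real, Real.norm_eq_abs, abs_of_pos h2]
      ring
    · have := ((hYl.norm.pow 2).mul hX0.norm).mul_const (Real.exp 1)
      simpa using this
  have main := ((hexp.mul hD).add ((h3.add ((hYl.pow 2).div_const 2)).add hTl |>.const_mul (β : ℂ))).const_mul ((Real.exp (-Z * u ^ 2) : ℝ) : ℂ)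
  have e : ((Real.exp (-Z * u ^ 2) : ℝ) : ℂ) * (1 * (β * e0) + β * (0 + (Q1 * u ^ 3) ^ 2 / 2 + (Q2 * u ^ 2 + Q4 * u ^ 4))) =
    β * ((Real.exp (-Z * u ^ 2) : ℝ) : ℂ) * (e0 + Q2 * u ^ 2 + Q4 * u ^ 4 + Q1 ^ 2 / 2 * u ^ 6) := by ring
  rw [e] at main
  refine main.congr' ?_
  filter_upwards [hXY, hpos] with h h1 h2
  have hne : (h : ℂ) ≠ 0 := by exact_mod_cast h2.ne'
  rw [cexp_split Z u (E h), h1]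
  have h4 : T h = (h * Y h - h * Q1 * u ^ 3) / (h : ℂ) ^ 2 := by rw [← h1]
  rw [h4]
  generalize Complex.exp (h * Y h) = x
  generalize ((Real.exp (-Z * u ^ 2) : ℝ) : ℂ) = g
  field_simp
  ring

lemma w_int (Z : ℝ) (hZ : 0 < Z) : Integrable (fun u : ℝ => (1 + |u|) ^ 15 * Real.exp (-Z * u ^ 2)) := by
  have h1 : Integrable (fun u : ℝ => 2 ^ 15 * (u ^ 0 * Real.exp (-Z * u ^ 2) + u ^ 16 * Real.exp (-Z * u ^ 2))) :=
    ((mom_int Z hZ 0).add (mom_int Z hZ 16)).const_mul _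
  refine h1.mono' (by fun_prop) (ae_of_all _ fun u => ?_)
  rw [Real.norm_eq_abs, abs_of_nonneg (by positivity), ← add_mul, ← mul_assoc]
  gcongr
  have hw : 1 ≤ 1 + |u| := by linarith [abs_nonneg u]
  have h2 : (1 + |u|) ^ 15 ≤ (1 + |u|) ^ 16 := pow_le_pow_right₀ hw (by norm_num)
  have h3 := add_pow_le (zero_le_one) (abs_nonneg u) 16
  have h4 : |u| ^ 16 = u ^ 16 := by rw [← abs_pow, abs_of_nonneg (by positivity)]
  rw [h4] at h3
  norm_num at h3 ⊢
  linarith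

lemma mom_cint (Z : ℝ) (hZ : 0 < Z) (n : ℕ) : Integrable (fun u : ℝ => ((Real.exp (-Z * u ^ 2) : ℝ) : ℂ) * (u : ℂ) ^ n) := by
  have := (mom_int Z hZ n).ofReal (𝕜 := ℂ)
  refine this.congr (ae_of_all _ fun u => ?_)
  simp only [Complex.coe_algebraMap, RCLike.ofReal_mul, Complex.ofReal_mul, Complex.ofReal_pow]
  push_cast; ring

lemma mom_ceq (Z : ℝ) (n : ℕ) : ∫ u : ℝ, ((Real.exp (-Z * u ^ 2) : ℝ) : ℂ) * (u : ℂ) ^ n =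
    ((∫ u : ℝ, u ^ n * Real.exp (-Z * u ^ 2) : ℝ) : ℂ) := by
  rw [← integral_complex_ofReal]
  congr 1
  funext u
  push_cast; ring

theorem laplace (E D : ℝ → ℝ → ℂ) (α γ δ : ℝ → ℂ) (Z β e0 C : ℝ) (Q1 Q2 Q4 : ℂ) (hZ : 0 < Z) (hC : 0 ≤ C)
    (hα : Tendsto α (𝓝[>] 0) (𝓝 Q2)) (hγ : Tendsto γ (𝓝[>] 0) (𝓝 0)) (hδ : Tendsto δ (𝓝[>] 0) (𝓝 Q4))
    (hI : ∀ᶠ h : ℝ in 𝓝[>] 0, ∀ u : ℝ, h * (1 + |u|) ^ 6 ≤ 1 →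
      ‖E h u - (-(Z * u ^ 2) + h * Q1 * u ^ 3 + h ^ 2 * (α h * u ^ 2 + γ h * u ^ 3 + δ h * u ^ 4))‖ ≤ C * (h ^ 3 * (1 + |u|) ^ 5))
    (hO : ∀ᶠ h : ℝ in 𝓝[>] 0, ∀ u : ℝ, 1 < h * (1 + |u|) ^ 6 →
      ‖Complex.exp (E h u) * D h u‖ ≤ C * h ^ 2 * (1 + u ^ 2)⁻¹)
    (hD : ∀ᶠ h : ℝ in 𝓝[>] 0, ∀ u : ℝ, ‖D h u - β‖ ≤ C * h ^ 2 * (1 + |u|) ^ 2)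
    (hDl : ∀ u : ℝ, Tendsto (fun h : ℝ => (D h u - β) / (h : ℂ) ^ 2) (𝓝[>] 0) (𝓝 (β * e0)))
    (hmeas : ∀ᶠ h : ℝ in 𝓝[>] 0, AEStronglyMeasurable (fun u => Complex.exp (E h u) * D h u) volume) :
    Tendsto (fun h : ℝ => ((∫ u : ℝ, Complex.exp (E h u) * D h u) - β * (Real.sqrt (Real.pi / Z) : ℝ)) / (h : ℂ) ^ 2) (𝓝[>] 0)
      (𝓝 (β * (Real.sqrt (Real.pi / Z) : ℝ) * (e0 + Q2 / (2 * Z) + 3 * Q4 / (2 * Z) ^ 2 + 15 * (Q1 ^ 2 / 2) / (2 * Z) ^ 3))) := by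
  have hpos : ∀ᶠ h : ℝ in 𝓝[>] 0, 0 < h := self_mem_nhdsWithin
  have hle1 : ∀ᶠ h : ℝ in 𝓝[>] 0, h ≤ 1 := by
    filter_upwards [Ioo_mem_nhdsGT (zero_lt_one (α := ℝ))] with h hh using hh.2.le
  have bdd : ∀ {f : ℝ → ℂ} {l : ℂ}, Tendsto f (𝓝[>] 0) (𝓝 l) → ∀ᶠ h : ℝ in 𝓝[>] 0, ‖f h‖ ≤ ‖l‖ + 1 := by
    intro f l hf
    filter_upwards [hf.norm.eventually (gt_mem_nhds (show ‖l‖ < ‖l‖ + 1 by linarith))] with h hh using hh.le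
  set C' := C + ‖Q1‖ + (‖Q2‖ + 1) + (‖(0:ℂ)‖ + 1) + (‖Q4‖ + 1) with hC'
  have n1 := norm_nonneg Q1
  have n2 := norm_nonneg Q2
  have n4 := norm_nonneg Q4
  have n0 : ‖(0:ℂ)‖ = 0 := norm_zero
  have hC'0 : 0 ≤ C' := by rw [hC']; positivity
  have hCC : C ≤ C' := by rw [hC', n0]; linarith
  set C2 := Real.exp (5 * C') * C' + 25 * |β| * C' ^ 2 * Real.exp (5 * C') + 4 * |β| * C' + |β| * (1 + C') + C' with hC2
  set G : ℝ → ℝ := fun u => C2 * ((1 + |u|) ^ 15 * Real.exp (-Z * u ^ 2) + (1 + u ^ 2)⁻¹) with hG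
  have hGi : Integrable G := ((w_int Z hZ).add integrable_inv_one_add_sq).const_mul _
  set J : ℝ → ℝ → ℂ := fun h u => β * ((Real.exp (-Z * u ^ 2) : ℝ) : ℂ) * (1 + h * Q1 * u ^ 3) with hJ
  set F : ℝ → ℝ → ℂ := fun h u => (Complex.exp (E h u) * D h u - J h u) / (h : ℂ) ^ 2 with hF
  have hJe : ∀ h u : ℝ, J h u = β * (((Real.exp (-Z * u ^ 2) : ℝ) : ℂ) * (u : ℂ) ^ 0) +
      β * h * Q1 * (((Real.exp (-Z * u ^ 2) : ℝ) : ℂ) * (u : ℂ) ^ 3) := by intro h u; simp only [hJ]; ring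
  have hJi : ∀ h : ℝ, Integrable (J h) := by
    intro h
    have := ((mom_cint Z hZ 0).const_mul (β : ℂ)).add ((mom_cint Z hZ 3).const_mul (β * h * Q1 : ℂ))
    exact this.congr (ae_of_all _ fun u => (hJe h u).symm)
  have m0 : ∫ u : ℝ, u ^ 0 * Real.exp (-Z * u ^ 2) = Real.sqrt (Real.pi / Z) := by
    rw [← integral_gaussian]; simp
  have m3 := mom_rec Z hZ 1
  rw [mom_one Z hZ, mul_zero] at m3
  have m2 := mom_rec Z hZ 0
  have m4 := mom_rec Z hZ 2
  have m6 := mom_rec Z hZ 4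
  norm_num at m3 m2 m4 m6
  norm_num at m0
  rw [m0] at m2
  rw [m2] at m4
  rw [m4] at m6
  have hJint : ∀ h : ℝ, ∫ u, J h u = β * (Real.sqrt (Real.pi / Z) : ℝ) := by
    intro h
    rw [show J h = fun u : ℝ => β * (((Real.exp (-Z * u ^ 2) : ℝ) : ℂ) * (u : ℂ) ^ 0) +
      β * h * Q1 * (((Real.exp (-Z * u ^ 2) : ℝ) : ℂ) * (u : ℂ) ^ 3) from funext (hJe h)]
    rw [integral_add ((mom_cint Z hZ 0).const_mul _) ((mom_cint Z hZ 3).const_mul _), integral_const_mul, integral_const_mul,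
      mom_ceq, mom_ceq]
    norm_num
    rw [m3, m0]
    norm_num
  have hbd : ∀ᶠ h : ℝ in 𝓝[>] 0, ∀ u : ℝ, ‖Complex.exp (E h u) * D h u - J h u‖ ≤ h ^ 2 * G u := by
    filter_upwards [hpos, hle1, bdd hα, bdd hγ, bdd hδ, hI, hO, hD] with h p0 p1 p2 p3 p4 p5 p6 p7 u
    refine F_bound C' h u Z β Q1 (α h) (γ h) (δ h) (E h u) (D h u) p0 p1 hC'0 (by rw [hC', n0]; linarith)
      (by rw [hC', n0]; linarith) (by rw [hC', n0]; rw [n0] at p3; linarith) (by rw [hC', n0]; linarith)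
      (fun hh => (p5 u hh).trans (by gcongr)) (fun hh => (p6 u hh).trans (by gcongr)) ((p7 u).trans (by gcongr))
  have hFlim : Tendsto (fun h => ∫ u, F h u) (𝓝[>] 0) (𝓝 (∫ u : ℝ, β * ((Real.exp (-Z * u ^ 2) : ℝ) : ℂ) *
      (e0 + Q2 * u ^ 2 + Q4 * u ^ 4 + Q1 ^ 2 / 2 * u ^ 6))) := by
    refine tendsto_integral_filter_of_dominated_convergence G ?_ ?_ hGi ?_
    · filter_upwards [hmeas] with h hm
      simp only [hF, div_eq_mul_inv]
      exact (hm.sub (hJi h).aestronglyMeasurable).mul_const _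
    · filter_upwards [hbd, hpos] with h hb hp
      refine ae_of_all _ fun u => ?_
      simp only [hF]
      rw [norm_div, norm_pow, Complex.norm_real, Real.norm_eq_abs, abs_of_pos hp, div_le_iff₀ (by positivity), mul_comm (G u)]
      exact hb u
    · refine ae_of_all _ fun u => ?_
      refine F_lim C u Z β e0 Q1 Q2 Q4 (fun h => E h u) (fun h => D h u) α γ δ hα hγ hδ ?_ (hDl u)
      have hw0 : 0 < (1 + |u|) ^ 6 := by positivity
      have : ∀ᶠ h : ℝ in 𝓝[>] 0, h * (1 + |u|) ^ 6 ≤ 1 := by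
        filter_upwards [Ioo_mem_nhdsGT (show (0:ℝ) < 1 / (1 + |u|) ^ 6 by positivity)] with h hh
        have := hh.2.le
        rwa [le_div_iff₀ hw0] at this
      filter_upwards [this, hI] with h h1 h2 using h2 u h1
  have hlimval : (∫ u : ℝ, β * ((Real.exp (-Z * u ^ 2) : ℝ) : ℂ) *
      (e0 + Q2 * u ^ 2 + Q4 * u ^ 4 + Q1 ^ 2 / 2 * u ^ 6)) =
      β * (Real.sqrt (Real.pi / Z) : ℝ) * (e0 + Q2 / (2 * Z) + 3 * Q4 / (2 * Z) ^ 2 + 15 * (Q1 ^ 2 / 2) / (2 * Z) ^ 3) := by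
    have e : ∀ u : ℝ, β * ((Real.exp (-Z * u ^ 2) : ℝ) : ℂ) * (e0 + Q2 * u ^ 2 + Q4 * u ^ 4 + Q1 ^ 2 / 2 * u ^ 6) =
        ((β * e0) * (((Real.exp (-Z * u ^ 2) : ℝ) : ℂ) * (u : ℂ) ^ 0) + (β * Q2) * (((Real.exp (-Z * u ^ 2) : ℝ) : ℂ) * (u : ℂ) ^ 2)) +
        ((β * Q4) * (((Real.exp (-Z * u ^ 2) : ℝ) : ℂ) * (u : ℂ) ^ 4) + (β * (Q1 ^ 2 / 2)) * (((Real.exp (-Z * u ^ 2) : ℝ) : ℂ) * (u : ℂ) ^ 6)) := by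
      intro u; ring
    simp_rw [e]
    have i0 := (mom_cint Z hZ 0).const_mul (β * e0 : ℂ)
    have i2 := (mom_cint Z hZ 2).const_mul (β * Q2 : ℂ)
    have i4 := (mom_cint Z hZ 4).const_mul (β * Q4 : ℂ)
    have i6 := (mom_cint Z hZ 6).const_mul (β * (Q1 ^ 2 / 2) : ℂ)
    have i02 := i0.add i2
    have i46 := i4.add i6
    simp only [Pi.add_def] at i02 i46
    rw [integral_add i02 i46, integral_add i0 i2, integral_add i4 i6, integral_const_mul, integral_const_mul,
      integral_const_mul, integral_const_mul, mom_ceq, mom_ceq, mom_ceq, mom_ceq]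
    norm_num
    rw [m0, m2, m4, m6]
    have hZc : (Z : ℂ) ≠ 0 := by exact_mod_cast hZ.ne'
    push_cast
    field_simp
    ring
  rw [← hlimval]
  refine hFlim.congr' ?_
  filter_upwards [hbd, hmeas, hpos] with h hb hm hp
  have hint : Integrable (fun u => Complex.exp (E h u) * D h u - J h u) :=
    (hGi.const_mul (h ^ 2)).mono' (hm.sub (hJi h).aestronglyMeasurable) (ae_of_all _ hb)
  have hint2 : Integrable (fun u => Complex.exp (E h u) * D h u) := by
    refine (hint.add (hJi h)).congr (ae_of_all _ fun u => ?_)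
    simp
  simp only [hF]
  rw [integral_div, integral_sub hint2 (hJi h), hJint]

/-- per-h facts at the saddle point -/
structure HS (κ θ ξ v ρ t k R M β V m h q U ε : ℝ) (N L : ℂ → ℂ) : Prop where
  h0 : 0 < h
  h1 : h ≤ 1
  nice : Nice R M N L
  small : ∀ z ∈ Metric.ball (0:ℂ) (R + 2),
      ‖hX κ ρ ξ q z‖ ≤ 1 ∧ ‖hDen κ ρ ξ q z - 1‖ ≤ 1 / 4 ∧ ‖Complex.log (hDen κ ρ ξ q z)‖ ≤ 1
  Ub : |U| < 1 / Real.sqrt β + 1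
  ε0 : 0 < ε
  bε : (ε : ℂ) = bF β q N U
  keq : (k : ℂ) = q * (-((m : ℝ) : ℂ) * (q ^ 2 * deriv L U)
          - (V : ℂ) / (2 * β) * (-2 * β * (U + q * deriv N U) / ε ^ 2)
          - (m : ℂ) * (-2 * β * (U + q * deriv N U) / ε))
  gU : hestG κ θ ξ v ρ t ((U : ℂ) / q) (q ^ 2) = GF β V m q N L U

lemma tendsto_pow_pos (n : ℕ) (hn : n ≠ 0) : Tendsto (fun h : ℝ => h ^ n) (𝓝[>] 0) (𝓝[>] 0) := by
  apply tendsto_nhdsWithin_of_tendsto_nhds_of_eventually_within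
  · have : Tendsto (fun h : ℝ => h ^ n) (𝓝 0) (𝓝 (0 ^ n)) := (continuous_pow n).tendsto 0
    rw [zero_pow hn] at this
    exact this.mono_left nhdsWithin_le_nhds
  · filter_upwards [self_mem_nhdsWithin] with h hh
    have h1 : (0:ℝ) < h := hh
    exact pow_pos h1 n

set_option maxHeartbeats 1600000 in
lemma basic (κ θ ξ v ρ t : ℝ) (hκ : 0 < κ) (hθ : 0 < θ) (hξ : 0 < ξ)
    (hv : 0 < v) (hρ : ρ ∈ Set.Ioo (-1 : ℝ) 1) (ht : 0 < t) (k : ℝ) (hk : 0 < k) (R β V m a0 : ℝ)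
    (hβd : β = betaT κ ξ t) (hVd : V = v * Real.exp (-(κ * t))) (hmd : m = 2 * κ * θ / ξ ^ 2)
    (ha0 : a0 = 1 / Real.sqrt β)
    (hR : 1 / Real.sqrt β + 1 < R) (U : ℝ → ℝ)
    (hU : ∀ᶠ h in 𝓝[>] (0:ℝ), U h ∈ hestDom κ θ ξ v ρ t (h ^ 8) ∧
      deriv (hestLambda κ θ ξ v ρ t (h ^ 8)) (U h) = (k : ℂ)) :
    ∃ M > 0, ∃ ε : ℝ → ℝ, ∃ r0 r1 : ℝ,
     (∀ᶠ h in 𝓝[>] (0:ℝ), HS κ θ ξ v ρ t k R M β V m h (h ^ 4) (U h) (ε h) (hN κ ρ ξ (h ^ 4)) (hL κ ρ ξ (h ^ 4))) ∧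
     0 < r0 ∧ V * a0 * r0 ^ 2 = k ∧
      2 * V * r0 * r1 = -k * (-a0 / (2 * r0)) / a0 ^ 2 - 2 * β * m * r0 ∧
      Tendsto U (𝓝[>] 0) (𝓝 a0) ∧ Tendsto (fun h => h ^ 2 / ε h) (𝓝[>] 0) (𝓝 r0) ∧
      Tendsto (fun h => (U h - a0) / h ^ 2) (𝓝[>] 0) (𝓝 (-a0 / (2 * r0))) ∧
      Tendsto (fun h => (h ^ 2 / ε h - r0) / h ^ 2) (𝓝[>] 0) (𝓝 r1) := by
  have hβ : 0 < β := hβd ▸ betaT_pos κ ξ t hκ hξ ht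
  have hV : 0 < V := by rw [hVd]; positivity
  have hm : 0 < m := by rw [hmd]; positivity
  have ha : 0 < a0 := by rw [ha0]; positivity
  have hβa : β * a0 ^ 2 = 1 := by
    rw [ha0, div_pow, Real.sq_sqrt hβ.le]; field_simp
  have hpos : ∀ᶠ h : ℝ in 𝓝[>] 0, 0 < h := self_mem_nhdsWithin
  have hle1 : ∀ᶠ h : ℝ in 𝓝[>] 0, h ≤ 1 := by
    filter_upwards [Ioo_mem_nhdsGT (zero_lt_one (α := ℝ))] with h hh using hh.2.le
  obtain ⟨q0, hq0, M, hM, hnice⟩ := nice_heston κ ρ ξ R (by linarith)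
  have hs := saddle κ θ ξ v ρ t hκ hθ hξ hv hρ ht k hk.ne' R (hβd ▸ hR)
  have hs' := (tendsto_pow_pos 4 (by norm_num)).eventually hs
  have hn' := (tendsto_pow_pos 4 (by norm_num)).eventually (Ioo_mem_nhdsGT hq0)
  set ε : ℝ → ℝ := fun h => (bF β (h ^ 4) (hN κ ρ ξ (h ^ 4)) (U h)).re with hεd
  have HH : ∀ᶠ h in 𝓝[>] (0:ℝ), HS κ θ ξ v ρ t k R M β V m h (h ^ 4) (U h) (ε h) (hN κ ρ ξ (h ^ 4)) (hL κ ρ ξ (h ^ 4)) := by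
    filter_upwards [hpos, hle1, hs', hn', hU] with h p0 p1 p2 p3 p4
    have e8 : (h ^ 4) ^ 2 = h ^ 8 := by ring
    have p5 := p2 (U h) (by rw [e8]; exact p4.1) (by rw [e8]; exact p4.2)
    obtain ⟨n1, n2⟩ := hnice (h ^ 4) p3.1 p3.2
    rw [← hβd, ← hVd, ← hmd] at p5
    obtain ⟨u1, ε', u2, u3, u4, u5⟩ := p5
    have : ε h = ε' := by simp only [hεd]; rw [← u3]; simp
    rw [this]
    exact ⟨p0, p1, n1, n2, u1, u2, u3, u4, u5⟩
  have hsq : Tendsto (fun s : ℝ => Real.sqrt s) (𝓝[>] 0) (𝓝[>] 0) := by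
    apply tendsto_nhdsWithin_of_tendsto_nhds_of_eventually_within
    · have := (Real.continuous_sqrt.tendsto 0).mono_left (nhdsWithin_le_nhds (s := Set.Ioi (0:ℝ)))
      rwa [Real.sqrt_zero] at this
    · filter_upwards [self_mem_nhdsWithin] with s hs
      exact Real.sqrt_pos.2 hs
  have HH2 := hsq.eventually HH
  obtain ⟨r0, r1, R1, R2, R3, R4, R5, R6, R7⟩ := asym β V m k (2 * M) a0 hβ hV hm hk ha hβa (fun s => U (Real.sqrt s))
    (fun s => ε (Real.sqrt s)) (fun s => (hN κ ρ ξ (Real.sqrt s ^ 4) (U (Real.sqrt s))).re)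
    (fun s => (deriv (hN κ ρ ξ (Real.sqrt s ^ 4)) (U (Real.sqrt s))).re)
    (fun s => (deriv (hL κ ρ ξ (Real.sqrt s ^ 4)) (U (Real.sqrt s))).re) (by
      filter_upwards [HH2, self_mem_nhdsWithin] with s H hs
      have hs0 : 0 < s := hs
      have e4 : Real.sqrt s ^ 4 = s ^ 2 := by
        rw [show Real.sqrt s ^ 4 = (Real.sqrt s ^ 2) ^ 2 by ring, Real.sq_sqrt hs0.le]
      rw [e4] at H ⊢
      set N := hN κ ρ ξ (s ^ 2)
      set L := hL κ ρ ξ (s ^ 2)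
      set u := U (Real.sqrt s)
      set e := ε (Real.sqrt s)
      have hub := H.Ub
      have hb : (u : ℂ) ∈ Metric.ball (0:ℂ) R := by simp; linarith
      have hb2 : (u : ℂ) ∈ Metric.ball (0:ℂ) (R + 2) := Metric.ball_subset_ball (by linarith) hb
      have n1 := (taylor_two H.nice.dN H.nice.bN).1 u hb
      have n2 := (taylor_two H.nice.dL H.nice.bL).1 u hb
      have n3 := H.nice.bN u hb2
      have hε := H.ε0
      refine ⟨H.ε0, by rw [ha0]; exact hub.le, ((Complex.abs_re_le_norm _).trans n3).trans (by linarith),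
        (Complex.abs_re_le_norm _).trans n1, (Complex.abs_re_le_norm _).trans n2, ?_, ?_⟩
      · have hk' := congrArg Complex.re H.keq
        have e1 : (((s ^ 2 : ℝ) : ℂ) * (-((m : ℝ) : ℂ) * (((s ^ 2 : ℝ) : ℂ) ^ 2 * deriv L u)
          - (V : ℂ) / (2 * β) * (-2 * β * (u + ((s ^ 2 : ℝ) : ℂ) * deriv N u) / e ^ 2)
          - (m : ℂ) * (-2 * β * (u + ((s ^ 2 : ℝ) : ℂ) * deriv N u) / e))) =
          ((-(m * s ^ 6) : ℝ) : ℂ) * deriv L u + ((V * (s / e) ^ 2 + 2 * β * m * s * (s / e) : ℝ) : ℂ) *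
            ((u : ℂ) + ((s ^ 2 : ℝ) : ℂ) * deriv N u) := by
          have hβc : (β : ℂ) ≠ 0 := by exact_mod_cast hβ.ne'
          have hεc : (e : ℂ) ≠ 0 := by exact_mod_cast hε.ne'
          push_cast
          field_simp
          ring
        rw [e1, Complex.add_re, Complex.re_ofReal_mul, Complex.re_ofReal_mul, Complex.add_re, Complex.re_ofReal_mul,
          Complex.ofReal_re, Complex.ofReal_re] at hk'
        linarith
      · have hb' := congrArg Complex.re H.bε
        have e1 : bF β (s ^ 2) N u = ((1 - β * u ^ 2 : ℝ) : ℂ) - ((2 * β * s ^ 2 : ℝ) : ℂ) * N u := by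
          unfold bF; push_cast; ring
        rw [e1, Complex.sub_re, Complex.re_ofReal_mul, Complex.ofReal_re, Complex.ofReal_re] at hb'
        linarith)
  have t2 := tendsto_pow_pos 2 (by norm_num)
  have esq : ∀ᶠ h in 𝓝[>] (0:ℝ), Real.sqrt (h ^ 2) = h := by
    filter_upwards [hpos] with h hh using Real.sqrt_sq hh.le
  refine ⟨M, hM, ε, r0, r1, HH, R1, R2, R3, (R4.comp t2).congr' ?_, (R5.comp t2).congr' ?_, (R6.comp t2).congr' ?_, (R7.comp t2).congr' ?_⟩
  all_goals
    filter_upwards [esq] with h hh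
    simp only [Function.comp_def, hh]

/-- first-order expansion in `h ^ 2` -/
def DQ (f : ℝ → ℂ) (f0 f1 : ℂ) : Prop := Tendsto (fun h : ℝ => (f h - f0) / (h : ℂ) ^ 2) (𝓝[>] 0) (𝓝 f1)

lemma ofReal_tendsto_zero : Tendsto (fun h : ℝ => (h : ℂ)) (𝓝[>] 0) (𝓝 0) := by
  have : Tendsto (fun h : ℝ => (h : ℂ)) (𝓝 0) (𝓝 ((0 : ℝ) : ℂ)) := Complex.continuous_ofReal.tendsto 0
  simpa using this.mono_left nhdsWithin_le_nhds

lemma eventually_ne_c : ∀ᶠ h : ℝ in 𝓝[>] 0, (h : ℂ) ≠ 0 := by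
  filter_upwards [self_mem_nhdsWithin] with h hh
  have : (0:ℝ) < h := hh
  exact_mod_cast this.ne'

lemma DQ.odiv {f : ℝ → ℂ} {f0 f1 : ℂ} (h : DQ f f0 f1) : Tendsto (fun h : ℝ => (f h - f0) / (h : ℂ)) (𝓝[>] 0) (𝓝 0) := by
  have h2 := ofReal_tendsto_zero.mul h
  rw [zero_mul] at h2
  refine h2.congr' ?_
  filter_upwards [eventually_ne_c] with x hx
  field_simp

lemma DQ.lim {f : ℝ → ℂ} {f0 f1 : ℂ} (h : DQ f f0 f1) : Tendsto f (𝓝[>] 0) (𝓝 f0) := by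
  have h2 := (ofReal_tendsto_zero.mul h.odiv).add_const f0
  rw [zero_mul, zero_add] at h2
  refine h2.congr' ?_
  filter_upwards [eventually_ne_c] with x hx
  field_simp
  ring

lemma DQ.mul {f g : ℝ → ℂ} {f0 f1 g0 g1 : ℂ} (hf : DQ f f0 f1) (hg : DQ g g0 g1) :
    DQ (fun h => f h * g h) (f0 * g0) (f1 * g0 + f0 * g1) := by
  have h2 := (Tendsto.mul hf hg.lim).add (Tendsto.const_mul f0 hg)
  unfold DQ
  refine h2.congr' ?_
  filter_upwards [eventually_ne_c] with x hx
  field_simp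
  ring

lemma DQ.const_mul {f : ℝ → ℂ} {f0 f1 : ℂ} (hf : DQ f f0 f1) (c : ℂ) :
    DQ (fun h => c * f h) (c * f0) (c * f1) := by
  have h2 := Tendsto.const_mul c hf
  unfold DQ
  refine h2.congr' ?_
  filter_upwards [eventually_ne_c] with x hx
  field_simp

lemma HS.gz {κ θ ξ v ρ t k R M β V m h q U ε : ℝ} 
    (H : HS κ θ ξ v ρ t k R M β V m h q U ε (hN κ ρ ξ q) (hL κ ρ ξ q))
    (hκ : 0 < κ) (hξ : 0 < ξ) (hρ : ρ ∈ Set.Ioo (-1 : ℝ) 1) (ht : 0 < t)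
    (hβd : β = betaT κ ξ t) (hVd : V = v * Real.exp (-(κ * t))) (hmd : m = 2 * κ * θ / ξ ^ 2)
    (hq : 0 < q) (y : ℝ) (hz : |U| + |y| < R) (hb : bF β q (hN κ ρ ξ q) (U + Complex.I * y) ≠ 0) :
    hestG κ θ ξ v ρ t ((U + Complex.I * y) / q) (q ^ 2) = GF β V m q (hN κ ρ ξ q) (hL κ ρ ξ q) (U + Complex.I * y) := by
  by_cases hy : y = 0
  · have : (U : ℂ) + Complex.I * y = U := by rw [hy]; simp
    rw [this]; exact H.gU
  set z : ℂ := U + Complex.I * y with hzd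
  have him : z.im = y := by simp [hzd]
  have hzim : z.im ≠ 0 := by rw [him]; exact hy
  have hzb : z ∈ Metric.ball (0:ℂ) (R + 2) := by
    rw [mem_ball_zero_iff]
    have := norm_add_le (U : ℂ) (Complex.I * y)
    rw [norm_mul, Complex.norm_I, one_mul, Complex.norm_real, Complex.norm_real, Real.norm_eq_abs, Real.norm_eq_abs] at this
    linarith
  obtain ⟨s1, s2, s3⟩ := H.small z hzb
  have hd : hestD κ ρ ξ (z / q) ≠ 0 := by
    apply hestD_ne κ ρ ξ hκ hξ hρ
    rw [Complex.div_ofReal_im]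
    exact div_ne_zero hzim hq.ne'
  have h0 : z ≠ 0 := by intro h; rw [h] at hzim; simp at hzim
  have h1 : z ≠ q := by intro h; rw [h] at hzim; simp at hzim
  rw [hβd] at hb
  rw [repr_G κ θ ξ v ρ t q hκ hξ ht hq z hd h0 h1 s1 s2 s3 (betaT_pos κ ξ t hκ hξ ht).ne' hb, hβd, hVd, hmd]

/-- the exponent -/
def EE (κ θ ξ v ρ t k : ℝ) (U : ℝ → ℝ) (h u : ℝ) : ℂ :=
  hestG κ θ ξ v ρ t (((U h : ℝ) + Complex.I * (h ^ 3 * u : ℝ)) / (h ^ 4 : ℝ)) ((h ^ 4) ^ 2)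
    - hestG κ θ ξ v ρ t (((U h : ℝ) : ℂ) / (h ^ 4 : ℝ)) ((h ^ 4) ^ 2) - Complex.I * u * k / h

lemma ev_small (c : ℝ) (hc : 0 < c) (n : ℕ) (hn : n ≠ 0) : ∀ᶠ h : ℝ in 𝓝[>] 0, h ^ n < c := by
  filter_upwards [(tendsto_pow_pos n hn).eventually (Ioo_mem_nhdsGT hc)] with h hh using hh.2

lemma region_small (C h w : ℝ) (hC : 1 ≤ C) (hh : 0 < h) (hw : 1 ≤ w) (h5 : h ^ 5 < (1 / (6 * C)) ^ 6) (hr : h * w ^ 6 ≤ 1) :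
    6 * C * (h * w) ≤ 1 := by
  have h1 : (h * w) ^ 6 ≤ (1 / (6 * C)) ^ 6 := by
    calc (h * w) ^ 6 = h ^ 5 * (h * w ^ 6) := by ring
      _ ≤ h ^ 5 * 1 := by gcongr
      _ ≤ _ := by linarith
  have h2 : h * w ≤ 1 / (6 * C) := le_of_pow_le_pow_left₀ (by norm_num) (by positivity) h1
  rw [le_div_iff₀ (by positivity)] at h2
  linarith

set_option maxHeartbeats 1600000 in
lemma inner_region (κ θ ξ v ρ t k R M β V m a0 r0 r1 : ℝ) (U ε : ℝ → ℝ)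
    (hκ : 0 < κ) (hξ : 0 < ξ) (hρ : ρ ∈ Set.Ioo (-1 : ℝ) 1) (ht : 0 < t)
    (hβd : β = betaT κ ξ t) (hVd : V = v * Real.exp (-(κ * t))) (hmd : m = 2 * κ * θ / ξ ^ 2)
    (hβ : 0 < β) (hV : 0 < V) (hm : 0 < m) (hM : 0 < M) (ha : 0 < a0) (hβa : β * a0 ^ 2 = 1)
    (ha0 : a0 = 1 / Real.sqrt β) (hR : a0 + 2 ≤ R)
    (HH : ∀ᶠ h in 𝓝[>] (0:ℝ), HS κ θ ξ v ρ t k R M β V m h (h ^ 4) (U h) (ε h) (hN κ ρ ξ (h ^ 4)) (hL κ ρ ξ (h ^ 4)))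
    (hr0 : 0 < r0)
    (lU : Tendsto U (𝓝[>] 0) (𝓝 a0)) (lr : Tendsto (fun h => h ^ 2 / ε h) (𝓝[>] 0) (𝓝 r0))
    (dU : Tendsto (fun h => (U h - a0) / h ^ 2) (𝓝[>] 0) (𝓝 (-a0 / (2 * r0))))
    (dr : Tendsto (fun h => (h ^ 2 / ε h - r0) / h ^ 2) (𝓝[>] 0) (𝓝 r1)) :
    ∃ C : ℝ, 0 ≤ C ∧ ∃ α γ δ : ℝ → ℂ, 
     Tendsto α (𝓝[>] 0) (𝓝 ((-2 * V * (3 * r0 ^ 2 * r1 - r0 ^ 2) - 2 * m * β * r0 ^ 2 - V * r0 ^ 2 / 2 : ℝ) : ℂ)) ∧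
     Tendsto γ (𝓝[>] 0) (𝓝 0) ∧ Tendsto δ (𝓝[>] 0) (𝓝 ((8 * V * β * r0 ^ 5 : ℝ) : ℂ)) ∧
     ∀ᶠ h : ℝ in 𝓝[>] 0, ∀ u : ℝ, h * (1 + |u|) ^ 6 ≤ 1 →
      ‖EE κ θ ξ v ρ t k U h u - (-((2 * V * r0 ^ 3 : ℝ) * u ^ 2) + h * (Complex.I * ((-4 * V * β * a0 * r0 ^ 4 : ℝ) : ℂ)) * u ^ 3
        + h ^ 2 * (α h * u ^ 2 + γ h * u ^ 3 + δ h * u ^ 4))‖ ≤ C * (h ^ 3 * (1 + |u|) ^ 5) := by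
  set rr : ℝ → ℂ := fun h => ((h ^ 2 / ε h : ℝ) : ℂ) with hrr
  set W : ℝ → ℂ := fun h => U h + (h ^ 4 : ℝ) * deriv (hN κ ρ ξ (h ^ 4)) (U h) with hW
  have dqr : DQ rr r0 r1 := by
    have := (Complex.continuous_ofReal.tendsto r1).comp dr
    refine this.congr' ?_
    filter_upwards with h
    simp [hrr]
  have dqU : DQ (fun h => (U h : ℂ)) a0 ((-a0 / (2 * r0) : ℝ) : ℂ) := by
    have := (Complex.continuous_ofReal.tendsto (-a0 / (2 * r0))).comp dU
    refine this.congr' ?_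
    filter_upwards with h
    simp
  have hN0 : Tendsto (fun h : ℝ => (h : ℂ) ^ 2 * deriv (hN κ ρ ξ (h ^ 4)) (U h)) (𝓝[>] 0) (𝓝 0) := by
    have : Tendsto (fun h : ℝ => ‖(h : ℂ)‖ ^ 2 * (2 * M)) (𝓝[>] 0) (𝓝 0) := by
      simpa using (ofReal_tendsto_zero.norm.pow 2).mul_const (2 * M)
    refine squeeze_zero_norm' ?_ this
    filter_upwards [HH] with h H
    rw [norm_mul, norm_pow]
    have hub := H.Ub
    have := (taylor_two H.nice.dN H.nice.bN).1 (U h) (by simp; linarith)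
    gcongr
  have dqW : DQ W a0 ((-a0 / (2 * r0) : ℝ) : ℂ) := by
    have := dqU.add hN0
    rw [add_zero] at this
    refine this.congr' ?_
    filter_upwards [eventually_ne_c] with h hh
    simp only [hW]; push_cast
    field_simp
    ring
  set K : ℝ → ℂ := fun h => ((V * (h ^ 2 / ε h) / (2 * β) : ℝ) : ℂ) with hK
  set P : ℝ → ℂ := fun h => -2 * Complex.I * β * rr h * W h with hP
  have hβc : (β : ℂ) ≠ 0 := by exact_mod_cast hβ.ne'
  have ha0c : (a0 : ℂ) ≠ 0 := by exact_mod_cast ha.ne'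
  have hr0c : (r0 : ℂ) ≠ 0 := by exact_mod_cast hr0.ne'
  have hβac : (β : ℂ) * a0 ^ 2 = 1 := by exact_mod_cast hβa
  have I2 : Complex.I ^ 2 = -1 := Complex.I_sq
  have dqK : DQ K (V / (2 * β) * r0) (V / (2 * β) * r1) := by
    have := dqr.const_mul ((V : ℂ) / (2 * β))
    refine Tendsto.congr' ?_ this
    filter_upwards with h
    simp only [hK, hrr]; push_cast; ring
  have dqP : DQ P (-2 * Complex.I * β * (r0 * a0)) (-2 * Complex.I * β * (r1 * a0 + r0 * ((-a0 / (2 * r0) : ℝ) : ℂ))) := by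
    have := (dqr.mul dqW).const_mul (-2 * Complex.I * β)
    refine Tendsto.congr' ?_ this
    filter_upwards with h
    simp only [hP]; ring
  have dqP2 := dqP.mul dqP
  have dqKP2 := dqK.mul dqP2
  have dqKP3 := dqKP2.mul dqP
  have dqKP4 := dqKP3.mul dqP
  have lP := dqP.lim
  set Z : ℝ := 2 * V * r0 ^ 3 with hZ
  set Q1 : ℂ := Complex.I * ((-4 * V * β * a0 * r0 ^ 4 : ℝ) : ℂ) with hQ1
  have eZ : (V / (2 * β) * r0 * ((-2 * Complex.I * β * (r0 * a0)) * (-2 * Complex.I * β * (r0 * a0))) : ℂ) = -(Z : ℂ) := by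
    have : (V / (2 * β) * r0 * ((-2 * Complex.I * β * (r0 * a0)) * (-2 * Complex.I * β * (r0 * a0))) : ℂ) =
      2 * V * r0 ^ 3 * (β * a0 ^ 2) * Complex.I ^ 2 := by field_simp
    rw [this, I2, hβac, hZ]; push_cast; ring
  have eQ : (V / (2 * β) * r0 * ((-2 * Complex.I * β * (r0 * a0)) * (-2 * Complex.I * β * (r0 * a0))) * (-2 * Complex.I * β * (r0 * a0)) : ℂ) = -Q1 := by
    rw [eZ, hZ, hQ1]; push_cast; ring
  rw [eQ] at dqKP3
  rw [eZ] at dqKP2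
  set α : ℝ → ℂ := fun h => (K h * (P h * P h) - -(Z : ℂ)) / (h : ℂ) ^ 2 + (m * P h ^ 2 / 2 - K h * ((β * (h ^ 2 / ε h) : ℝ) : ℂ)) with hα
  set γ : ℝ → ℂ := fun h => -((K h * (P h * P h) * P h - -Q1) / (h : ℂ)) with hγ
  set δ : ℝ → ℂ := fun h => K h * (P h * P h) * P h * P h with hδ
  set P0 : ℂ := -2 * Complex.I * β * (r0 * a0) with hP0
  have lKr : Tendsto (fun h => K h * ((β * (h ^ 2 / ε h) : ℝ) : ℂ)) (𝓝[>] 0) (𝓝 (V / (2 * β) * r0 * (β * r0))) := by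
    have := dqK.lim.mul (dqr.lim.const_mul (β : ℂ))
    refine this.congr' ?_
    filter_upwards with h
    simp only [hrr]; push_cast; ring
  set C : ℝ := 1 + m + V * (r0 + 1) / (2 * β) + (‖P0‖ + 1) + β * (r0 + 1) + 8 * β * M * (r0 + 1) + 4 * M with hC
  have q1 : 0 < V * (r0 + 1) / (2 * β) := by positivity
  have q2 : 0 ≤ ‖P0‖ := norm_nonneg _
  have q3 : 0 < β * (r0 + 1) := by positivity
  have q4 : 0 < 8 * β * M * (r0 + 1) := by positivity
  have hC1 : 1 ≤ C := by rw [hC]; linarith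
  refine ⟨3000 * C ^ 6, by positivity, α, γ, δ, ?_, ?_, ?_, ?_⟩
  · have := Tendsto.add dqKP2 (((lP.pow 2).const_mul (m : ℂ)).div_const 2 |>.sub lKr)
    refine (this.congr' ?_).trans (le_of_eq ?_)
    · filter_upwards with h
      simp only [hα]
    · congr 1
      rw [hP0]
      push_cast
      have e1 : (V / (2 * β) * r1 * (-2 * Complex.I * β * (r0 * a0) * (-2 * Complex.I * β * (r0 * a0))) +
        V / (2 * β) * r0 * (-2 * Complex.I * β * (r1 * a0 + r0 * (-a0 / (2 * r0))) * (-2 * Complex.I * β * (r0 * a0)) +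
        -2 * Complex.I * β * (r0 * a0) * (-2 * Complex.I * β * (r1 * a0 + r0 * (-a0 / (2 * r0))))) +
        (m * (-2 * Complex.I * β * (r0 * a0)) ^ 2 / 2 - V / (2 * β) * r0 * (β * r0)) : ℂ) =
        (β * a0 ^ 2) * Complex.I ^ 2 * (2 * V * (3 * r0 ^ 2 * r1 - r0 ^ 2) + 2 * m * β * r0 ^ 2) - V * r0 ^ 2 / 2 := by
        field_simp
        ring
      rw [e1, I2, hβac]
      ring
  · have := dqKP3.odiv.neg
    rw [neg_zero] at this
    exact this
  · have := dqKP4.lim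
    refine this.trans (le_of_eq ?_)
    congr 1
    rw [eQ, hQ1]
    have : -(Complex.I * ((-4 * V * β * a0 * r0 ^ 4 : ℝ) : ℂ)) * P0 = -(8 * V * β * r0 ^ 5 * (β * a0 ^ 2) * Complex.I ^ 2) := by
      rw [hP0]; push_cast; ring
    rw [this, I2, hβac]; push_cast; ring
  · have b1 : ∀ᶠ h : ℝ in 𝓝[>] 0, ‖P h‖ < ‖P0‖ + 1 := lP.norm.eventually (gt_mem_nhds (by linarith))
    have b2 : ∀ᶠ h : ℝ in 𝓝[>] 0, h ^ 2 / ε h < r0 + 1 := lr.eventually (gt_mem_nhds (by linarith))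
    filter_upwards [HH, b1, b2, ev_small ((1 / (6 * C)) ^ 6) (by positivity) 5 (by norm_num)] with h H c1 c2 c3 u hu
    have hh := H.h0
    have hε := H.ε0
    have hw1 : 1 ≤ 1 + |u| := by linarith [abs_nonneg u]
    have hs := region_small C h (1 + |u|) hC1 hh hw1 c3 hu
    have hUb := H.Ub
    rw [← ha0] at hUb
    have hr' : 0 < h ^ 2 / ε h := by positivity
    have hy : h ^ 3 * |u| < 1 := by
      have g0 : h * |u| < 1 := by nlinarith [abs_nonneg u]
      have g1 : h ^ 2 ≤ 1 := pow_le_one₀ hh.le H.h1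
      have g2 : h ^ 2 * (h * |u|) ≤ 1 * (h * |u|) := by
        have := abs_nonneg u
        gcongr
      calc h ^ 3 * |u| = h ^ 2 * (h * |u|) := by ring
        _ < 1 := by linarith
    have key := GF_expand C β V m R M k (U h) (ε h) h u (h ^ 4) (h ^ 2 / ε h) (1 + |u|) (hN κ ρ ξ (h ^ 4)) (hL κ ρ ξ (h ^ 4))
      hβ hV hC1 H.nice hh rfl rfl rfl hε H.bε (by linarith) (by linarith) H.keq hs (by rw [abs_of_pos hm, hC]; linarith)
      (by
        have : V * (h ^ 2 / ε h) / (2 * β) ≤ V * (r0 + 1) / (2 * β) := by gcongr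
        rw [hC]; linarith)
      (by rw [hC]; simp only [hP, hrr, hW] at c1; linarith)
      (by
        have : β * (h ^ 2 / ε h) ≤ β * (r0 + 1) := by gcongr
        rw [hC]; linarith)
      (by
        have : 8 * β * M * (h ^ 2 / ε h) ≤ 8 * β * M * (r0 + 1) := by gcongr
        rw [hC]; linarith)
      (by rw [hC]; linarith)
    obtain ⟨k1, k2⟩ := key
    have hay : |h ^ 3 * u| = h ^ 3 * |u| := by rw [abs_mul, abs_of_pos (show 0 < h ^ 3 by positivity)]
    have gz := H.gz hκ hξ hρ ht hβd hVd hmd (by positivity) (h ^ 3 * u) (by rw [hay]; linarith) k1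
    unfold EE
    rw [gz, H.gU]
    have hhc : (h : ℂ) ≠ 0 := by exact_mod_cast hh.ne'
    refine le_trans (le_of_eq ?_) k2
    congr 1
    have ePW : -2 * Complex.I * β * ((h ^ 2 / ε h : ℝ) : ℂ) * (U h + ((h ^ 4 : ℝ) : ℂ) * deriv (hN κ ρ ξ (h ^ 4)) (U h)) = P h := rfl
    have eKK : ((V * (h ^ 2 / ε h) / (2 * β) : ℝ) : ℂ) = K h := rfl
    rw [ePW, eKK]
    simp only [hα, hγ, hδ]
    field_simp
    ring

lemma exp_decay (c x : ℝ) (hc : 0 < c) (hx : 0 < x) (n : ℕ) :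
    Real.exp (-(c * x)) ≤ (n.factorial : ℝ) / (c * x) ^ n := by
  have h1 := Real.pow_div_factorial_le_exp (c * x) (by positivity) n
  rw [Real.exp_neg, inv_eq_one_div, div_le_div_iff₀ (Real.exp_pos _) (by positivity)]
  rw [div_le_iff₀ (by positivity)] at h1
  linarith

lemma elem_two (c Rr h u : ℝ) (hc : 0 < c) (hh : 0 < h) (h1 : h ≤ 1) (hu : 1 ≤ |u|)
    (hr : 1 < h * (1 + |u|) ^ 6) (hy : h ^ 3 * (1 + |u|) ≤ Rr) :
    Real.exp (-(c * (u ^ 2 / (1 + h ^ 2 * u ^ 2)))) ≤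
      (5040 / c ^ 7 * 5 ^ 7 * (1 + Rr ^ 2)) * (h ^ 2 * (1 + u ^ 2)⁻¹) := by
  have hu2 : u ^ 2 = |u| ^ 2 := (sq_abs u).symm
  rw [hu2]
  set a := |u| with ha
  have ha0 : 0 < a := by linarith
  set w := 1 + a with hw
  have hw0 : 0 < w := by positivity
  have hwa : w ≤ 2 * a := by rw [hw]; linarith
  set x := a ^ 2 / (1 + h ^ 2 * a ^ 2) with hx
  have hx0 : 0 < x := by positivity
  have e1 := exp_decay c x hc hx0 7
  have e2 : ((7 : ℕ).factorial : ℝ) / (c * x) ^ 7 = 5040 / c ^ 7 * (1 / x) ^ 7 := by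
    have : ((7 : ℕ).factorial : ℝ) = 5040 := by norm_num [Nat.factorial]
    rw [this]; field_simp
  rw [e2] at e1
  have e3 : 1 / x ≤ 4 / w ^ 2 + h ^ 2 := by
    have : 1 / x = 1 / a ^ 2 + h ^ 2 := by rw [hx]; field_simp
    rw [this]
    have : 1 / a ^ 2 ≤ 4 / w ^ 2 := by
      rw [div_le_div_iff₀ (by positivity) (by positivity)]
      nlinarith
    linarith
  have e4 : (1 + a ^ 2) ≤ w ^ 2 := by rw [hw]; nlinarith
  have e5 : 1 / w ^ 2 ≤ (1 + a ^ 2)⁻¹ := by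
    rw [inv_eq_one_div]
    exact one_div_le_one_div_of_le (by positivity) e4
  have key : (1 / x) ^ 7 ≤ 5 ^ 7 * (1 + Rr ^ 2) * (h ^ 2 * (1 / w ^ 2)) := by
    have hx1 : 0 ≤ 1 / x := by positivity
    by_cases hc' : h * w ≤ 1
    · have f1 : h ^ 2 ≤ 1 / w ^ 2 := by
        rw [le_div_iff₀ (by positivity)]
        calc h ^ 2 * w ^ 2 = (h * w) ^ 2 := by ring
          _ ≤ 1 := pow_le_one₀ (by positivity) hc'
      have f2 : 1 / x ≤ 5 * (1 / w ^ 2) := by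
        have : 4 / w ^ 2 = 4 * (1 / w ^ 2) := by ring
        linarith
      have f3 : 1 / w ^ 6 ≤ h := by
        rw [div_le_iff₀ (by positivity)]; linarith
      have f4 : (1 / w ^ 6) ^ 2 ≤ h ^ 2 := by gcongr
      calc (1 / x) ^ 7 ≤ (5 * (1 / w ^ 2)) ^ 7 := by gcongr
        _ = 5 ^ 7 * ((1 / w ^ 6) ^ 2 * (1 / w ^ 2)) := by field_simp
        _ ≤ 5 ^ 7 * (h ^ 2 * (1 / w ^ 2)) := by gcongr
        _ ≤ _ := by
          have : (0:ℝ) ≤ 5 ^ 7 * (h ^ 2 * (1 / w ^ 2)) := by positivity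
          nlinarith [sq_nonneg Rr]
    · push Not at hc'
      have f1 : 1 / w ^ 2 ≤ h ^ 2 := by
        rw [div_le_iff₀ (by positivity)]
        calc 1 ≤ (h * w) ^ 2 := one_le_pow₀ hc'.le
          _ = _ := by ring
      have f2 : 1 / x ≤ 5 * h ^ 2 := by
        have : 4 / w ^ 2 = 4 * (1 / w ^ 2) := by ring
        linarith
      have f3 : h ^ 6 ≤ Rr ^ 2 * (1 / w ^ 2) := by
        have : (h ^ 3 * w) ^ 2 ≤ Rr ^ 2 := by gcongr
        have e : Rr ^ 2 * (1 / w ^ 2) = Rr ^ 2 / w ^ 2 := by ring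
        rw [e, le_div_iff₀ (by positivity)]
        calc h ^ 6 * w ^ 2 = (h ^ 3 * w) ^ 2 := by ring
          _ ≤ _ := this
      have f4 : h ^ 6 ≤ 1 := pow_le_one₀ hh.le h1
      calc (1 / x) ^ 7 ≤ (5 * h ^ 2) ^ 7 := by gcongr
        _ = 5 ^ 7 * (h ^ 2 * (h ^ 6 * h ^ 6)) := by ring
        _ ≤ 5 ^ 7 * (h ^ 2 * (1 * (Rr ^ 2 * (1 / w ^ 2)))) := by gcongr
        _ ≤ _ := by
          have : (0:ℝ) ≤ 5 ^ 7 * (h ^ 2 * (1 / w ^ 2)) := by positivity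
          nlinarith [sq_nonneg Rr]
  calc _ ≤ 5040 / c ^ 7 * (1 / x) ^ 7 := e1
    _ ≤ 5040 / c ^ 7 * (5 ^ 7 * (1 + Rr ^ 2) * (h ^ 2 * (1 / w ^ 2))) := by gcongr
    _ ≤ 5040 / c ^ 7 * (5 ^ 7 * (1 + Rr ^ 2) * (h ^ 2 * (1 + a ^ 2)⁻¹)) := by gcongr
    _ = _ := by ring

lemma elem_three (K h u : ℝ) (hK : 0 < K) (hh : 0 < h) (hu : 1 ≤ |u|) :
    Real.exp (-(K * (1 / h ^ 2))) * (1 / (h ^ 3 * u) ^ 2) ≤ (24 / K ^ 4 * 2) * (h ^ 2 * (1 + u ^ 2)⁻¹) := by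
  have e1 := exp_decay K (1 / h ^ 2) hK (by positivity) 4
  have e2 : ((4 : ℕ).factorial : ℝ) / (K * (1 / h ^ 2)) ^ 4 = 24 / K ^ 4 * h ^ 8 := by
    have : ((4 : ℕ).factorial : ℝ) = 24 := by norm_num [Nat.factorial]
    rw [this]; field_simp
  rw [e2] at e1
  have hu2 : 1 ≤ u ^ 2 := by rw [← sq_abs]; exact one_le_pow₀ hu
  have hu0 : u ≠ 0 := by intro h; rw [h] at hu2; norm_num at hu2
  have e3 : 1 / u ^ 2 ≤ 2 * (1 + u ^ 2)⁻¹ := by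
    rw [← div_eq_mul_inv, div_le_div_iff₀ (by positivity) (by positivity)]
    linarith
  calc _ ≤ 24 / K ^ 4 * h ^ 8 * (1 / (h ^ 3 * u) ^ 2) := by gcongr
    _ = 24 / K ^ 4 * h ^ 2 * (1 / u ^ 2) := by field_simp
    _ ≤ 24 / K ^ 4 * h ^ 2 * (2 * (1 + u ^ 2)⁻¹) := by gcongr
    _ = _ := by ring

lemma elem_mid (A b E ε h u : ℝ) (hA : 0 < A) (hb : 0 < b) (hE : 0 < E) (hε : 0 < ε) (hh : 0 < h)
    (hεE : ε ≤ E * h ^ 2) (hu : u ≠ 0):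
    A / E * (b / (E ^ 2 + b)) * (u ^ 2 / (1 + h ^ 2 * u ^ 2)) ≤
      A / ε * (b * (h ^ 3 * u) ^ 2 / (ε ^ 2 + b * (h ^ 3 * u) ^ 2)) := by
  have h2 : ε ^ 2 ≤ (E * h ^ 2) ^ 2 := by gcongr
  calc _ = A / (E * h ^ 2) * (b * (h ^ 3 * u) ^ 2 / ((E ^ 2 + b) * (1 + h ^ 2 * u ^ 2) * h ^ 4)) := by
        field_simp
    _ ≤ A / (E * h ^ 2) * (b * (h ^ 3 * u) ^ 2 / ((E * h ^ 2) ^ 2 + b * (h ^ 3 * u) ^ 2)) := by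
        gcongr
        have e : (E ^ 2 + b) * (1 + h ^ 2 * u ^ 2) * h ^ 4 = (E * h ^ 2) ^ 2 + b * (h ^ 3 * u) ^ 2 + (E ^ 2 * h ^ 2 * u ^ 2 + b) * h ^ 4 := by ring
        rw [e]
        have : 0 ≤ (E ^ 2 * h ^ 2 * u ^ 2 + b) * h ^ 4 := by positivity
        linarith
    _ ≤ _ := by gcongr

/-- the inverse denominator -/
def DD (U : ℝ → ℝ) (h u : ℝ) : ℂ :=
  1 / (((U h : ℝ) + Complex.I * (h ^ 3 * u : ℝ)) * ((U h - h ^ 4 : ℝ) + Complex.I * (h ^ 3 * u : ℝ)))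

lemma re_aux (x y : ℝ) : ((x : ℂ) + Complex.I * (y : ℝ)).re = x := by simp
lemma im_aux (x y : ℝ) : ((x : ℂ) + Complex.I * (y : ℝ)).im = y := by simp

lemma EE_re (κ θ ξ v ρ t k : ℝ) (U : ℝ → ℝ) (h u : ℝ) :
    (EE κ θ ξ v ρ t k U h u).re = 
  (hestG κ θ ξ v ρ t (((U h : ℝ) + Complex.I * (h ^ 3 * u : ℝ)) / (h ^ 4 : ℝ)) ((h ^ 4) ^ 2)).re
    - (hestG κ θ ξ v ρ t (((U h : ℝ) : ℂ) / (h ^ 4 : ℝ)) ((h ^ 4) ^ 2)).re := by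
  unfold EE
  rw [Complex.sub_re, Complex.sub_re]
  have : Complex.I * u * k / h = ((u * k / h : ℝ) : ℂ) * Complex.I := by push_cast; ring
  rw [this, Complex.re_ofReal_mul]
  simp

lemma DD_bound (U : ℝ → ℝ) (h u a : ℝ) (ha : 0 < a) (h1 : a ≤ U h) (h2 : a / 2 ≤ U h - h ^ 4) :
    ‖DD U h u‖ ≤ 2 / a ^ 2 := by
  unfold DD
  have e : ∀ x y : ℝ, |x| ≤ ‖(x : ℂ) + Complex.I * (y : ℝ)‖ := by
    intro x y
    have := Complex.abs_re_le_norm ((x : ℂ) + Complex.I * (y : ℝ))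
    simpa using this
  have e1 := (le_abs_self _).trans (e (U h) (h ^ 3 * u))
  have e2 := (le_abs_self _).trans (e (U h - h ^ 4) (h ^ 3 * u))
  rw [norm_div, norm_mul, norm_one]
  calc _ ≤ 1 / (a * (a / 2)) := by
        gcongr
        · linarith
        · linarith
    _ = _ := by field_simp

lemma DD_bound2 (U : ℝ → ℝ) (h u : ℝ) (hh : 0 < h) (hu : u ≠ 0) :
    ‖DD U h u‖ ≤ 1 / (h ^ 3 * u) ^ 2 := by
  unfold DD
  have e : ∀ x y : ℝ, |y| ≤ ‖(x : ℂ) + Complex.I * (y : ℝ)‖ := by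
    intro x y
    have := Complex.abs_im_le_norm ((x : ℂ) + Complex.I * (y : ℝ))
    simpa using this
  have hy : 0 < |h ^ 3 * u| := by
    rw [abs_pos]; positivity
  rw [norm_div, norm_mul, norm_one, ← sq_abs (h ^ 3 * u), pow_two |h ^ 3 * u|]
  have e1 := e (U h) (h ^ 3 * u)
  have e2 := e (U h - h ^ 4) (h ^ 3 * u)
  gcongr

set_option maxHeartbeats 1600000 in
lemma outer_region (κ θ ξ v ρ t k R R' M β V m a0 r0 : ℝ) (U ε : ℝ → ℝ)
    (hκ : 0 < κ) (hθ : 0 < θ) (hξ : 0 < ξ) (hv : 0 < v) (hρ : ρ ∈ Set.Ioo (-1 : ℝ) 1) (ht : 0 < t)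
    (hβd : β = betaT κ ξ t) (hVd : V = v * Real.exp (-(κ * t))) (hmd : m = 2 * κ * θ / ξ ^ 2)
    (hβ : 0 < β) (hV : 0 < V) (hm : 0 < m) (hM : 0 < M) (ha : 0 < a0) (hβa : β * a0 ^ 2 = 1)
    (hR' : 0 < R') (hRR : (a0 + 2) ^ 2 ≤ (1 - ρ ^ 2) * R' ^ 2) (hR : a0 + 1 + R' ≤ R)
    (HH : ∀ᶠ h in 𝓝[>] (0:ℝ), HS κ θ ξ v ρ t k R M β V m h (h ^ 4) (U h) (ε h) (hN κ ρ ξ (h ^ 4)) (hL κ ρ ξ (h ^ 4)))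
    (hr0 : 0 < r0)
    (lU : Tendsto U (𝓝[>] 0) (𝓝 a0)) (lr : Tendsto (fun h => h ^ 2 / ε h) (𝓝[>] 0) (𝓝 r0)) :
    ∃ C : ℝ, 0 ≤ C ∧ ∀ᶠ h : ℝ in 𝓝[>] 0, ∀ u : ℝ, 1 < h * (1 + |u|) ^ 6 →
      ‖Complex.exp (EE κ θ ξ v ρ t k U h u) * DD U h u‖ ≤ C * h ^ 2 * (1 + u ^ 2)⁻¹ := by
  set U0 : ℝ := a0 / 2 with hU0
  have hU0p : 0 < U0 := by positivity
  set C1 : ℝ := 4 * β * M * (1 + 2 * R) with hC1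
  have hRp : 0 < R := by linarith
  have hC1p : 0 < C1 := by positivity
  set E : ℝ := 2 / r0 with hE
  have hEp : 0 < E := by positivity
  set b : ℝ := (β * U0) ^ 2 with hb
  have hbp : 0 < b := by positivity
  set A : ℝ := V / (16 * β) with hA
  have hAp : 0 < A := by positivity
  set c : ℝ := A / E * (b / (E ^ 2 + b)) with hc
  have hcp : 0 < c := by positivity
  set K : ℝ := V * r0 / (4 * β) with hK
  have hKp : 0 < K := by positivity
  set Cm : ℝ := m * Real.log 2 + 2 * m * M with hCm
  set Cf : ℝ := m * M + V / (2 * β) with hCf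
  set T2 : ℝ := 5040 / c ^ 7 * 5 ^ 7 * (1 + (R' + 1) ^ 2) with hT2
  set T3 : ℝ := 24 / K ^ 4 * 2 with hT3
  have hT2p : 0 < T2 := by positivity
  have hT3p : 0 < T3 := by positivity
  refine ⟨Real.exp Cm * T2 * (2 / U0 ^ 2) + Real.exp Cf * T3, by positivity, ?_⟩
  have b1 : ∀ᶠ h : ℝ in 𝓝[>] 0, U0 < U h := lU.eventually (lt_mem_nhds (by rw [hU0]; linarith))
  have b2 : ∀ᶠ h : ℝ in 𝓝[>] 0, U h < a0 + 1 := lU.eventually (gt_mem_nhds (by linarith))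
  have b3 : ∀ᶠ h : ℝ in 𝓝[>] 0, r0 / 2 < h ^ 2 / ε h := lr.eventually (lt_mem_nhds (by linarith))
  have b4 : ∀ᶠ h : ℝ in 𝓝[>] 0, h ^ 2 / ε h < r0 + 1 := lr.eventually (gt_mem_nhds (by linarith))
  filter_upwards [HH, b1, b2, b3, b4, ev_small (1 / 64) (by norm_num) 1 (by norm_num),
    ev_small (β * U0 / C1) (by positivity) 4 (by norm_num),
    ev_small (2 * β / (r0 + 1) / C1 ^ 2) (by positivity) 6 (by norm_num),
    ev_small (b / (2 * C1)) (by positivity) 1 (by norm_num),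
    ev_small (U0 / 2) (by positivity) 4 (by norm_num), ev_small (1 / E) (by positivity) 2 (by norm_num)]
    with h H c1 c2 c3 c4 s1 s2 s3 s4 s5 s6 u hu
  have hh := H.h0
  have hh1 := H.h1
  have hε := H.ε0
  rw [pow_one] at s1 s4
  have hεE : ε h ≤ E * h ^ 2 := by
    rw [lt_div_iff₀ hε] at c3
    rw [hE, div_mul_eq_mul_div, le_div_iff₀ hr0]
    linarith
  have hε1 : ε h ≤ 1 := by
    rw [lt_div_iff₀ hEp] at s6
    linarith
  have hεl : h ^ 2 ≤ (r0 + 1) * ε h := by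
    rw [div_lt_iff₀ hε] at c4; linarith
  have hu1 : 1 ≤ |u| := by
    by_contra hlt
    push Not at hlt
    have : (1 + |u|) ^ 6 ≤ 2 ^ 6 := by
      have := abs_nonneg u
      gcongr
      linarith
    nlinarith
  have hu0 : u ≠ 0 := by intro h0; rw [h0] at hu1; norm_num at hu1
  have hay : |h ^ 3 * u| = h ^ 3 * |u| := by rw [abs_mul, abs_of_pos (show 0 < h ^ 3 by positivity)]
  have hq1 : h ^ 4 ≤ 1 := pow_le_one₀ hh.le hh1
  have hUp : 0 < U h := by linarith
  have hUb : U h ∈ Set.Ioo 0 (a0 + 1) := ⟨hUp, c2⟩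
  rw [norm_mul, Complex.norm_exp, EE_re]
  by_cases hy : |h ^ 3 * u| < R'
  · -- middle region
    have key := middle β V m R M (U h) U0 (ε h) h (h ^ 3 * u) (h ^ 4) C1 (hN κ ρ ξ (h ^ 4)) (hL κ ρ ξ (h ^ 4))
      hβ hV hm hM H.nice hh (by positivity) hq1 hε H.bε hU0p c1.le (by linarith) hC1
      (by rw [hay]; nlinarith [pow_pos hh 3])
      (by rw [lt_div_iff₀ hC1p] at s2; linarith)
      (by
        rw [lt_div_iff₀ (by positivity), lt_div_iff₀ (by positivity)] at s3
        have e1 : (C1 * h ^ 4) ^ 2 = C1 ^ 2 * h ^ 6 * h ^ 2 := by ring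
        rw [e1]
        calc C1 ^ 2 * h ^ 6 * h ^ 2 ≤ C1 ^ 2 * h ^ 6 * ((r0 + 1) * ε h) := by gcongr
          _ = (h ^ 6 * C1 ^ 2 * (r0 + 1)) * ε h := by ring
          _ ≤ 2 * β * ε h := by gcongr)
      (by
        rw [lt_div_iff₀ (by positivity)] at s4
        calc 2 * ε h * (C1 * h ^ 4) ≤ 2 * 1 * (C1 * h ^ 4) := by gcongr
          _ = (h * (2 * C1)) * h ^ 3 := by ring
          _ ≤ _ := by gcongr)
    obtain ⟨k1, k2⟩ := key
    have gz := H.gz hκ hξ hρ ht hβd hVd hmd (by positivity) (h ^ 3 * u) (by rw [abs_of_pos hUp]; linarith) k1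
    rw [gz, H.gU]
    have e2 := elem_mid A b E (ε h) h u hAp hbp hEp hε hh hεE hu0
    rw [← hc] at e2
    have e3 : V / (16 * β * ε h) = A / ε h := by rw [hA]; field_simp
    rw [e3] at k2
    have e4 := elem_two c (R' + 1) h u hcp hh hh1 hu1 hu (by
      rw [hay] at hy
      have : h ^ 3 ≤ 1 := pow_le_one₀ hh.le hh1
      linarith)
    rw [← hT2] at e4
    have e5 := DD_bound U h u U0 hU0p c1.le (by linarith)
    calc _ ≤ Real.exp (Cm + -(c * (u ^ 2 / (1 + h ^ 2 * u ^ 2)))) * (2 / U0 ^ 2) := by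
          gcongr
          rw [hCm]
          linarith
      _ = Real.exp Cm * Real.exp (-(c * (u ^ 2 / (1 + h ^ 2 * u ^ 2)))) * (2 / U0 ^ 2) := by rw [Real.exp_add]
      _ ≤ Real.exp Cm * (T2 * (h ^ 2 * (1 + u ^ 2)⁻¹)) * (2 / U0 ^ 2) := by gcongr
      _ = (Real.exp Cm * T2 * (2 / U0 ^ 2)) * h ^ 2 * (1 + u ^ 2)⁻¹ := by ring
      _ ≤ _ := by
        gcongr
        have : 0 ≤ Real.exp Cf * T3 := by positivity
        linarith
  · push Not at hy
    have hρ2 : 0 < 1 - ρ ^ 2 := by nlinarith [hρ.1, hρ.2]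
    have hf := far κ θ ξ v ρ t (h ^ 4) hκ hθ hξ hv hρ ht (by positivity) ((U h : ℝ) + Complex.I * (h ^ 3 * u : ℝ))
      (by rw [im_aux]; positivity)
      (by
        rw [re_aux, im_aux]
        have e3 : R' ^ 2 ≤ (h ^ 3 * u) ^ 2 := by rw [← sq_abs (h ^ 3 * u)]; gcongr
        have e4 : (1 - ρ ^ 2) * R' ^ 2 ≤ (1 - ρ ^ 2) * (h ^ 3 * u) ^ 2 := by gcongr
        have e5 : U h ^ 2 ≤ (a0 + 2) ^ 2 := by gcongr; linarith
        have e6 : 0 ≤ h ^ 4 * U h := by positivity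
        linarith)
    have hg : K * (1 / h ^ 2) - Cf ≤ (hestG κ θ ξ v ρ t (((U h : ℝ) : ℂ) / (h ^ 4 : ℝ)) ((h ^ 4) ^ 2)).re := by
      rw [H.gU, GF_re, ← H.bε]
      have l1 : Real.log ‖((ε h : ℝ) : ℂ)‖ ≤ 0 := by
        rw [Complex.norm_real, Real.norm_eq_abs, abs_of_pos hε]
        exact Real.log_nonpos hε.le hε1
      have l2 := H.nice.bL (U h) (by simp [abs_of_pos hUp]; linarith)
      have l3 := (le_abs_self _).trans ((Complex.abs_re_le_norm _).trans l2)
      have l4 : (h ^ 4) ^ 2 ≤ 1 := pow_le_one₀ (by positivity) hq1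
      have l5 : m * ((h ^ 4) ^ 2 * (hL κ ρ ξ (h ^ 4) (U h)).re) ≤ m * M := by
        gcongr
        calc _ ≤ (h ^ 4) ^ 2 * M := by gcongr
          _ ≤ 1 * M := by gcongr
          _ = M := one_mul M
      have l6 : K * (1 / h ^ 2) ≤ V / (2 * β) * (ε h / (ε h ^ 2)) := by
        have : ε h / ε h ^ 2 = 1 / ε h := by field_simp
        rw [this]
        have : 1 / (E * h ^ 2) ≤ 1 / ε h := one_div_le_one_div_of_le hε hεE
        calc K * (1 / h ^ 2) = V / (2 * β) * (1 / (E * h ^ 2)) := by rw [hK, hE]; field_simp; ring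
          _ ≤ _ := by gcongr
      rw [Complex.ofReal_re, Complex.ofReal_im, zero_pow two_ne_zero, add_zero, mul_sub, mul_one]
      have l7 : m * Real.log ‖((ε h : ℝ) : ℂ)‖ ≤ 0 := mul_nonpos_of_nonneg_of_nonpos hm.le l1
      rw [hCf]
      linarith
    have e4 := elem_three K h u hKp hh hu1
    rw [← hT3] at e4
    have e5 := DD_bound2 U h u hh hu0
    calc _ ≤ Real.exp (Cf + -(K * (1 / h ^ 2))) * (1 / (h ^ 3 * u) ^ 2) := by
          gcongr
          linarith
      _ = Real.exp Cf * (Real.exp (-(K * (1 / h ^ 2))) * (1 / (h ^ 3 * u) ^ 2)) := by rw [Real.exp_add]; ring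
      _ ≤ Real.exp Cf * (T3 * (h ^ 2 * (1 + u ^ 2)⁻¹)) := by gcongr
      _ = (Real.exp Cf * T3) * h ^ 2 * (1 + u ^ 2)⁻¹ := by ring
      _ ≤ _ := by
        gcongr
        have : 0 ≤ Real.exp Cm * T2 * (2 / U0 ^ 2) := by positivity
        linarith

lemma DD_sub (β a0 : ℝ) (hβa : β * a0 ^ 2 = 1) (U : ℝ → ℝ) (h u : ℝ) (h1 : 0 < U h) (h2 : 0 < U h - h ^ 4) :
    DD U h u - β = β * (((a0 - U h) * (a0 + U h) + h ^ 4 * U h + (h ^ 3 * u) ^ 2 : ℝ) 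
      - Complex.I * ((h ^ 3 * u * (2 * U h - h ^ 4) : ℝ) : ℂ)) * DD U h u := by
  unfold DD
  have n1 : ((U h : ℝ) : ℂ) + Complex.I * (h ^ 3 * u : ℝ) ≠ 0 := by
    intro h0
    have := congrArg Complex.re h0
    rw [re_aux, Complex.zero_re] at this
    exact h1.ne' this
  have n2 : ((U h - h ^ 4 : ℝ) : ℂ) + Complex.I * (h ^ 3 * u : ℝ) ≠ 0 := by
    intro h0
    have := congrArg Complex.re h0
    rw [re_aux, Complex.zero_re] at this
    exact h2.ne' this
  have hβac : (β : ℂ) * a0 ^ 2 = 1 := by exact_mod_cast hβa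
  have I2 : Complex.I ^ 2 = -1 := Complex.I_sq
  field_simp
  push_cast
  linear_combination (-1 : ℂ) * hβac + (-(β : ℂ) * (h ^ 3 * u) ^ 2) * I2

set_option maxHeartbeats 800000 in
lemma denom (β a0 r0 : ℝ) (U : ℝ → ℝ) (hβ : 0 < β) (ha : 0 < a0) (hβa : β * a0 ^ 2 = 1) (hr0 : 0 < r0)
    (lU : Tendsto U (𝓝[>] 0) (𝓝 a0))
    (dU : Tendsto (fun h => (U h - a0) / h ^ 2) (𝓝[>] 0) (𝓝 (-a0 / (2 * r0)))) :
    (∃ C : ℝ, 0 ≤ C ∧ ∀ᶠ h : ℝ in 𝓝[>] 0, ∀ u : ℝ, ‖DD U h u - β‖ ≤ C * h ^ 2 * (1 + |u|) ^ 2) ∧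
    ∀ u : ℝ, Tendsto (fun h : ℝ => (DD U h u - β) / (h : ℂ) ^ 2) (𝓝[>] 0) (𝓝 (β * ((1 / r0 : ℝ) : ℂ))) := by
  have b1 : ∀ᶠ h : ℝ in 𝓝[>] 0, a0 / 2 < U h := lU.eventually (lt_mem_nhds (by linarith))
  have b2 : ∀ᶠ h : ℝ in 𝓝[>] 0, U h < a0 + 1 := lU.eventually (gt_mem_nhds (by linarith))
  have b3 : ∀ᶠ h : ℝ in 𝓝[>] 0, |(U h - a0) / h ^ 2| < a0 / (2 * r0) + 1 := by
    have := dU.abs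
    rw [neg_div, abs_neg, abs_of_pos (by positivity)] at this
    exact this.eventually (gt_mem_nhds (by linarith))
  have b4 := ev_small (a0 / 4) (by positivity) 4 (by norm_num)
  have b5 := ev_small 1 (by norm_num) 1 (by norm_num)
  have part1 : (∃ C : ℝ, 0 ≤ C ∧ ∀ᶠ h : ℝ in 𝓝[>] 0, ∀ u : ℝ, ‖DD U h u - β‖ ≤ C * h ^ 2 * (1 + |u|) ^ 2) := by
    refine ⟨β * ((a0 / (2 * r0) + 1) * (2 * a0 + 1) + (a0 + 1) + 1 + 2 * (a0 + 1)) * (2 / (a0 / 2) ^ 2), by positivity, ?_⟩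
    filter_upwards [b1, b2, b3, b4, b5, self_mem_nhdsWithin] with h c1 c2 c3 c4 c5 hh u
    have hh : (0:ℝ) < h := hh
    rw [pow_one] at c5
    have hUp : 0 < U h := by linarith
    rw [DD_sub β a0 hβa U h u hUp (by linarith), norm_mul, norm_mul, Complex.norm_real, Real.norm_eq_abs, abs_of_pos hβ]
    have e1 := DD_bound U h u (a0 / 2) (by positivity) c1.le (by linarith)
    set w := 1 + |u| with hw
    have hu0 := abs_nonneg u
    have hw1 : 1 ≤ w := by rw [hw]; linarith
    have e2 : ‖(((a0 - U h) * (a0 + U h) + h ^ 4 * U h + (h ^ 3 * u) ^ 2 : ℝ) 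
      - Complex.I * ((h ^ 3 * u * (2 * U h - h ^ 4) : ℝ) : ℂ))‖ ≤ 
      ((a0 / (2 * r0) + 1) * (2 * a0 + 1) + (a0 + 1) + 1 + 2 * (a0 + 1)) * (h ^ 2 * w ^ 2) := by
      have p1 : |(a0 - U h) * (a0 + U h)| ≤ (a0 / (2 * r0) + 1) * (2 * a0 + 1) * (h ^ 2 * w ^ 2) := by
        rw [abs_div, div_lt_iff₀ (by positivity), abs_of_pos (show 0 < h ^ 2 by positivity)] at c3
        rw [abs_mul, abs_sub_comm, abs_of_pos (show 0 < a0 + U h by linarith)]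
        calc _ ≤ ((a0 / (2 * r0) + 1) * h ^ 2) * (2 * a0 + 1) :=
              mul_le_mul c3.le (by linarith) (by linarith) (by positivity)
          _ = (a0 / (2 * r0) + 1) * (2 * a0 + 1) * (h ^ 2 * 1) := by ring
          _ ≤ _ := by gcongr; exact one_le_pow₀ hw1
      have p2 : |h ^ 4 * U h| ≤ (a0 + 1) * (h ^ 2 * w ^ 2) := by
        rw [abs_of_pos (by positivity)]
        have : h ^ 2 ≤ 1 := pow_le_one₀ hh.le c5.le
        calc h ^ 4 * U h = U h * (h ^ 2 * h ^ 2) := by ring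
          _ ≤ (a0 + 1) * (h ^ 2 * 1) := by gcongr
          _ ≤ _ := by gcongr; exact one_le_pow₀ hw1
      have p3 : |(h ^ 3 * u) ^ 2| ≤ 1 * (h ^ 2 * w ^ 2) := by
        rw [abs_of_nonneg (by positivity)]
        have : h ^ 4 ≤ 1 := pow_le_one₀ hh.le c5.le
        calc (h ^ 3 * u) ^ 2 = h ^ 4 * (h ^ 2 * |u| ^ 2) := by rw [sq_abs]; ring
          _ ≤ _ := by gcongr; rw [hw]; linarith
      have p4 : |h ^ 3 * u * (2 * U h - h ^ 4)| ≤ 2 * (a0 + 1) * (h ^ 2 * w ^ 2) := by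
        rw [abs_mul, abs_mul, abs_of_pos (show 0 < h ^ 3 by positivity), abs_of_pos (show 0 < 2 * U h - h ^ 4 by linarith)]
        have g1 : |u| ≤ w ^ 2 := by nlinarith
        have g2 : 2 * U h - h ^ 4 ≤ 2 * (a0 + 1) := by linarith [pow_pos hh 4]
        have g3 : 0 ≤ 2 * U h - h ^ 4 := by linarith
        calc _ = (2 * U h - h ^ 4) * (h ^ 2 * |u|) * h := by ring
          _ ≤ (2 * (a0 + 1)) * (h ^ 2 * w ^ 2) * 1 := by gcongr
          _ = _ := by ring
      calc _ ≤ |(a0 - U h) * (a0 + U h) + h ^ 4 * U h + (h ^ 3 * u) ^ 2| + |h ^ 3 * u * (2 * U h - h ^ 4)| := by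
            refine (norm_sub_le _ _).trans (le_of_eq ?_)
            rw [norm_mul, Complex.norm_I, one_mul, Complex.norm_real, Complex.norm_real, Real.norm_eq_abs, Real.norm_eq_abs]
        _ ≤ _ := by
            have := abs_add_three ((a0 - U h) * (a0 + U h)) (h ^ 4 * U h) ((h ^ 3 * u) ^ 2)
            linarith
    calc _ ≤ β * (((a0 / (2 * r0) + 1) * (2 * a0 + 1) + (a0 + 1) + 1 + 2 * (a0 + 1)) * (h ^ 2 * w ^ 2)) * (2 / (a0 / 2) ^ 2) := by gcongr
      _ = _ := by ring
  refine ⟨part1, fun u => ?_⟩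
  obtain ⟨C, hC, hCe⟩ := part1
  have h0 : Tendsto (fun h : ℝ => h) (𝓝[>] 0) (𝓝 0) := tendsto_id.mono_left nhdsWithin_le_nhds
  have lD : Tendsto (fun h : ℝ => DD U h u) (𝓝[>] 0) (𝓝 β) := by
    rw [tendsto_iff_norm_sub_tendsto_zero]
    have : Tendsto (fun h : ℝ => C * h ^ 2 * (1 + |u|) ^ 2) (𝓝[>] 0) (𝓝 0) := by
      simpa using (((h0.pow 2).const_mul C).mul_const ((1 + |u|) ^ 2))
    refine squeeze_zero' (Eventually.of_forall fun _ => norm_nonneg _) ?_ this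
    filter_upwards [hCe] with h hh using hh u
  have l1 : Tendsto (fun h : ℝ => -((U h - a0) / h ^ 2) * (a0 + U h) + h ^ 2 * U h + h ^ 4 * u ^ 2) (𝓝[>] 0)
      (𝓝 (-(-a0 / (2 * r0)) * (a0 + a0) + 0 ^ 2 * a0 + 0 ^ 4 * u ^ 2)) :=
    ((dU.neg.mul (lU.const_add a0)).add ((h0.pow 2).mul lU)).add ((h0.pow 4).mul_const _)
  have l2 : Tendsto (fun h : ℝ => h * u * (2 * U h - h ^ 4)) (𝓝[>] 0) (𝓝 (0 * u * (2 * a0 - 0 ^ 4))) :=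
    (h0.mul_const u).mul ((lU.const_mul 2).sub (h0.pow 4))
  have l3 := (((((Complex.continuous_ofReal.tendsto _).comp l1)).sub
    (((Complex.continuous_ofReal.tendsto _).comp l2).const_mul Complex.I)).const_mul (β : ℂ)).mul lD
  refine (l3.congr' ?_).trans (le_of_eq ?_)
  · filter_upwards [b1, b4, eventually_ne_c] with h c1 c4 hh
    rw [DD_sub β a0 hβa U h u (by linarith) (by linarith)]
    simp only [Function.comp]
    push_cast
    field_simp
    ring
  · congr 1
    have e : -(-a0 / (2 * r0)) * (a0 + a0) + 0 ^ 2 * a0 + 0 ^ 4 * u ^ 2 = a0 ^ 2 / r0 := by field_simp; ring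
    rw [e]
    have hβac : (β : ℂ) * a0 ^ 2 = 1 := by exact_mod_cast hβa
    simp only [zero_mul, Complex.ofReal_zero, mul_zero, sub_zero]
    push_cast
    calc (β : ℂ) * (a0 ^ 2 / r0) * β = β * (β * a0 ^ 2) / r0 := by ring
      _ = _ := by rw [hβac]; ring

lemma meas_G (κ θ ξ v ρ t τ : ℝ) : Measurable (fun w => hestG κ θ ξ v ρ t w τ) := by
  unfold hestG hestA hestB hestGamma hestD
  fun_prop

lemma meas_int (κ θ ξ v ρ t k : ℝ) (U : ℝ → ℝ) (h : ℝ) :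
    AEStronglyMeasurable (fun u => Complex.exp (EE κ θ ξ v ρ t k U h u) * DD U h u) volume := by
  apply Measurable.aestronglyMeasurable
  unfold EE DD
  have h1 := meas_G κ θ ξ v ρ t ((h ^ 4) ^ 2)
  have h2 : Measurable (fun u : ℝ => hestG κ θ ξ v ρ t (((U h : ℝ) + Complex.I * (h ^ 3 * u : ℝ)) / (h ^ 4 : ℝ)) ((h ^ 4) ^ 2)) := by
    apply h1.comp
    fun_prop
  fun_prop

lemma core (κ θ ξ v ρ t : ℝ) (hκ : 0 < κ) (hθ : 0 < θ) (hξ : 0 < ξ)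
    (hv : 0 < v) (hρ : ρ ∈ Set.Ioo (-1 : ℝ) 1) (ht : 0 < t) (k : ℝ) (hk : 0 < k) (β V m a0 : ℝ)
    (hβd : β = betaT κ ξ t) (hVd : V = v * Real.exp (-(κ * t))) (hmd : m = 2 * κ * θ / ξ ^ 2)
    (ha0 : a0 = 1 / Real.sqrt β) (U : ℝ → ℝ)
    (hU : ∀ᶠ h in 𝓝[>] (0:ℝ), U h ∈ hestDom κ θ ξ v ρ t (h ^ 8) ∧
      deriv (hestLambda κ θ ξ v ρ t (h ^ 8)) (U h) = (k : ℂ)) :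
    ∃ r0 r1 : ℝ, 0 < r0 ∧ V * a0 * r0 ^ 2 = k ∧ 
      2 * V * r0 * r1 = -k * (-a0 / (2 * r0)) / a0 ^ 2 - 2 * β * m * r0 ∧
      Tendsto (fun h : ℝ => ((∫ u, Complex.exp (EE κ θ ξ v ρ t k U h u) * DD U h u) - 
          β * (Real.sqrt (Real.pi / (2 * V * r0 ^ 3)) : ℝ)) / (h : ℂ) ^ 2) (𝓝[>] 0) 
        (𝓝 (β * (Real.sqrt (Real.pi / (2 * V * r0 ^ 3)) : ℝ) * 
          (((1 / r0 : ℝ) : ℂ) + ((-2 * V * (3 * r0 ^ 2 * r1 - r0 ^ 2) - 2 * m * β * r0 ^ 2 - V * r0 ^ 2 / 2 : ℝ) : ℂ) / (2 * (2 * V * r0 ^ 3 : ℝ))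
            + 3 * ((8 * V * β * r0 ^ 5 : ℝ) : ℂ) / (2 * (2 * V * r0 ^ 3 : ℝ)) ^ 2
            + 15 * ((Complex.I * ((-4 * V * β * a0 * r0 ^ 4 : ℝ) : ℂ)) ^ 2 / 2) / (2 * (2 * V * r0 ^ 3 : ℝ)) ^ 3))) := by
  have hβ : 0 < β := by rw [hβd]; exact betaT_pos κ ξ t hκ hξ ht
  have hV : 0 < V := by rw [hVd]; positivity
  have hm : 0 < m := by rw [hmd]; positivity
  have ha : 0 < a0 := by rw [ha0]; positivity
  have hβa : β * a0 ^ 2 = 1 := by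
    rw [ha0, div_pow, Real.sq_sqrt hβ.le]; field_simp
  have hρ2 : 0 < 1 - ρ ^ 2 := by nlinarith [hρ.1, hρ.2]
  set R' : ℝ := (a0 + 2) / Real.sqrt (1 - ρ ^ 2) with hR'
  have hR'p : 0 < R' := by positivity
  have hRR : (a0 + 2) ^ 2 ≤ (1 - ρ ^ 2) * R' ^ 2 := by
    rw [hR', div_pow, Real.sq_sqrt hρ2.le]
    apply le_of_eq; field_simp
  set R : ℝ := a0 + 2 + R' with hR
  obtain ⟨M, hM, ε, r0, r1, HH, hr0, e1, e2, lU, lr, dU, dr⟩ := basic κ θ ξ v ρ t hκ hθ hξ hv hρ ht k hk R β V m a0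
    hβd hVd hmd ha0 (by rw [← ha0]; linarith) U hU
  refine ⟨r0, r1, hr0, e1, e2, ?_⟩
  obtain ⟨C1, hC1, α, γ, δ, hα, hγ, hδ, hI⟩ := inner_region κ θ ξ v ρ t k R M β V m a0 r0 r1 U ε hκ hξ hρ ht hβd hVd hmd
    hβ hV hm hM ha hβa ha0 (by linarith) HH hr0 lU lr dU dr
  obtain ⟨C2, hC2, hO⟩ := outer_region κ θ ξ v ρ t k R R' M β V m a0 r0 U ε hκ hθ hξ hv hρ ht hβd hVd hmd
    hβ hV hm hM ha hβa hR'p hRR (by linarith) HH hr0 lU lr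
  obtain ⟨⟨C3, hC3, hD⟩, hDl⟩ := denom β a0 r0 U hβ ha hβa hr0 lU dU
  have hpos : ∀ᶠ h : ℝ in 𝓝[>] 0, 0 < h := self_mem_nhdsWithin
  refine laplace (EE κ θ ξ v ρ t k U) (DD U) α γ δ (2 * V * r0 ^ 3) β (1 / r0) (C1 + C2 + C3)
    (Complex.I * ((-4 * V * β * a0 * r0 ^ 4 : ℝ) : ℂ)) _ _ (by positivity) (by positivity) hα hγ hδ ?_ ?_ ?_ hDl
    (Eventually.of_forall fun h => meas_int κ θ ξ v ρ t k U h)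
  · filter_upwards [hI, hpos] with h h1 hp u hu
    refine (h1 u hu).trans ?_
    have : 0 ≤ h ^ 3 * (1 + |u|) ^ 5 := by positivity
    gcongr; linarith
  · filter_upwards [hO, hpos] with h h1 hp u hu
    refine (h1 u hu).trans ?_
    gcongr; linarith
  · filter_upwards [hD, hpos] with h h1 hp u
    refine (h1 u).trans ?_
    gcongr; linarith

lemma phi_eq (κ θ ξ v ρ t k : ℝ) (ustar : ℝ → ℝ) (h u : ℝ) (hh : 0 < h) :
    hestPhi κ θ ξ v ρ t k ustar (h ^ 8) u = Complex.exp (EE κ θ ξ v ρ t k (fun h => ustar (h ^ 8)) h u) := by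
  have e1 : (h ^ 8) ^ (-(1:ℝ) / 8) = h⁻¹ := by
    rw [← Real.rpow_natCast, ← Real.rpow_mul hh.le, ← Real.rpow_neg_one]; norm_num
  have e2 : (h ^ 8) ^ (-(1:ℝ) / 2) = (h ^ 4)⁻¹ := by
    rw [← Real.rpow_natCast, ← Real.rpow_mul hh.le, ← Real.rpow_natCast, ← Real.rpow_neg hh.le]; norm_num
  have e3 : (h ^ 8) ^ ((3:ℝ) / 8) = h ^ 3 := by
    rw [← Real.rpow_natCast, ← Real.rpow_mul hh.le, ← Real.rpow_natCast]; norm_num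
  have e4 : h ^ 8 = (h ^ 4) ^ 2 := by ring
  have hhc : (h : ℂ) ≠ 0 := by exact_mod_cast hh.ne'
  unfold hestPhi EE
  rw [e1, e2, e3]
  beta_reduce
  generalize ustar (h ^ 8) = y
  rw [e4, lambda_eq κ θ ξ v ρ t (h ^ 4) (by positivity), lambda_eq κ θ ξ v ρ t (h ^ 4) (by positivity)]
  have e5 : (y : ℂ) + Complex.I * u * ((h ^ 3 : ℝ) : ℂ) = y + Complex.I * ((h ^ 3 * u : ℝ) : ℂ) := by push_cast; ring
  rw [e5]
  generalize hestG κ θ ξ v ρ t ((y + Complex.I * ((h ^ 3 * u : ℝ) : ℂ)) / ((h ^ 4 : ℝ) : ℂ)) ((h ^ 4) ^ 2) = g1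
  generalize hestG κ θ ξ v ρ t (y / ((h ^ 4 : ℝ) : ℂ)) ((h ^ 4) ^ 2) = g2
  congr 1
  push_cast
  field_simp
  ring

set_option maxHeartbeats 1600000 in
lemma coefs (κ θ ξ v ρ t : ℝ) (hκ : 0 < κ) (hθ : 0 < θ) (hξ : 0 < ξ)
    (hv : 0 < v) (k : ℝ) (hk : 0 < k) (β V m a0 r0 r1 : ℝ) (hβ : 0 < β)
    (hβd : β = betaT κ ξ t) (hVd : V = v * Real.exp (-(κ * t))) (hmd : m = 2 * κ * θ / ξ ^ 2)
    (ha0 : a0 = 1 / Real.sqrt β) (hr0 : 0 < r0) (e1 : V * a0 * r0 ^ 2 = k)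
    (e2 : 2 * V * r0 * r1 = -k * (-a0 / (2 * r0)) / a0 ^ 2 - 2 * β * m * r0) :
    0 < coefZeta κ θ ξ v ρ t k ∧ coefZeta κ θ ξ v ρ t k ^ 2 = 2 * (2 * V * r0 ^ 3) ∧
    coefP1 κ θ ξ v ρ t k = 1 / r0 + (-2 * V * (3 * r0 ^ 2 * r1 - r0 ^ 2) - 2 * m * β * r0 ^ 2 - V * r0 ^ 2 / 2) / (2 * (2 * V * r0 ^ 3))
            + 3 * (8 * V * β * r0 ^ 5) / (2 * (2 * V * r0 ^ 3)) ^ 2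
            + 15 * (-(-4 * V * β * a0 * r0 ^ 4) ^ 2 / 2) / (2 * (2 * V * r0 ^ 3)) ^ 3 := by
  have hV : 0 < V := by rw [hVd]; positivity
  have hm : 0 < m := by rw [hmd]; positivity
  have ha : 0 < a0 := by rw [ha0]; positivity
  have hβa : β * a0 ^ 2 = 1 := by
    rw [ha0, div_pow, Real.sq_sqrt hβ.le]; field_simp
  set S : ℝ := Real.sqrt v * Real.exp (-(κ * t) / 2) with hS
  have hSp : 0 < S := by positivity
  have hS2 : S ^ 2 = V := by
    rw [hS, mul_pow, Real.sq_sqrt hv.le, ← Real.exp_nat_mul, hVd]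
    congr 2; push_cast; ring
  set s : ℝ := Real.sqrt k with hs
  have hsp : 0 < s := by positivity
  have hs2 : s ^ 2 = k := Real.sq_sqrt hk.le
  set b : ℝ := β ^ ((1:ℝ) / 4) with hb
  have hbp : 0 < b := by positivity
  have hb2 : b ^ 2 = 1 / a0 := by
    rw [hb, ← Real.rpow_natCast, ← Real.rpow_mul hβ.le, ha0, Real.sqrt_eq_rpow]; norm_num
  have cA0 : coefA0 κ θ ξ v ρ t k = a0 := by
    unfold coefA0 sgn'
    rw [if_pos hk.le, ← hβd, ha0]
  have hE : S / (s * b) = 1 / r0 := by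
    have : (S / (s * b)) ^ 2 = (1 / r0) ^ 2 := by
      rw [div_pow S, mul_pow s b, hS2, hs2, hb2, ← e1]; field_simp
    exact (pow_left_inj₀ (by positivity) (by positivity) two_ne_zero).1 this
  have cA1 : coefA1 κ θ ξ v ρ t k = -a0 / (2 * r0) := by
    unfold coefA1
    rw [cA0, ← hβd, abs_of_pos hk, ← hs, ← hb]
    calc _ = -a0 * (S / (s * b)) / 2 := by rw [hS]; field_simp
      _ = _ := by rw [hE]; field_simp
  have cE0 : coefE0 κ θ ξ v ρ t k = 1 / r0 := by
    unfold coefE0; rw [cA0, cA1]; field_simp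
  have hr1 : r1 = 1 / 4 - β * m / V := by
    rw [← e1] at e2
    field_simp at e2 ⊢
    nlinarith
  have cR : coefR κ θ ξ v ρ t k = a0 ^ 2 / (8 * r0 ^ 2) - m / (2 * V * r0 ^ 2) := by
    unfold coefR
    rw [cA1, abs_of_pos hk, ← hβd, ← e1]
    have : Real.sqrt β = 1 / a0 := by rw [ha0]; field_simp
    rw [this, hmd]
    field_simp
    ring
  have cE1 : coefE1 κ θ ξ v ρ t k = -r1 / r0 ^ 2 := by
    unfold coefE1
    rw [cR, ← hβd, hr1]
    have : -2 * β * (a0 ^ 2 / (8 * r0 ^ 2) - m / (2 * V * r0 ^ 2)) = -(β * a0 ^ 2) / (4 * r0 ^ 2) + β * m / (V * r0 ^ 2) := by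
      field_simp; ring
    rw [this, hβa]
    field_simp; ring
  have hβe : β = 1 / a0 ^ 2 := by field_simp; linarith
  have hVe : ∀ x : ℝ, x * v * Real.exp (-(κ * t)) = x * V := by intro x; rw [hVd]; ring
  have hVe' : v * Real.exp (-(κ * t)) = V := hVd.symm
  have cP0 : coefPsi0 κ θ ξ v ρ t k = -2 * a0 * β * m * r0 := by
    unfold coefPsi0
    rw [hVe, cA0, cE0, cA1, cE1, ← hβd, hr1, hβe]
    field_simp; ring
  have cP1 : coefPsi1 κ θ ξ v ρ t k = -4 * V * β * a0 * r0 ^ 4 := by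
    unfold coefPsi1
    rw [cA0, cE0, ← hβd, hVd]
    field_simp
  have cP2 : coefPsi2 κ θ ξ v ρ t k = -6 * V * r0 ^ 2 * r1 + 3 / 2 * V * r0 ^ 2 := by
    unfold coefPsi2
    rw [hVe', cA0, cE0, cA1, cE1, ← hβd, hβe]
    field_simp; ring
  have cP3 : coefPsi3 κ θ ξ v ρ t k = 8 * V * β * r0 ^ 5 := by
    unfold coefPsi3
    rw [cE0, ← hβd, hVd]
    field_simp
  have hq1 : 4 * κ * θ * β / ξ ^ 2 = 2 * m * β := by rw [hmd]; ring
  have hq2 : ∀ x : ℝ, x * (2 * κ * θ + ξ ^ 2) / ((1 / r0) ^ 2 * ξ ^ 2) = x * (m + 1) * r0 ^ 2 := by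
    intro x; rw [hmd]; field_simp
  have c2a : coefPhi2a κ θ ξ v ρ t k = -2 * V * (3 * r0 ^ 2 * r1 - r0 ^ 2) - 2 * m * β * r0 ^ 2 - V * r0 ^ 2 / 2 := by
    unfold coefPhi2a
    rw [cP2, cP0, cA0, cE0, ← hβd, hq1, hq2, hβe]
    field_simp; ring
  have c2b : coefPhi2b κ θ ξ v ρ t k = 8 * V * β * r0 ^ 5 := by
    unfold coefPhi2b
    rw [cP3, cP0, cP1, cA0, cE0, ← hβd, hq1]
    field_simp; ring
  have c2c : coefPhi2c κ θ ξ v ρ t k = -(-4 * V * β * a0 * r0 ^ 4) ^ 2 / 2 := by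
    unfold coefPhi2c
    rw [cP1]
  have hZp : 0 < coefZeta κ θ ξ v ρ t k := by
    unfold coefZeta; rw [cE0]; positivity
  have hZ2 : coefZeta κ θ ξ v ρ t k ^ 2 = 2 * (2 * V * r0 ^ 3) := by
    unfold coefZeta
    rw [cE0, div_pow]
    have : ((1 / r0) ^ ((3:ℝ) / 2)) ^ 2 = (1 / r0) ^ 3 := by
      rw [← Real.rpow_natCast, ← Real.rpow_mul (by positivity), ← Real.rpow_natCast]; norm_num
    rw [this, mul_assoc, ← hS, mul_pow, hS2]
    field_simp
  refine ⟨hZp, hZ2, ?_⟩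
  unfold coefP1
  have h4 : coefZeta κ θ ξ v ρ t k ^ 4 = (2 * (2 * V * r0 ^ 3)) ^ 2 := by rw [← hZ2]; ring
  have h6 : coefZeta κ θ ξ v ρ t k ^ 6 = (2 * (2 * V * r0 ^ 3)) ^ 3 := by rw [← hZ2]; ring
  rw [h4, h6, hZ2, cE0, c2a, c2b, c2c]

lemma integral_eq (κ θ ξ v ρ t k : ℝ) (ustar : ℝ → ℝ) (h : ℝ) (hh : 0 < h) :
    (∫ u : ℝ, (((h ^ 8) ^ ((7 : ℝ) / 8) : ℝ) : ℂ) * hestPhi κ θ ξ v ρ t k ustar (h ^ 8) u /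
              ((((ustar (h ^ 8) : ℝ) : ℂ) + Complex.I * (((h ^ 8) ^ ((3 : ℝ) / 8) : ℝ) : ℂ) * (u : ℂ)) *
                (((ustar (h ^ 8) - Real.sqrt (h ^ 8) : ℝ) : ℂ) +
                  Complex.I * (((h ^ 8) ^ ((3 : ℝ) / 8) : ℝ) : ℂ) * (u : ℂ)))) =
    (((h ^ 8) ^ ((7 : ℝ) / 8) : ℝ) : ℂ) * ∫ u : ℝ, Complex.exp (EE κ θ ξ v ρ t k (fun h => ustar (h ^ 8)) h u)
      * DD (fun h => ustar (h ^ 8)) h u := by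
  rw [← integral_const_mul]
  congr 1
  funext u
  have e3 : (h ^ 8) ^ ((3:ℝ) / 8) = h ^ 3 := by
    rw [← Real.rpow_natCast, ← Real.rpow_mul hh.le, ← Real.rpow_natCast]; norm_num
  have e4 : Real.sqrt (h ^ 8) = h ^ 4 := by
    rw [show h ^ 8 = (h ^ 4) ^ 2 by ring]
    exact Real.sqrt_sq (by positivity)
  rw [phi_eq κ θ ξ v ρ t k ustar h u hh, e3, e4]
  unfold DD
  have e5 : Complex.I * ((h ^ 3 : ℝ) : ℂ) * u = Complex.I * ((h ^ 3 * u : ℝ) : ℂ) := by push_cast; ring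
  rw [e5]
  ring

theorem stmt17 (κ θ ξ v ρ t : ℝ) (hκ : 0 < κ) (hθ : 0 < θ) (hξ : 0 < ξ)
    (hv : 0 < v) (hρ : ρ ∈ Set.Ioo (-1 : ℝ) 1) (ht : 0 < t)
    (k : ℝ) (hk : 0 < k) (ustar : ℝ → ℝ)
    (hustar : ∀ᶠ τ in 𝓝[>] (0 : ℝ), ustar τ ∈ hestDom κ θ ξ v ρ t τ ∧
      deriv (hestLambda κ θ ξ v ρ t τ) (ustar τ) = (k : ℂ)) :
    ∃ err : ℝ → ℂ, err =o[𝓝[>] (0 : ℝ)] (fun τ : ℝ => τ ^ ((1 : ℝ) / 4)) ∧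
      ∀ᶠ τ in 𝓝[>] (0 : ℝ),
        ((1 / (2 * Real.pi) : ℝ) : ℂ) *
            ∫ u : ℝ, ((τ ^ ((7 : ℝ) / 8) : ℝ) : ℂ) * hestPhi κ θ ξ v ρ t k ustar τ u /
              ((((ustar τ : ℝ) : ℂ) + Complex.I * ((τ ^ ((3 : ℝ) / 8) : ℝ) : ℂ) * (u : ℂ)) *
                (((ustar τ - Real.sqrt τ : ℝ) : ℂ) +
                  Complex.I * ((τ ^ ((3 : ℝ) / 8) : ℝ) : ℂ) * (u : ℂ))) =
          ((τ ^ ((7 : ℝ) / 8) * betaT κ ξ t /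
              (coefZeta κ θ ξ v ρ t k * Real.sqrt (2 * Real.pi)) : ℝ) : ℂ) *
            (1 + ((coefP1 κ θ ξ v ρ t k : ℝ) : ℂ) * ((τ ^ ((1 : ℝ) / 4) : ℝ) : ℂ) + err τ) := by
  have hβ := betaT_pos κ ξ t hκ hξ ht
  obtain ⟨r0, r1, hr0, e1, e2, lim⟩ := core κ θ ξ v ρ t hκ hθ hξ hv hρ ht k hk (betaT κ ξ t) (v * Real.exp (-(κ * t)))
    (2 * κ * θ / ξ ^ 2) (1 / Real.sqrt (betaT κ ξ t)) rfl rfl rfl rfl (fun h => ustar (h ^ 8))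
    ((tendsto_pow_pos 8 (by norm_num)).eventually hustar)
  obtain ⟨hZp, hZ2, hP⟩ := coefs κ θ ξ v ρ t hκ hθ hξ hv k hk (betaT κ ξ t) (v * Real.exp (-(κ * t)))
    (2 * κ * θ / ξ ^ 2) (1 / Real.sqrt (betaT κ ξ t)) r0 r1 hβ rfl rfl rfl rfl hr0 e1 e2
  have hP' := congrArg (fun x : ℝ => (x : ℂ)) hP
  set V : ℝ := v * Real.exp (-(κ * t)) with hV
  set β : ℝ := betaT κ ξ t with hβd
  set m : ℝ := 2 * κ * θ / ξ ^ 2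
  set a0 : ℝ := 1 / Real.sqrt β
  set ζ := coefZeta κ θ ξ v ρ t k with hζ
  set p := coefP1 κ θ ξ v ρ t k with hp
  set J : ℝ → ℂ := fun h => ∫ u, Complex.exp (EE κ θ ξ v ρ t k (fun h => ustar (h ^ 8)) h u) * DD (fun h => ustar (h ^ 8)) h u with hJ
  have hVp : 0 < V := by positivity
  set s : ℝ := Real.sqrt (Real.pi / (2 * V * r0 ^ 3)) with hs
  have hsp : 0 < s := by
    have := Real.pi_pos
    positivity
  have hsζ : s = Real.sqrt (2 * Real.pi) / ζ := by
    rw [hs, show Real.pi / (2 * V * r0 ^ 3) = (2 * Real.pi) / ζ ^ 2 by rw [hZ2]; field_simp, Real.sqrt_div (by positivity),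
      Real.sqrt_sq hZp.le]
  have lim2 : Tendsto (fun h : ℝ => (J h - β * s) / (h : ℂ) ^ 2) (𝓝[>] 0) (𝓝 (β * s * p)) := by
    refine lim.trans (le_of_eq ?_)
    congr 2
    rw [hP']
    have : (Complex.I * ((-4 * V * β * a0 * r0 ^ 4 : ℝ) : ℂ)) ^ 2 / 2 = ((-(-4 * V * β * a0 * r0 ^ 4) ^ 2 / 2 : ℝ) : ℂ) := by
      rw [mul_pow, Complex.I_sq]; push_cast; ring
    rw [this]
    push_cast
    ring
  have hβc : (β : ℂ) ≠ 0 := by exact_mod_cast hβ.ne'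
  have hsc : (s : ℂ) ≠ 0 := by exact_mod_cast hsp.ne'
  have hr : Tendsto (fun τ : ℝ => τ ^ ((1:ℝ) / 8)) (𝓝[>] 0) (𝓝[>] 0) := by
    apply tendsto_nhdsWithin_of_tendsto_nhds_of_eventually_within
    · have : Tendsto (fun τ : ℝ => τ ^ ((1:ℝ) / 8)) (𝓝 0) (𝓝 (0 ^ ((1:ℝ) / 8))) :=
        (Real.continuous_rpow_const (by norm_num)).tendsto 0
      rw [Real.zero_rpow (by norm_num)] at this
      exact this.mono_left nhdsWithin_le_nhds
    · filter_upwards [self_mem_nhdsWithin] with τ hτ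
      have : (0:ℝ) < τ := hτ
      exact Real.rpow_pos_of_pos this _
  refine ⟨fun τ => J (τ ^ ((1:ℝ) / 8)) / (β * s) - 1 - p * ((τ ^ ((1 : ℝ) / 4) : ℝ) : ℂ), ?_, ?_⟩
  · rw [← isLittleO_norm_right]
    have key : (fun τ : ℝ => J (τ ^ ((1:ℝ) / 8)) / (β * s) - 1 - p * ((τ ^ ((1 : ℝ) / 4) : ℝ) : ℂ)) =o[𝓝[>] (0 : ℝ)]
        (fun τ : ℝ => ((τ ^ ((1 : ℝ) / 4) : ℝ) : ℂ)) := by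
      rw [isLittleO_iff_tendsto']
      · have l := ((lim2.comp hr).div_const (β * s : ℂ)).sub_const (p : ℂ)
        have z : (β * s * p / (β * s) - p : ℂ) = 0 := by field_simp; ring
        rw [z] at l
        refine l.congr' ?_
        filter_upwards [self_mem_nhdsWithin] with τ hτ
        have hτ : (0:ℝ) < τ := hτ
        have e : τ ^ ((1:ℝ) / 4) = (τ ^ ((1:ℝ) / 8)) ^ 2 := by
          rw [← Real.rpow_natCast, ← Real.rpow_mul hτ.le]; norm_num
        have hn : ((τ ^ ((1:ℝ) / 8) : ℝ) : ℂ) ≠ 0 := by exact_mod_cast (Real.rpow_pos_of_pos hτ _).ne'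
        rw [e]
        simp only [Function.comp]
        push_cast
        field_simp
      · filter_upwards [self_mem_nhdsWithin] with τ hτ h0
        have hτ : (0:ℝ) < τ := hτ
        exact absurd (by exact_mod_cast h0) (Real.rpow_pos_of_pos hτ ((1:ℝ) / 4)).ne'
    have key2 := isLittleO_norm_right.2 key
    simpa only [Complex.norm_real] using key2
  · filter_upwards [self_mem_nhdsWithin] with τ hτ
    have hτ : (0:ℝ) < τ := hτ
    have hh : 0 < τ ^ ((1:ℝ) / 8) := Real.rpow_pos_of_pos hτ _
    have h8 : (τ ^ ((1:ℝ) / 8)) ^ 8 = τ := by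
      rw [← Real.rpow_natCast, ← Real.rpow_mul hτ.le]; norm_num
    have ie := integral_eq κ θ ξ v ρ t k ustar (τ ^ ((1:ℝ) / 8)) hh
    rw [h8] at ie
    rw [ie]
    have hJe : (∫ u : ℝ, Complex.exp (EE κ θ ξ v ρ t k (fun h => ustar (h ^ 8)) (τ ^ ((1:ℝ) / 8)) u)
      * DD (fun h => ustar (h ^ 8)) (τ ^ ((1:ℝ) / 8)) u) = J (τ ^ ((1:ℝ) / 8)) := rfl
    rw [hJe]
    generalize J (τ ^ ((1:ℝ) / 8)) = j
    generalize τ ^ ((7:ℝ) / 8) = x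
    generalize τ ^ ((1:ℝ) / 4) = y
    have e3 : (x * β / (ζ * Real.sqrt (2 * Real.pi)) : ℝ) = (1 / (2 * Real.pi)) * x * (β * s) := by
      rw [hsζ]
      have hpp := Real.pi_pos
      have h2 : Real.sqrt (2 * Real.pi) ^ 2 = 2 * Real.pi := Real.sq_sqrt (by positivity)
      have h3 : 0 < Real.sqrt (2 * Real.pi) := by positivity
      field_simp
      rw [h2]
      ring
    rw [e3]
    push_cast
    field_simp
    ring

end
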